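/- Assume a ∈ K̂ with a > 0 on the closure of A and p > 2. Let {u_n} ⊂ K, and for each n let v_n be a C² function on the closure of A with −Δv_n + v_n = a(x) u_n(x)^{p−1} pointwise in A and v_n = 0 on ∂A. If the sequence {I(u_n)} is bounded and ‖u_n − v_n‖_{H¹(A)} → 0 as n → ∞, then there exist a subsequence {u_{n_k}} and a function u ∈ K such that ‖u_{n_k} − u‖_{H¹(A)} → 0 and u is a weak solution of −Δu + u = a(x)|u|^{p−2}u in A with u = 0 on ∂A. -/

import Mathlib

open MeasureTheory Real Set

noncomputable section

/-- The open annulus `{x : R₀ < |x| < R₁}` in `ℝ^N`. -/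
def annulus (N : ℕ) (R₀ R₁ : ℝ) : Set (EuclideanSpace ℝ (Fin N)) :=
  {x | R₀ < ‖x‖ ∧ ‖x‖ < R₁}

/-- The last coordinate `x_N` of a point of `ℝ^N`. -/
def lastCoord {N : ℕ} (x : EuclideanSpace ℝ (Fin N)) : ℝ :=
  if h : 0 < N then x ⟨N - 1, by omega⟩ else 0

/-- The polar angle `θ = arcsin (x_N / |x|)`. -/
def angleOf {N : ℕ} (x : EuclideanSpace ℝ (Fin N)) : ℝ :=
  Real.arcsin (lastCoord x / ‖x‖)

/-- `u` is axially symmetric on the closed annulus with representative `𝔲 = 𝔲(r,θ)`. -/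
def IsAxiallySymmRep (N : ℕ) (R₀ R₁ : ℝ) (u : EuclideanSpace ℝ (Fin N) → ℝ)
    (𝔲 : ℝ → ℝ → ℝ) : Prop :=
  ∀ x ∈ closure (annulus N R₀ R₁), u x = 𝔲 ‖x‖ (angleOf x)

/-- Membership in the cone `K̂`: `C¹` on the closed annulus, nonnegative, axially symmetric,
even in `θ` and nonincreasing in `θ` on `[0, π/2]`. -/
def memKhat (N : ℕ) (R₀ R₁ : ℝ) (u : EuclideanSpace ℝ (Fin N) → ℝ) : Prop :=
  ContDiffOn ℝ 1 u (closure (annulus N R₀ R₁)) ∧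
  (∀ x ∈ closure (annulus N R₀ R₁), 0 ≤ u x) ∧
  ∃ 𝔲 : ℝ → ℝ → ℝ,
    IsAxiallySymmRep N R₀ R₁ u 𝔲 ∧
    (∀ r ∈ Icc R₀ R₁, ∀ θ ∈ Icc (-(π / 2)) (π / 2), 𝔲 r (-θ) = 𝔲 r θ) ∧
    (∀ r ∈ Icc R₀ R₁, AntitoneOn (𝔲 r) (Icc 0 (π / 2)))

/-- `C¹₀(A)` : `C¹` on the closed annulus, vanishing on the boundary. -/
def memC10 (N : ℕ) (R₀ R₁ : ℝ) (u : EuclideanSpace ℝ (Fin N) → ℝ) : Prop :=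
  ContDiffOn ℝ 1 u (closure (annulus N R₀ R₁)) ∧
  ∀ x : EuclideanSpace ℝ (Fin N), (‖x‖ = R₀ ∨ ‖x‖ = R₁) → u x = 0

/-- The cone `K = K̂ ∩ C¹₀(A)`. -/
def memK (N : ℕ) (R₀ R₁ : ℝ) (u : EuclideanSpace ℝ (Fin N) → ℝ) : Prop :=
  memKhat N R₀ R₁ u ∧ ∀ x : EuclideanSpace ℝ (Fin N), (‖x‖ = R₀ ∨ ‖x‖ = R₁) → u x = 0

/-- The squared `H¹(A)`-norm `∫_A (|∇u|² + u²) dx`. -/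
def H1sq (N : ℕ) (R₀ R₁ : ℝ) (u : EuclideanSpace ℝ (Fin N) → ℝ) : ℝ :=
  ∫ x in annulus N R₀ R₁,
    (‖fderivWithin ℝ u (closure (annulus N R₀ R₁)) x‖ ^ 2 + (u x) ^ 2)

/-- The energy functional `I(u) = ½‖u‖²_{H¹} − (1/p) ∫_A a |u|^p`. -/
def funcI (N : ℕ) (R₀ R₁ : ℝ) (a : EuclideanSpace ℝ (Fin N) → ℝ) (p : ℝ)
    (u : EuclideanSpace ℝ (Fin N) → ℝ) : ℝ :=
  (1 / 2) * H1sq N R₀ R₁ u - (1 / p) * ∫ x in annulus N R₀ R₁, a x * |u x| ^ p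

/-- The Nehari set `N_K`. -/
def memNehari (N : ℕ) (R₀ R₁ : ℝ) (a : EuclideanSpace ℝ (Fin N) → ℝ) (p : ℝ)
    (u : EuclideanSpace ℝ (Fin N) → ℝ) : Prop :=
  memK N R₀ R₁ u ∧ (∃ x ∈ annulus N R₀ R₁, u x ≠ 0) ∧
  H1sq N R₀ R₁ u = ∫ x in annulus N R₀ R₁, a x * |u x| ^ p

/-- The Nehari level `c_I = inf_{N_K} I`. -/
def cI (N : ℕ) (R₀ R₁ : ℝ) (a : EuclideanSpace ℝ (Fin N) → ℝ) (p : ℝ) : ℝ :=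
  sInf {c | ∃ u, memNehari N R₀ R₁ a p u ∧ c = funcI N R₀ R₁ a p u}

/-- Test functions `C_c^∞(A)`. -/
def IsTestFun (N : ℕ) (R₀ R₁ : ℝ) (φ : EuclideanSpace ℝ (Fin N) → ℝ) : Prop :=
  ContDiff ℝ (⊤ : ℕ∞) φ ∧ HasCompactSupport φ ∧ tsupport φ ⊆ annulus N R₀ R₁

/-- Weak solution of `−Δu + u = a(x)|u|^{p−2}u` in `A`, `u = 0` on `∂A`. -/
def IsWeakSolution (N : ℕ) (R₀ R₁ : ℝ) (a : EuclideanSpace ℝ (Fin N) → ℝ) (p : ℝ)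
    (u : EuclideanSpace ℝ (Fin N) → ℝ) : Prop :=
  memC10 N R₀ R₁ u ∧
  ∀ φ : EuclideanSpace ℝ (Fin N) → ℝ, IsTestFun N R₀ R₁ φ →
    (∫ x in annulus N R₀ R₁,
      (fderivWithin ℝ u (closure (annulus N R₀ R₁)) x (gradient φ x) + u x * φ x))
    = ∫ x in annulus N R₀ R₁, a x * |u x| ^ (p - 2) * u x * φ x

/-- The (classical) Laplacian, as the sum of second partial derivatives. -/
def lapl {N : ℕ} (u : EuclideanSpace ℝ (Fin N) → ℝ) (x : EuclideanSpace ℝ (Fin N)) : ℝ :=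
  ∑ i : Fin N,
    fderiv ℝ (fun y => fderiv ℝ u y (EuclideanSpace.single i 1)) x (EuclideanSpace.single i 1)

/-- The inclusion `ℝ^{N-1} → ℝ^N`, `x' ↦ (x',0)`. -/
def embedHyper (N : ℕ) (x' : EuclideanSpace ℝ (Fin (N - 1))) : EuclideanSpace ℝ (Fin N) :=
  (WithLp.equiv 2 (Fin N → ℝ)).symm
    (fun j => if h : (j : ℕ) < N - 1 then x' ⟨j, h⟩ else 0)

/-- A `C¹` distance on the closed annulus. -/
def C1dist (N : ℕ) (R₀ R₁ : ℝ) (u v : EuclideanSpace ℝ (Fin N) → ℝ) : ℝ :=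
  (⨆ x : closure (annulus N R₀ R₁), |u x - v x|) +
  (⨆ x : closure (annulus N R₀ R₁),
    ‖fderivWithin ℝ u (closure (annulus N R₀ R₁)) x
      - fderivWithin ℝ v (closure (annulus N R₀ R₁)) x‖)

end

section Part1
section geom
variable {N : ℕ} {R₀ R₁ : ℝ}

lemma isOpen_annulus : IsOpen (annulus N R₀ R₁) := by
  have h : annulus N R₀ R₁ = (fun x : EuclideanSpace ℝ (Fin N) => ‖x‖) ⁻¹' (Ioo R₀ R₁) := by
    ext x; simp [annulus]
  rw [h]; exact isOpen_Ioo.preimage continuous_norm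

lemma closure_annulus_subset :
    closure (annulus N R₀ R₁) ⊆ {x | R₀ ≤ ‖x‖ ∧ ‖x‖ ≤ R₁} := by
  apply closure_minimal
  · intro x hx; exact ⟨hx.1.le, hx.2.le⟩
  · have h : {x : EuclideanSpace ℝ (Fin N) | R₀ ≤ ‖x‖ ∧ ‖x‖ ≤ R₁}
      = (fun x : EuclideanSpace ℝ (Fin N) => ‖x‖) ⁻¹' (Icc R₀ R₁) := by
      ext x; simp
    rw [h]; exact isClosed_Icc.preimage continuous_norm

/-- the interior ball through a point of the closed annulus -/
lemma closedBall_subset_annulus (hR₀ : 0 < R₀) (hR : R₀ < R₁) {x : EuclideanSpace ℝ (Fin N)}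
    (h0 : R₀ ≤ ‖x‖) (h1 : ‖x‖ ≤ R₁) :
    ∃ c : EuclideanSpace ℝ (Fin N), x ∈ Metric.closedBall c ((R₁ - R₀) / 2) ∧
      Metric.ball c ((R₁ - R₀) / 2) ⊆ annulus N R₀ R₁ := by
  have hx : 0 < ‖x‖ := by linarith
  refine ⟨((R₀ + R₁) / 2 / ‖x‖) • x, ?_, ?_⟩
  · rw [mem_closedBall_iff_norm]
    have : x - ((R₀ + R₁) / 2 / ‖x‖) • x = (1 - (R₀ + R₁) / 2 / ‖x‖) • x := by
      rw [sub_smul, one_smul]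
    rw [this, norm_smul, Real.norm_eq_abs, ← abs_of_pos hx, ← abs_mul, abs_of_pos hx]
    have : (1 - (R₀ + R₁) / 2 / ‖x‖) * ‖x‖ = ‖x‖ - (R₀ + R₁) / 2 := by field_simp
    rw [this, abs_le]; constructor <;> linarith
  · intro y hy
    rw [mem_ball_iff_norm] at hy
    have hc : ‖((R₀ + R₁) / 2 / ‖x‖) • x‖ = (R₀ + R₁) / 2 := by
      rw [norm_smul, Real.norm_eq_abs, abs_of_pos (div_pos (by linarith) hx)]; field_simp
    have h2 := abs_norm_sub_norm_le y (((R₀ + R₁) / 2 / ‖x‖) • x)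
    rw [hc] at h2
    have := abs_le.1 h2
    constructor <;> linarith [this.1, this.2]

lemma closure_annulus (hR₀ : 0 < R₀) (hR : R₀ < R₁) :
    closure (annulus N R₀ R₁) = {x | R₀ ≤ ‖x‖ ∧ ‖x‖ ≤ R₁} := by
  apply Subset.antisymm closure_annulus_subset
  rintro x ⟨h0, h1⟩
  obtain ⟨c, hxc, hc⟩ := closedBall_subset_annulus hR₀ hR h0 h1
  rw [← closure_ball c (by linarith)] at hxc
  exact closure_mono hc hxc

lemma mem_closure_annulus (hR₀ : 0 < R₀) (hR : R₀ < R₁) {x : EuclideanSpace ℝ (Fin N)} :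
    x ∈ closure (annulus N R₀ R₁) ↔ R₀ ≤ ‖x‖ ∧ ‖x‖ ≤ R₁ := by
  rw [closure_annulus hR₀ hR]; rfl

lemma isCompact_closure_annulus : IsCompact (closure (annulus N R₀ R₁)) := by
  apply Metric.isCompact_of_isClosed_isBounded isClosed_closure
  apply (Metric.isBounded_closedBall (x := (0 : EuclideanSpace ℝ (Fin N))) (r := R₁)).subset
  intro x hx
  simpa using (closure_annulus_subset hx).2

lemma uniqueDiffOn_cA (hR₀ : 0 < R₀) (hR : R₀ < R₁) :
    UniqueDiffOn ℝ (closure (annulus N R₀ R₁)) := by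
  intro x hx
  obtain ⟨h0, h1⟩ := closure_annulus_subset hx
  obtain ⟨c, hxc, hc⟩ := closedBall_subset_annulus hR₀ hR h0 h1
  have hu : UniqueDiffOn ℝ (Metric.closedBall c ((R₁ - R₀) / 2)) := by
    apply uniqueDiffOn_convex (convex_closedBall _ _)
    rw [interior_closedBall c (by linarith)]
    exact ⟨c, Metric.mem_ball_self (by linarith)⟩
  apply (hu x hxc).mono
  rw [← closure_ball c (by linarith)]
  exact closure_mono hc

lemma not_mem_of_bd {x : EuclideanSpace ℝ (Fin N)} (h : ‖x‖ = R₀ ∨ ‖x‖ = R₁) :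
    x ∉ annulus N R₀ R₁ := by
  rintro ⟨h0, h1⟩; rcases h with h | h <;> linarith

lemma bd_of_mem_closure {x : EuclideanSpace ℝ (Fin N)} (h : x ∈ closure (annulus N R₀ R₁))
    (h' : x ∉ annulus N R₀ R₁) : ‖x‖ = R₀ ∨ ‖x‖ = R₁ := by
  obtain ⟨h0, h1⟩ := closure_annulus_subset h
  by_contra! hc
  exact h' ⟨lt_of_le_of_ne h0 (Ne.symm hc.1), lt_of_le_of_ne h1 hc.2⟩

/-- First exit along a ray. -/
lemma first_exit {x e : EuclideanSpace ℝ (Fin N)} {T : ℝ} (hT : 0 < T)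
    (hx : x ∈ annulus N R₀ R₁) (hy : x + T • e ∉ annulus N R₀ R₁) :
    ∃ s, 0 < s ∧ s ≤ T ∧ (‖x + s • e‖ = R₀ ∨ ‖x + s • e‖ = R₁) ∧
      ∀ t, 0 ≤ t → t < s → x + t • e ∈ annulus N R₀ R₁ := by
  have hcont : Continuous (fun t : ℝ => x + t • e) := by fun_prop
  let S : Set ℝ := Icc 0 T ∩ (fun t : ℝ => x + t • e) ⁻¹' (annulus N R₀ R₁)ᶜ
  have hS : IsCompact S := isCompact_Icc.inter_right (isOpen_annulus.isClosed_compl.preimage hcont)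
  obtain ⟨s, hs, hmin⟩ := hS.exists_isLeast ⟨T, ⟨hT.le, le_rfl⟩, hy⟩
  have hall : ∀ t, 0 ≤ t → t < s → x + t • e ∈ annulus N R₀ R₁ := by
    intro t ht hts
    by_contra hc
    have := hmin (⟨⟨ht, hts.le.trans hs.1.2⟩, hc⟩ : t ∈ S)
    linarith
  have hs0 : 0 < s := by
    rcases hs.1.1.lt_or_eq with h | h
    · exact h
    · exfalso; apply hs.2; rw [← h]; simpa using hx
  refine ⟨s, hs0, hs.1.2, ?_, hall⟩
  apply bd_of_mem_closure _ hs.2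
  have : s ∈ closure (Ico 0 s) := by rw [closure_Ico hs0.ne]; exact ⟨hs0.le, le_rfl⟩
  exact map_mem_closure (f := fun t : ℝ => x + t • e) hcont this (fun t ht => hall t ht.1 ht.2)

lemma mem_nhds_cA {x : EuclideanSpace ℝ (Fin N)} (hx : x ∈ annulus N R₀ R₁) :
    closure (annulus N R₀ R₁) ∈ nhds x :=
  Filter.mem_of_superset (isOpen_annulus.mem_nhds hx) subset_closure

lemma fderivWithin_eq_of_mem {F : EuclideanSpace ℝ (Fin N) → ℝ} {x : EuclideanSpace ℝ (Fin N)}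
    (hx : x ∈ annulus N R₀ R₁) :
    fderivWithin ℝ F (closure (annulus N R₀ R₁)) x = fderiv ℝ F x :=
  fderivWithin_of_mem_nhds (mem_nhds_cA hx)

lemma ContDiffOn.diffAt {F : EuclideanSpace ℝ (Fin N) → ℝ}
    (hF : ContDiffOn ℝ 1 F (closure (annulus N R₀ R₁))) {x : EuclideanSpace ℝ (Fin N)}
    (hx : x ∈ annulus N R₀ R₁) : DifferentiableAt ℝ F x :=
  (hF.differentiableOn one_ne_zero).differentiableAt (mem_nhds_cA hx)

lemma exists_fderiv_bound (hR₀ : 0 < R₀) (hR : R₀ < R₁) {F : EuclideanSpace ℝ (Fin N) → ℝ}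
    (hF : ContDiffOn ℝ 1 F (closure (annulus N R₀ R₁))) :
    ∃ M, 0 ≤ M ∧ ∀ x ∈ annulus N R₀ R₁, ‖fderiv ℝ F x‖ ≤ M := by
  have hc := hF.continuousOn_fderivWithin (uniqueDiffOn_cA hR₀ hR) le_rfl
  obtain ⟨M, hM⟩ := isCompact_closure_annulus.exists_bound_of_continuousOn hc
  refine ⟨max M 0, le_max_right _ _, fun x hx => ?_⟩
  rw [← fderivWithin_eq_of_mem hx]
  exact (hM x (subset_closure hx)).trans (le_max_left _ _)

/-- The bound along a ray up to the first exit. -/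
lemma abs_le_exit {F : EuclideanSpace ℝ (Fin N) → ℝ} (hF : memC10 N R₀ R₁ F) {M : ℝ}
    (hM : ∀ x ∈ annulus N R₀ R₁, ‖fderiv ℝ F x‖ ≤ M)
    {x y : EuclideanSpace ℝ (Fin N)} (hx : x ∈ annulus N R₀ R₁) (hy : y ∉ annulus N R₀ R₁) :
    ∃ s, 0 < s ∧ s ≤ 1 ∧ |F x| ≤ M * (s * ‖y - x‖) ∧
      ∀ t, 0 ≤ t → t < s → x + t • (y - x) ∈ annulus N R₀ R₁ := by
  obtain ⟨s, hs0, hs1, hbd, hall⟩ := first_exit (e := y - x) one_pos hx (by simpa using hy)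
  refine ⟨s, hs0, hs1, ?_, hall⟩
  have hmem : ∀ t ∈ Icc 0 s, x + t • (y - x) ∈ closure (annulus N R₀ R₁) := by
    intro t ht
    have hcont : Continuous (fun t : ℝ => x + t • (y - x)) := by fun_prop
    have : t ∈ closure (Ico 0 s) := by rw [closure_Ico hs0.ne]; exact ht
    exact map_mem_closure (f := fun t : ℝ => x + t • (y - x)) hcont this (fun t ht => hall t ht.1 ht.2)
  have hcont : ContinuousOn (fun t : ℝ => F (x + t • (y - x))) (Icc 0 s) :=
    hF.1.continuousOn.comp (by fun_prop) hmem
  have hder : ∀ t ∈ Ioo 0 s, HasDerivAt (fun t : ℝ => F (x + t • (y - x)))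
      (fderiv ℝ F (x + t • (y - x)) (y - x)) t := by
    intro t ht
    have h1 := (hF.1.diffAt (hall t ht.1.le ht.2)).hasFDerivAt
    have h2 : HasDerivAt (fun t : ℝ => x + t • (y - x)) (y - x) t := by
      simpa using ((hasDerivAt_id t).smul_const (y - x)).const_add x
    exact h1.comp_hasDerivAt t h2
  obtain ⟨c, hc, hcs⟩ := exists_hasDerivAt_eq_slope _ _ hs0 hcont hder
  have h0 : F (x + s • (y - x)) = 0 := hF.2 _ hbd
  simp only [h0, zero_smul, add_zero, zero_sub, sub_zero] at hcs
  have hb : |fderiv ℝ F (x + c • (y - x)) (y - x)| ≤ M * ‖y - x‖ :=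
    ((fderiv ℝ F (x + c • (y - x))).le_opNorm _).trans
      (mul_le_mul_of_nonneg_right (hM _ (hall c hc.1.le hc.2)) (norm_nonneg _))
  rw [hcs, abs_div, abs_neg, abs_of_pos hs0, div_le_iff₀ hs0] at hb
  linarith

lemma memC10_abs_sub_le {F : EuclideanSpace ℝ (Fin N) → ℝ} (hF : memC10 N R₀ R₁ F) {M : ℝ}
    (hM : ∀ x ∈ annulus N R₀ R₁, ‖fderiv ℝ F x‖ ≤ M) (hM0 : 0 ≤ M)
    (x y : EuclideanSpace ℝ (Fin N)) :
    |(annulus N R₀ R₁).indicator F x - (annulus N R₀ R₁).indicator F y| ≤ M * ‖x - y‖ := by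
  classical
  have key : ∀ x y : EuclideanSpace ℝ (Fin N), x ∈ annulus N R₀ R₁ → y ∉ annulus N R₀ R₁ →
      |F x| ≤ M * ‖y - x‖ := by
    intro x y hx hy
    obtain ⟨s, hs0, hs1, h, -⟩ := abs_le_exit hF hM hx hy
    refine h.trans (mul_le_mul_of_nonneg_left ?_ hM0)
    nlinarith [norm_nonneg (y - x)]
  by_cases hx : x ∈ annulus N R₀ R₁ <;> by_cases hy : y ∈ annulus N R₀ R₁
  · simp only [hx, hy, indicator_of_mem]
    by_cases hseg : ∀ t ∈ Icc (0 : ℝ) 1, x + t • (y - x) ∈ annulus N R₀ R₁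
    · have hder : ∀ t ∈ Icc (0 : ℝ) 1, HasDerivWithinAt (fun t : ℝ => F (x + t • (y - x)))
          (fderiv ℝ F (x + t • (y - x)) (y - x)) (Icc 0 1) t := by
        intro t ht
        have h1 := (hF.1.diffAt (hseg t ht)).hasFDerivAt
        have h2 : HasDerivAt (fun t : ℝ => x + t • (y - x)) (y - x) t := by
          simpa using ((hasDerivAt_id t).smul_const (y - x)).const_add x
        exact (h1.comp_hasDerivAt t h2).hasDerivWithinAt
      have := norm_image_sub_le_of_norm_deriv_le_segment_01' (C := M * ‖y - x‖) hder (by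
        intro t ht
        exact ((fderiv ℝ F (x + t • (y - x))).le_opNorm _).trans
          (mul_le_mul_of_nonneg_right (hM _ (hseg t ⟨ht.1, ht.2.le⟩)) (norm_nonneg _)))
      simp only [one_smul, add_sub_cancel, zero_smul, add_zero, Real.norm_eq_abs] at this
      rw [abs_sub_comm, norm_sub_rev]; exact this
    · push Not at hseg
      obtain ⟨t, ht, hz⟩ := hseg
      have a1 := key x _ hx hz
      have a2 := key y _ hy hz
      have e1 : x + t • (y - x) - x = t • (y - x) := by abel
      have e2 : x + t • (y - x) - y = (1 - t) • (x - y) := by module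
      rw [e1, norm_smul, Real.norm_eq_abs, abs_of_nonneg ht.1, norm_sub_rev] at a1
      rw [e2, norm_smul, Real.norm_eq_abs, abs_of_nonneg (sub_nonneg.2 ht.2)] at a2
      calc |F x - F y| ≤ |F x| + |F y| := abs_sub _ _
        _ ≤ M * (t * ‖x - y‖) + M * ((1 - t) * ‖x - y‖) := add_le_add a1 a2
        _ = _ := by ring
  · simp only [hx, hy, indicator_of_mem, not_false_eq_true, indicator_of_notMem, sub_zero]
    rw [norm_sub_rev]; exact key x y hx hy
  · simp only [hx, hy, indicator_of_mem, not_false_eq_true, indicator_of_notMem, zero_sub, abs_neg]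
    exact key y x hy hx
  · simp only [hx, hy, not_false_eq_true, indicator_of_notMem, sub_zero, abs_zero]
    positivity

lemma indicator_eq_of_memC10 {F : EuclideanSpace ℝ (Fin N) → ℝ} (hF : memC10 N R₀ R₁ F)
    {x : EuclideanSpace ℝ (Fin N)} (hx : x ∈ closure (annulus N R₀ R₁)) :
    (annulus N R₀ R₁).indicator F x = F x := by
  by_cases h : x ∈ annulus N R₀ R₁
  · simp [h]
  · rw [indicator_of_notMem h, hF.2 x (bd_of_mem_closure hx h)]

/-- sup bound -/
lemma memC10_abs_le (hR₀ : 0 < R₀) {F : EuclideanSpace ℝ (Fin N) → ℝ} (hF : memC10 N R₀ R₁ F)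
    {M : ℝ} (hM : ∀ x ∈ annulus N R₀ R₁, ‖fderiv ℝ F x‖ ≤ M) (hM0 : 0 ≤ M)
    {x : EuclideanSpace ℝ (Fin N)} (hx : x ∈ closure (annulus N R₀ R₁)) : |F x| ≤ M * R₁ := by
  have h := memC10_abs_sub_le hF hM hM0 x 0
  have h0 : (0 : EuclideanSpace ℝ (Fin N)) ∉ annulus N R₀ R₁ := by
    rintro ⟨h, -⟩; simp at h; linarith
  rw [indicator_eq_of_memC10 hF hx, indicator_of_notMem h0, sub_zero, sub_zero] at h
  exact h.trans (mul_le_mul_of_nonneg_left (closure_annulus_subset hx).2 hM0)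

/-- Integral of a derivative of a `C¹` function vanishing on the boundary is zero. -/
lemma integral_fderiv_eq_zero (hN : 0 < N) (hR₀ : 0 < R₀) (hR : R₀ < R₁)
    {F : EuclideanSpace ℝ (Fin N) → ℝ} (hF : memC10 N R₀ R₁ F) (e : EuclideanSpace ℝ (Fin N)) :
    ∫ x in annulus N R₀ R₁, fderiv ℝ F x e = 0 := by
  classical
  obtain ⟨M, hM0, hM⟩ := exists_fderiv_bound hR₀ hR hF.1
  have hlip : LipschitzWith ⟨M, hM0⟩ ((annulus N R₀ R₁).indicator F) := by
    apply LipschitzWith.of_dist_le_mul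
    intro x y
    rw [Real.dist_eq, dist_eq_norm]
    exact memC10_abs_sub_le hF hM hM0 x y
  have hone : LipschitzWith 0 (fun _ : EuclideanSpace ℝ (Fin N) => (1 : ℝ)) :=
    LipschitzWith.const _
  have hsupp : HasCompactSupport ((annulus N R₀ R₁).indicator F) := by
    apply HasCompactSupport.of_support_subset_isCompact isCompact_closure_annulus
    exact (support_indicator_subset).trans subset_closure
  have h := LipschitzWith.integral_lineDeriv_mul_eq (μ := volume) hone hlip hsupp (-e)
  have h1 : ∀ x, lineDeriv ℝ (fun _ : EuclideanSpace ℝ (Fin N) => (1 : ℝ)) x (-e) = 0 := by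
    intro x; simp [lineDeriv]
  simp only [h1, zero_mul, integral_zero, neg_neg, mul_one] at h
  rw [← integral_indicator isOpen_annulus.measurableSet, h]
  apply integral_congr_ae
  have hnull : ∀ᵐ x : EuclideanSpace ℝ (Fin N), ‖x‖ ≠ R₀ ∧ ‖x‖ ≠ R₁ := by
    have : Nonempty (Fin N) := ⟨⟨0, hN⟩⟩
    have a0 := Measure.addHaar_sphere (volume : Measure (EuclideanSpace ℝ (Fin N))) 0 R₀
    have a1 := Measure.addHaar_sphere (volume : Measure (EuclideanSpace ℝ (Fin N))) 0 R₁
    have b0 := measure_eq_zero_iff_ae_notMem.1 a0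
    have b1 := measure_eq_zero_iff_ae_notMem.1 a1
    filter_upwards [b0, b1] with x h0 h1
    simp only [mem_sphere_iff_norm, sub_zero] at h0 h1
    exact ⟨h0, h1⟩
  filter_upwards [hnull] with x hx
  by_cases hxA : x ∈ annulus N R₀ R₁
  · rw [indicator_of_mem hxA]
    have heq : (annulus N R₀ R₁).indicator F =ᶠ[nhds x] F := by
      filter_upwards [isOpen_annulus.mem_nhds hxA] with y hy
      simp [hy]
    rw [heq.lineDeriv_eq, (hF.1.diffAt hxA).lineDeriv_eq_fderiv]
  · rw [indicator_of_notMem hxA]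
    have hxc : x ∈ (closure (annulus N R₀ R₁))ᶜ := by
      intro hc
      rcases bd_of_mem_closure hc hxA with h | h
      exacts [hx.1 h, hx.2 h]
    have heq : (annulus N R₀ R₁).indicator F =ᶠ[nhds x] fun _ => 0 := by
      filter_upwards [isClosed_closure.isOpen_compl.mem_nhds hxc] with y hy
      rw [indicator_of_notMem (fun h => hy (subset_closure h))]
    rw [heq.lineDeriv_eq]; simp [lineDeriv]

lemma integrableOn_of_cont {G : Type*} [NormedAddCommGroup G] {F : EuclideanSpace ℝ (Fin N) → G}
    (hF : ContinuousOn F (closure (annulus N R₀ R₁))) :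
    IntegrableOn F (annulus N R₀ R₁) :=
  (hF.integrableOn_compact isCompact_closure_annulus).mono_set subset_closure

end geom

end Part1

section Part2
section green
variable {N : ℕ} {R₀ R₁ : ℝ}

/-- partial derivative up to the boundary -/
noncomputable def pdv (N : ℕ) (R₀ R₁ : ℝ) (i : Fin N) (F : EuclideanSpace ℝ (Fin N) → ℝ)
    (y : EuclideanSpace ℝ (Fin N)) : ℝ :=
  fderivWithin ℝ F (closure (annulus N R₀ R₁)) y (EuclideanSpace.single i 1)

lemma pdv_eq {i : Fin N} {F : EuclideanSpace ℝ (Fin N) → ℝ} {x : EuclideanSpace ℝ (Fin N)}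
    (hx : x ∈ annulus N R₀ R₁) :
    pdv N R₀ R₁ i F x = fderiv ℝ F x (EuclideanSpace.single i 1) := by
  rw [pdv, fderivWithin_eq_of_mem hx]

lemma pdv_contDiffOn (hR₀ : 0 < R₀) (hR : R₀ < R₁) (i : Fin N) {F : EuclideanSpace ℝ (Fin N) → ℝ}
    (hF : ContDiffOn ℝ 2 F (closure (annulus N R₀ R₁))) :
    ContDiffOn ℝ 1 (pdv N R₀ R₁ i F) (closure (annulus N R₀ R₁)) := by
  have h := hF.fderivWithin (m := 1) (uniqueDiffOn_cA hR₀ hR) (by norm_num)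
  exact h.clm_apply contDiffOn_const

lemma pdv_continuousOn (hR₀ : 0 < R₀) (hR : R₀ < R₁) (i : Fin N)
    {F : EuclideanSpace ℝ (Fin N) → ℝ}
    (hF : ContDiffOn ℝ 1 F (closure (annulus N R₀ R₁))) :
    ContinuousOn (pdv N R₀ R₁ i F) (closure (annulus N R₀ R₁)) := by
  have h := hF.continuousOn_fderivWithin (uniqueDiffOn_cA hR₀ hR) le_rfl
  exact h.clm_apply continuousOn_const

lemma pdv_eventuallyEq {i : Fin N} {F : EuclideanSpace ℝ (Fin N) → ℝ}
    {x : EuclideanSpace ℝ (Fin N)} (hx : x ∈ annulus N R₀ R₁) :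
    pdv N R₀ R₁ i F =ᶠ[nhds x] fun y => fderiv ℝ F y (EuclideanSpace.single i 1) := by
  filter_upwards [isOpen_annulus.mem_nhds hx] with y hy
  exact pdv_eq hy

lemma lapl_eq_pdv {F : EuclideanSpace ℝ (Fin N) → ℝ}
    {x : EuclideanSpace ℝ (Fin N)} (hx : x ∈ annulus N R₀ R₁) :
    lapl F x = ∑ i, fderiv ℝ (pdv N R₀ R₁ i F) x (EuclideanSpace.single i 1) := by
  unfold lapl
  refine Finset.sum_congr rfl fun i _ => ?_
  rw [(pdv_eventuallyEq hx).fderiv_eq]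

lemma lapl_cont (hR₀ : 0 < R₀) (hR : R₀ < R₁) {F : EuclideanSpace ℝ (Fin N) → ℝ}
    (hF : ContDiffOn ℝ 2 F (closure (annulus N R₀ R₁))) :
    ∃ L : EuclideanSpace ℝ (Fin N) → ℝ, ContinuousOn L (closure (annulus N R₀ R₁)) ∧
      ∀ x ∈ annulus N R₀ R₁, lapl F x = L x := by
  refine ⟨fun x => ∑ i, pdv N R₀ R₁ i (pdv N R₀ R₁ i F) x, ?_, ?_⟩
  · exact continuousOn_finsetSum _ fun i _ =>
      pdv_continuousOn hR₀ hR i (pdv_contDiffOn hR₀ hR i hF)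
  · intro x hx
    rw [lapl_eq_pdv hx]
    exact Finset.sum_congr rfl fun i _ => (pdv_eq hx).symm

lemma integrableOn_fderiv (hR₀ : 0 < R₀) (hR : R₀ < R₁) {F : EuclideanSpace ℝ (Fin N) → ℝ}
    (hF : ContDiffOn ℝ 1 F (closure (annulus N R₀ R₁))) (e : EuclideanSpace ℝ (Fin N)) :
    IntegrableOn (fun x => fderiv ℝ F x e) (annulus N R₀ R₁) := by
  have h : ContinuousOn (fun x => fderivWithin ℝ F (closure (annulus N R₀ R₁)) x e)
      (closure (annulus N R₀ R₁)) :=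
    (hF.continuousOn_fderivWithin (uniqueDiffOn_cA hR₀ hR) le_rfl).clm_apply continuousOn_const
  refine (integrableOn_of_cont h).congr_fun (fun x hx => ?_) isOpen_annulus.measurableSet
  simp only [fderivWithin_eq_of_mem hx]

/-- divergence theorem for fields vanishing on the boundary -/
lemma integral_div_eq_zero (hN : 0 < N) (hR₀ : 0 < R₀) (hR : R₀ < R₁)
    {F : Fin N → EuclideanSpace ℝ (Fin N) → ℝ} (hF : ∀ i, memC10 N R₀ R₁ (F i)) :
    ∫ x in annulus N R₀ R₁, ∑ i, fderiv ℝ (F i) x (EuclideanSpace.single i 1) = 0 := by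
  rw [integral_finsetSum _ fun i _ => integrableOn_fderiv hR₀ hR (hF i).1 _]
  exact Finset.sum_eq_zero fun i _ => integral_fderiv_eq_zero hN hR₀ hR (hF i) _

lemma green_second (hN : 0 < N) (hR₀ : 0 < R₀) (hR : R₀ < R₁)
    {h P : EuclideanSpace ℝ (Fin N) → ℝ} (hh : ContDiffOn ℝ 2 h (closure (annulus N R₀ R₁)))
    (hP : ContDiff ℝ 2 P)
    (hbd : ∀ x : EuclideanSpace ℝ (Fin N), (‖x‖ = R₀ ∨ ‖x‖ = R₁) →
      h x = 0 ∧ (P x = 0 ∨ ∀ i, pdv N R₀ R₁ i h x = 0)) :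
    ∫ x in annulus N R₀ R₁, P x * lapl h x = ∫ x in annulus N R₀ R₁, h x * lapl P x := by
  have hh1 : ContDiffOn ℝ 1 h (closure (annulus N R₀ R₁)) := hh.of_le (by norm_num)
  have hP1 : ContDiff ℝ 1 P := hP.of_le (by norm_num)
  have hdP : ∀ i : Fin N, ContDiff ℝ 1 (fun y => fderiv ℝ P y (EuclideanSpace.single i 1)) :=
    fun i => (hP.fderiv_right (m := 1) (by norm_num)).clm_apply contDiff_const
  have hdh := fun i => pdv_contDiffOn hR₀ hR i hh
  let F : Fin N → EuclideanSpace ℝ (Fin N) → ℝ := fun i y =>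
    P y * pdv N R₀ R₁ i h y - h y * fderiv ℝ P y (EuclideanSpace.single i 1)
  have hF : ∀ i, memC10 N R₀ R₁ (F i) := by
    intro i
    refine ⟨(hP1.contDiffOn.mul (hdh i)).sub (hh1.mul (hdP i).contDiffOn), fun x hx => ?_⟩
    obtain ⟨h0, h1⟩ := hbd x hx
    simp only [F, h0, zero_mul, sub_zero]
    rcases h1 with h1 | h1 <;> simp [h1]
  have hz := integral_div_eq_zero hN hR₀ hR hF
  have hpt : ∀ x ∈ annulus N R₀ R₁, ∑ i, fderiv ℝ (F i) x (EuclideanSpace.single i 1)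
      = P x * lapl h x - h x * lapl P x := by
    intro x hx
    rw [lapl_eq_pdv hx, lapl, Finset.mul_sum, Finset.mul_sum, ← Finset.sum_sub_distrib]
    refine Finset.sum_congr rfl fun i _ => ?_
    have d1 : DifferentiableAt ℝ P x := hP1.differentiable one_ne_zero x
    have d2 : DifferentiableAt ℝ (pdv N R₀ R₁ i h) x := (hdh i).diffAt hx
    have d3 : DifferentiableAt ℝ h x := hh1.diffAt hx
    have d4 := (hdP i).differentiable one_ne_zero x
    have : HasFDerivAt (F i) _ x :=
      (d1.hasFDerivAt.mul d2.hasFDerivAt).sub (d3.hasFDerivAt.mul d4.hasFDerivAt)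
    rw [this.fderiv]
    simp only [_root_.sub_apply, _root_.add_apply,
      _root_.smul_apply, smul_eq_mul]
    rw [pdv_eq hx]; ring
  rw [setIntegral_congr_fun isOpen_annulus.measurableSet hpt] at hz
  obtain ⟨L, hL, hLe⟩ := lapl_cont hR₀ hR hh
  obtain ⟨L', hL', hLe'⟩ := lapl_cont hR₀ hR (hP.contDiffOn (s := closure (annulus N R₀ R₁)))
  have i1 : IntegrableOn (fun x => P x * lapl h x) (annulus N R₀ R₁) := by
    refine (integrableOn_of_cont (hP.continuous.continuousOn.mul hL)).congr_fun
      (fun x hx => ?_) isOpen_annulus.measurableSet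
    simp only [hLe x hx, Pi.mul_apply]
  have i2 : IntegrableOn (fun x => h x * lapl P x) (annulus N R₀ R₁) := by
    refine (integrableOn_of_cont (hh.continuousOn.mul hL')).congr_fun
      (fun x hx => ?_) isOpen_annulus.measurableSet
    simp only [hLe' x hx, Pi.mul_apply]
  rw [integral_sub i1 i2] at hz
  linarith

lemma green_first (hN : 0 < N) (hR₀ : 0 < R₀) (hR : R₀ < R₁)
    {v g : EuclideanSpace ℝ (Fin N) → ℝ} (hv : ContDiffOn ℝ 2 v (closure (annulus N R₀ R₁)))
    (hg : memC10 N R₀ R₁ g) :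
    ∫ x in annulus N R₀ R₁, ∑ i, pdv N R₀ R₁ i v x * pdv N R₀ R₁ i g x
      = - ∫ x in annulus N R₀ R₁, lapl v x * g x := by
  have hdv := fun i => pdv_contDiffOn hR₀ hR i hv
  have hF : ∀ i, memC10 N R₀ R₁ (fun y => pdv N R₀ R₁ i v y * g y) := by
    intro i
    refine ⟨(hdv i).mul hg.1, fun x hx => ?_⟩
    simp [hg.2 x hx]
  have hz := integral_div_eq_zero hN hR₀ hR hF
  have hpt : ∀ x ∈ annulus N R₀ R₁, ∑ i, fderiv ℝ (fun y => pdv N R₀ R₁ i v y * g y) x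
      (EuclideanSpace.single i 1)
      = (∑ i, pdv N R₀ R₁ i v x * pdv N R₀ R₁ i g x) + lapl v x * g x := by
    intro x hx
    rw [lapl_eq_pdv hx, Finset.sum_mul, ← Finset.sum_add_distrib]
    refine Finset.sum_congr rfl fun i _ => ?_
    have d2 : DifferentiableAt ℝ (pdv N R₀ R₁ i v) x := (hdv i).diffAt hx
    have d3 : DifferentiableAt ℝ g x := hg.1.diffAt hx
    have : HasFDerivAt (fun y => pdv N R₀ R₁ i v y * g y) _ x := d2.hasFDerivAt.mul d3.hasFDerivAt
    rw [this.fderiv]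
    simp only [_root_.add_apply,
      _root_.smul_apply, smul_eq_mul]
    rw [pdv_eq (F := g) hx]; ring
  rw [setIntegral_congr_fun isOpen_annulus.measurableSet hpt] at hz
  obtain ⟨L, hL, hLe⟩ := lapl_cont hR₀ hR hv
  have i1 : IntegrableOn (fun x => ∑ i, pdv N R₀ R₁ i v x * pdv N R₀ R₁ i g x)
      (annulus N R₀ R₁) :=
    integrableOn_of_cont (continuousOn_finsetSum _ fun i _ =>
      (hdv i).continuousOn.mul (pdv_continuousOn hR₀ hR i hg.1))
  have i2 : IntegrableOn (fun x => lapl v x * g x) (annulus N R₀ R₁) := by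
    refine (integrableOn_of_cont (hL.mul hg.1.continuousOn)).congr_fun
      (fun x hx => ?_) isOpen_annulus.measurableSet
    simp only [hLe x hx, Pi.mul_apply]
  rw [integral_add i1 i2] at hz
  linarith

end green

section kernel
variable {N : ℕ}

/-- quadratic numerator -/
noncomputable def kq (α β : ℝ) (e y : EuclideanSpace ℝ (Fin N)) : ℝ :=
  α * ‖y‖ ^ 2 - inner ℝ e y + β
/-- quadratic denominator -/
noncomputable def kD (κ ρ : ℝ) (x y : EuclideanSpace ℝ (Fin N)) : ℝ :=
  κ * ‖y‖ ^ 2 - 2 * inner ℝ x y + ρ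

lemma kq_hasFDerivAt (α β : ℝ) (e y : EuclideanSpace ℝ (Fin N)) :
    HasFDerivAt (kq α β e) (α • (2 • innerSL ℝ y) - innerSL ℝ e) y := by
  have h1 := (hasStrictFDerivAt_norm_sq y).hasFDerivAt
  have h2 := (innerSL ℝ e).hasFDerivAt (x := y)
  exact (((h1.const_mul α).sub h2).add_const β)

lemma kD_hasFDerivAt (κ ρ : ℝ) (x y : EuclideanSpace ℝ (Fin N)) :
    HasFDerivAt (kD κ ρ x) (κ • (2 • innerSL ℝ y) - (2 : ℝ) • innerSL ℝ x) y := by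
  have h1 := (hasStrictFDerivAt_norm_sq y).hasFDerivAt
  have h2 := (innerSL ℝ x).hasFDerivAt (x := y)
  exact (((h1.const_mul κ).sub (h2.const_mul 2)).add_const ρ)

lemma kS_hasFDerivAt (κ ρ τ r : ℝ) (x y : EuclideanSpace ℝ (Fin N)) (h : 0 < kD κ ρ x y + τ) :
    HasFDerivAt (fun y => (kD κ ρ x y + τ) ^ r)
      ((r * (kD κ ρ x y + τ) ^ (r - 1)) • (κ • (2 • innerSL ℝ y) - (2 : ℝ) • innerSL ℝ x)) y :=
  ((kD_hasFDerivAt κ ρ x y).add_const τ).rpow_const (Or.inl h.ne')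

/-- the kernel -/
noncomputable def kQ (κ ρ α β τ : ℝ) (x e y : EuclideanSpace ℝ (Fin N)) : ℝ :=
  kq α β e y * (kD κ ρ x y + τ) ^ (-(N : ℝ) / 2)

lemma kQ_contDiff {κ ρ α β τ : ℝ} {x e : EuclideanSpace ℝ (Fin N)}
    (hpos : ∀ y, 0 < kD κ ρ x y + τ) : ContDiff ℝ 2 (kQ κ ρ α β τ x e) := by
  have h1 : ContDiff ℝ 2 (kq α β e) := by
    unfold kq
    exact ((contDiff_const.mul (contDiff_norm_sq ℝ)).sub (contDiff_const.inner ℝ contDiff_id)).add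
      contDiff_const
  have h2 : ContDiff ℝ 2 (fun y => kD κ ρ x y + τ) := by
    unfold kD
    exact (((contDiff_const.mul (contDiff_norm_sq ℝ)).sub
      (contDiff_const.mul (contDiff_const.inner ℝ contDiff_id))).add contDiff_const).add
      contDiff_const
  exact h1.mul (h2.rpow_const_of_ne fun y => (hpos y).ne')

lemma kQ_fderiv {κ ρ α β τ : ℝ} {x e : EuclideanSpace ℝ (Fin N)}
    (hpos : ∀ y, 0 < kD κ ρ x y + τ) (y : EuclideanSpace ℝ (Fin N)) (i : Fin N) :
    fderiv ℝ (kQ κ ρ α β τ x e) y (EuclideanSpace.single i 1) =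
      (2 * α * y i - e i) * (kD κ ρ x y + τ) ^ (-(N : ℝ) / 2) +
      (-(N : ℝ)) * (kq α β e y * (kD κ ρ x y + τ) ^ (-(N : ℝ) / 2 - 1) * (κ * y i - x i)) := by
  have h : HasFDerivAt (kQ κ ρ α β τ x e) _ y :=
    (kq_hasFDerivAt α β e y).mul (kS_hasFDerivAt κ ρ τ (-(N : ℝ) / 2) x y (hpos y))
  rw [h.fderiv]
  simp [EuclideanSpace.inner_single_right]
  ring

lemma kQ_lapl {κ ρ α β τ : ℝ} {x e : EuclideanSpace ℝ (Fin N)}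
    (hpos : ∀ y, 0 < kD κ ρ x y + τ) (h1 : κ * ρ = ‖x‖ ^ 2)
    (h2 : α * ρ + κ * β = inner ℝ e x) (y : EuclideanSpace ℝ (Fin N)) :
    lapl (kQ κ ρ α β τ x e) y = τ * (2 * N * α * (kD κ ρ x y + τ) ^ (-(N : ℝ) / 2 - 1)
      - N * (N + 2) * κ * kq α β e y * (kD κ ρ x y + τ) ^ (-(N : ℝ) / 2 - 2)) := by
  set T := kD κ ρ x y + τ with hT
  have hT0 : 0 < T := hpos y
  have e0 : T ^ (-(N : ℝ) / 2) = T ^ (-(N : ℝ) / 2 - 2) * T ^ 2 := by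
    rw [← Real.rpow_natCast T 2, ← Real.rpow_add hT0]; norm_num
  have e1 : T ^ (-(N : ℝ) / 2 - 1) = T ^ (-(N : ℝ) / 2 - 2) * T := by
    nth_rewrite 3 [← Real.rpow_one T]
    rw [← Real.rpow_add hT0]; ring_nf
  have e2 : -(N : ℝ) / 2 - 1 - 1 = -(N : ℝ) / 2 - 2 := by ring
  have hterm : ∀ i : Fin N,
      fderiv ℝ (fun y => fderiv ℝ (kQ κ ρ α β τ x e) y (EuclideanSpace.single i 1)) y
        (EuclideanSpace.single i 1) =
      2 * α * T ^ (-(N : ℝ) / 2)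
      - 2 * N * T ^ (-(N : ℝ) / 2 - 1) * ((2 * α * y i - e i) * (κ * y i - x i))
      + N * (N + 2) * kq α β e y * T ^ (-(N : ℝ) / 2 - 2) * (κ * y i - x i) ^ 2
      - N * κ * kq α β e y * T ^ (-(N : ℝ) / 2 - 1) := by
    intro i
    simp_rw [kQ_fderiv hpos]
    have hl : HasFDerivAt (fun y : EuclideanSpace ℝ (Fin N) => y i)
        (EuclideanSpace.proj i : EuclideanSpace ℝ (Fin N) →L[ℝ] ℝ) y :=
      (EuclideanSpace.proj i : EuclideanSpace ℝ (Fin N) →L[ℝ] ℝ).hasFDerivAt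
    have ha := (hl.const_mul (2 * α)).sub_const (e i)
    have hb := (hl.const_mul κ).sub_const (x i)
    have hs0 := kS_hasFDerivAt κ ρ τ (-(N : ℝ) / 2) x y (hpos y)
    have hs1 := kS_hasFDerivAt κ ρ τ (-(N : ℝ) / 2 - 1) x y (hpos y)
    have hq := kq_hasFDerivAt α β e y
    have h := (ha.mul hs0).add (((hq.mul hs1).mul hb).const_mul (-(N : ℝ)))
    have h' : HasFDerivAt (fun y : EuclideanSpace ℝ (Fin N) =>
      (2 * α * y i - e i) * (kD κ ρ x y + τ) ^ (-(N : ℝ) / 2) +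
      (-(N : ℝ)) * (kq α β e y * (kD κ ρ x y + τ) ^ (-(N : ℝ) / 2 - 1) * (κ * y i - x i))) _ y := h
    rw [h'.fderiv]
    simp [EuclideanSpace.inner_single_right, ← hT, e2]
    ring
  rw [lapl, Finset.sum_congr rfl fun i _ => hterm i]
  have hy2 : ‖y‖ ^ 2 = ∑ i, y i * y i := by
    rw [EuclideanSpace.real_norm_sq_eq]; exact Finset.sum_congr rfl fun i _ => by ring
  have hx2 : ‖x‖ ^ 2 = ∑ i, x i * x i := by
    rw [EuclideanSpace.real_norm_sq_eq]; exact Finset.sum_congr rfl fun i _ => by ring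
  have hin : ∀ a b : EuclideanSpace ℝ (Fin N), inner ℝ a b = ∑ i, a i * b i := by
    intro a b
    simp [PiLp.inner_apply, mul_comm]
  have s1 : ∑ i, (κ * y i - x i) ^ 2 = κ * kD κ ρ x y := by
    have : ∑ i, (κ * y i - x i) ^ 2 = κ ^ 2 * ∑ i, y i * y i - 2 * κ * ∑ i, x i * y i
        + ∑ i, x i * x i := by
      rw [Finset.mul_sum, Finset.mul_sum, ← Finset.sum_sub_distrib, ← Finset.sum_add_distrib]
      exact Finset.sum_congr rfl fun i _ => by ring
    rw [this, ← hy2, ← hx2, ← hin, ← h1, kD]; ring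
  have s2 : ∑ i, ((2 * α * y i - e i) * (κ * y i - x i)) = α * kD κ ρ x y + κ * kq α β e y := by
    have : ∑ i, ((2 * α * y i - e i) * (κ * y i - x i)) = 2 * α * κ * ∑ i, y i * y i
        - 2 * α * ∑ i, x i * y i - κ * ∑ i, e i * y i + ∑ i, e i * x i := by
      rw [Finset.mul_sum, Finset.mul_sum, Finset.mul_sum, ← Finset.sum_sub_distrib,
        ← Finset.sum_sub_distrib, ← Finset.sum_add_distrib]
      exact Finset.sum_congr rfl fun i _ => by ring
    rw [this, ← hy2, ← hin, ← hin, ← hin, ← h2, kD, kq]; ring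
  rw [Finset.sum_sub_distrib, Finset.sum_add_distrib, Finset.sum_sub_distrib,
    ← Finset.mul_sum (f := fun i => (2 * α * y i - e i) * (κ * y i - x i)),
    ← Finset.mul_sum (f := fun i => (κ * y i - x i) ^ 2), s1, s2]
  simp only [Finset.sum_const, Finset.card_univ, Fintype.card_fin, nsmul_eq_mul]
  have hD : kD κ ρ x y = T - τ := by rw [hT]; ring
  rw [e0, e1, hD]
  ring

end kernel

end Part2

section Part3
section kbound
variable {N : ℕ} {R₀ R₁ : ℝ}

lemma kernel_aux {s D q c τ : ℝ} (hN : 1 ≤ N) (hs : 0 < s) (hD : s ^ 2 ≤ D)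
    (hq : q ^ 2 ≤ c ^ 2 * D) (hc : 0 ≤ c) (hτ : 0 < τ) :
    |q * (D + τ) ^ (-(N : ℝ) / 2)| ≤ c * s ^ (1 - (N : ℝ)) := by
  have hD0 : 0 < D := lt_of_lt_of_le (by positivity) hD
  set d := √D with hd
  have hd0 : 0 < d := Real.sqrt_pos.2 hD0
  have hdD : d ^ 2 = D := Real.sq_sqrt hD0.le
  have hsd : s ≤ d := Real.le_sqrt_of_sq_le hD
  have h1 : |q| ≤ c * d := by
    apply abs_le_of_sq_le_sq _ (by positivity)
    rw [mul_pow, hdD]; exact hq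
  have hN' : (1 : ℝ) ≤ N := by exact_mod_cast hN
  have h2 : (D + τ) ^ (-(N : ℝ) / 2) ≤ d ^ (-(N : ℝ)) := by
    have : d ^ (-(N : ℝ)) = D ^ (-(N : ℝ) / 2) := by
      rw [← hdD, ← Real.rpow_natCast d 2, ← Real.rpow_mul hd0.le]; congr 1; push_cast; ring
    rw [this]
    exact Real.rpow_le_rpow_of_nonpos hD0 (by linarith) (by linarith)
  rw [abs_mul, abs_of_nonneg (Real.rpow_nonneg (by linarith : (0 : ℝ) ≤ D + τ) _)]
  calc |q| * (D + τ) ^ (-(N : ℝ) / 2) ≤ (c * d) * d ^ (-(N : ℝ)) := by gcongr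
    _ = c * d ^ (1 - (N : ℝ)) := by
      rw [sub_eq_add_neg, Real.rpow_add hd0, Real.rpow_one]; ring
    _ ≤ c * s ^ (1 - (N : ℝ)) := by
      gcongr ?_ * ?_
      exact Real.rpow_le_rpow_of_nonpos hs hsd (by linarith)

lemma kD1_eq (x y : EuclideanSpace ℝ (Fin N)) : kD 1 (‖x‖ ^ 2) x y = ‖x - y‖ ^ 2 := by
  rw [kD, norm_sub_sq_real]; ring

lemma kq1_eq (x e y : EuclideanSpace ℝ (Fin N)) :
    kq 0 (inner ℝ e x) e y = inner ℝ e (x - y) := by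
  rw [kq, inner_sub_right]; ring

lemma kD2_eq {R : ℝ} (hR : R ≠ 0) (x y : EuclideanSpace ℝ (Fin N)) :
    kD (‖x‖ ^ 2 / R ^ 2) (R ^ 2) x y =
      ‖x - y‖ ^ 2 + (R ^ 2 - ‖x‖ ^ 2) * (R ^ 2 - ‖y‖ ^ 2) / R ^ 2 := by
  rw [kD, norm_sub_sq_real]; field_simp; ring

lemma kD2_ge {R : ℝ} (hR : 0 < R) (x y : EuclideanSpace ℝ (Fin N)) :
    (‖x‖ * ‖y‖ / R - R) ^ 2 ≤ kD (‖x‖ ^ 2 / R ^ 2) (R ^ 2) x y := by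
  have h := real_inner_le_norm x y
  have : kD (‖x‖ ^ 2 / R ^ 2) (R ^ 2) x y - (‖x‖ * ‖y‖ / R - R) ^ 2
    = 2 * (‖x‖ * ‖y‖ - inner ℝ x y) := by
    rw [kD]; field_simp; ring
  linarith

lemma kD2_pos {R τ : ℝ} (hR : 0 < R) (hτ : 0 < τ) (x y : EuclideanSpace ℝ (Fin N)) :
    0 < kD (‖x‖ ^ 2 / R ^ 2) (R ^ 2) x y + τ := by
  have := kD2_ge hR x y
  nlinarith [sq_nonneg (‖x‖ * ‖y‖ / R - R)]

lemma kD1_pos {τ : ℝ} (hτ : 0 < τ) (x y : EuclideanSpace ℝ (Fin N)) :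
    0 < kD 1 (‖x‖ ^ 2) x y + τ := by
  rw [kD1_eq]; positivity

lemma kq2_sq {R : ℝ} (hR : 0 < R) (x e y : EuclideanSpace ℝ (Fin N)) (he : ‖e‖ = 1) :
    (kq (inner ℝ e x / R ^ 2) 0 e y) ^ 2 ≤
      (‖y‖ / R) ^ 2 * kD (‖x‖ ^ 2 / R ^ 2) (R ^ 2) x y := by
  have h1 : kq (inner ℝ e x / R ^ 2) 0 e y = inner ℝ e ((‖y‖ ^ 2 / R ^ 2) • x - y) := by
    rw [kq, inner_sub_right, inner_smul_right]; ring
  have h2 : ‖(‖y‖ ^ 2 / R ^ 2) • x - y‖ ^ 2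
      = (‖y‖ / R) ^ 2 * kD (‖x‖ ^ 2 / R ^ 2) (R ^ 2) x y := by
    rw [norm_sub_sq_real, norm_smul, inner_smul_left, kD, Real.norm_eq_abs,
      abs_of_nonneg (by positivity)]
    simp only [conj_trivial]
    field_simp
  rw [h1, ← h2]
  have := abs_real_inner_le_norm e ((‖y‖ ^ 2 / R ^ 2) • x - y)
  rw [he, one_mul] at this
  exact sq_le_sq' (by linarith [neg_abs_le (inner ℝ e ((‖y‖ ^ 2 / R ^ 2) • x - y))])
    (by linarith [le_abs_self (inner ℝ e ((‖y‖ ^ 2 / R ^ 2) • x - y))])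

/-- the full regularised kernel -/
noncomputable def kP (R τ : ℝ) (x e y : EuclideanSpace ℝ (Fin N)) : ℝ :=
  kQ 1 (‖x‖ ^ 2) 0 (inner ℝ e x) τ x e y
    - kQ (‖x‖ ^ 2 / R ^ 2) (R ^ 2) (inner ℝ e x / R ^ 2) 0 τ x e y

lemma kP_contDiff {R τ : ℝ} (hR : 0 < R) (hτ : 0 < τ) (x e : EuclideanSpace ℝ (Fin N)) :
    ContDiff ℝ 2 (kP R τ x e) :=
  (kQ_contDiff (kD1_pos hτ x)).sub (kQ_contDiff (kD2_pos hR hτ x))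

lemma kP_bd {R τ : ℝ} (hR : 0 < R) (x e y : EuclideanSpace ℝ (Fin N)) (hy : ‖y‖ = R) :
    kP R τ x e y = 0 := by
  have h1 : kD 1 (‖x‖ ^ 2) x y = kD (‖x‖ ^ 2 / R ^ 2) (R ^ 2) x y := by
    rw [kD, kD, hy]; field_simp; ring
  have h2 : kq 0 (inner ℝ e x) e y = kq (inner ℝ e x / R ^ 2) 0 e y := by
    rw [kq, kq, hy]; field_simp; ring
  rw [kP, kQ, kQ, h1, h2, sub_self]

lemma kP_bound (hN : 1 ≤ N) (hR₀ : 0 < R₀) (hR : R₀ < R₁) {R τ : ℝ} (hRR : R = R₀ ∨ R = R₁)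
    (hτ : 0 < τ) {x e y : EuclideanSpace ℝ (Fin N)} (he : ‖e‖ = 1)
    (hx : x ∈ annulus N R₀ R₁) (hy : y ∈ annulus N R₀ R₁) (hxy : x ≠ y) :
    |kP R τ x e y| ≤ (1 + R₁ / R₀) * ‖x - y‖ ^ (1 - (N : ℝ)) := by
  obtain ⟨hx0, hx1⟩ := hx
  obtain ⟨hy0, hy1⟩ := hy
  have hs : 0 < ‖x - y‖ := norm_pos_iff.2 (sub_ne_zero.2 hxy)
  have hRp : 0 < R := by rcases hRR with rfl | rfl <;> linarith
  have hR1p : 0 < R₁ := hR₀.trans hR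
  have hRR0 : R₀ ≤ R := by rcases hRR with rfl | rfl <;> linarith
  have hx2 : R₀ ^ 2 < ‖x‖ ^ 2 := by gcongr
  have hx3 : ‖x‖ ^ 2 < R₁ ^ 2 := by gcongr
  have hy2 : R₀ ^ 2 < ‖y‖ ^ 2 := by gcongr
  have hy3 : ‖y‖ ^ 2 < R₁ ^ 2 := by gcongr
  have b1 : |kQ 1 (‖x‖ ^ 2) 0 (inner ℝ e x) τ x e y| ≤ 1 * ‖x - y‖ ^ (1 - (N : ℝ)) := by
    refine kernel_aux hN hs (kD1_eq x y).ge ?_ zero_le_one hτ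
    rw [kD1_eq, kq1_eq, one_pow, one_mul]
    have := abs_real_inner_le_norm e (x - y)
    rw [he, one_mul] at this
    exact sq_le_sq' (by linarith [neg_abs_le (inner ℝ e (x - y))])
      (by linarith [le_abs_self (inner ℝ e (x - y))])
  have hD2 : ‖x - y‖ ^ 2 ≤ kD (‖x‖ ^ 2 / R ^ 2) (R ^ 2) x y := by
    rw [kD2_eq hRp.ne']
    have : 0 ≤ (R ^ 2 - ‖x‖ ^ 2) * (R ^ 2 - ‖y‖ ^ 2) := by
      rcases hRR with rfl | rfl <;> nlinarith
    have : 0 ≤ (R ^ 2 - ‖x‖ ^ 2) * (R ^ 2 - ‖y‖ ^ 2) / R ^ 2 := by positivity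
    linarith
  have b2 : |kQ (‖x‖ ^ 2 / R ^ 2) (R ^ 2) (inner ℝ e x / R ^ 2) 0 τ x e y|
      ≤ R₁ / R₀ * ‖x - y‖ ^ (1 - (N : ℝ)) := by
    refine kernel_aux hN hs hD2 ((kq2_sq hRp x e y he).trans ?_) (by positivity) hτ
    have : 0 ≤ kD (‖x‖ ^ 2 / R ^ 2) (R ^ 2) x y := (by positivity : (0:ℝ) ≤ ‖x - y‖ ^ 2).trans hD2
    gcongr
  calc |kP R τ x e y| ≤ _ := abs_sub _ _
    _ ≤ _ := add_le_add b1 b2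
    _ = _ := by ring

lemma lapl_sub_of {f g : EuclideanSpace ℝ (Fin N) → ℝ} (hf : ContDiff ℝ 2 f)
    (hg : ContDiff ℝ 2 g) (y : EuclideanSpace ℝ (Fin N)) :
    lapl (fun z => f z - g z) y = lapl f y - lapl g y := by
  unfold lapl
  rw [← Finset.sum_sub_distrib]
  refine Finset.sum_congr rfl fun i _ => ?_
  have h1 : (fun z => fderiv ℝ (fun z => f z - g z) z (EuclideanSpace.single i 1))
      = fun z => fderiv ℝ f z (EuclideanSpace.single i 1)
        - fderiv ℝ g z (EuclideanSpace.single i 1) := by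
    funext z
    rw [fderiv_fun_sub (hf.differentiable two_ne_zero z) (hg.differentiable two_ne_zero z)]
    rfl
  have d1 : Differentiable ℝ (fun y => fderiv ℝ f y (EuclideanSpace.single i 1)) :=
    ((hf.fderiv_right (m := 1) (by norm_num)).clm_apply contDiff_const).differentiable one_ne_zero
  have d2 : Differentiable ℝ (fun y => fderiv ℝ g y (EuclideanSpace.single i 1)) :=
    ((hg.fderiv_right (m := 1) (by norm_num)).clm_apply contDiff_const).differentiable one_ne_zero
  rw [h1, fderiv_fun_sub (d1 y) (d2 y)]
  rfl

end kbound

end Part3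

section Part4
section repr
variable {N : ℕ} {R₀ R₁ : ℝ}

/-- mollifier -/
noncomputable def kEta (τ : ℝ) (x y : EuclideanSpace ℝ (Fin N)) : ℝ :=
  N * τ * (kD 1 (‖x‖ ^ 2) x y + τ) ^ (-(N : ℝ) / 2 - 1)

lemma kEta_contDiff {τ : ℝ} (hτ : 0 < τ) (x : EuclideanSpace ℝ (Fin N)) :
    ContDiff ℝ 1 (kEta τ x) := by
  have h2 : ContDiff ℝ 1 (fun y => kD 1 (‖x‖ ^ 2) x y + τ) := by
    unfold kD
    exact (((contDiff_const.mul (contDiff_norm_sq ℝ)).sub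
      (contDiff_const.mul (contDiff_const.inner ℝ contDiff_id))).add contDiff_const).add
      contDiff_const
  exact contDiff_const.mul (h2.rpow_const_of_ne fun y => (kD1_pos hτ x y).ne')

lemma kEta_fderiv {τ : ℝ} (hτ : 0 < τ) (x e y : EuclideanSpace ℝ (Fin N)) :
    fderiv ℝ (kEta τ x) y e =
      N * (N + 2) * τ * inner ℝ e (x - y) * (kD 1 (‖x‖ ^ 2) x y + τ) ^ (-(N : ℝ) / 2 - 2) := by
  have h : HasFDerivAt (kEta τ x) _ y :=
    (kS_hasFDerivAt 1 (‖x‖ ^ 2) τ (-(N : ℝ) / 2 - 1) x y (kD1_pos hτ x y)).const_mul (N * τ)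
  have e2 : -(N : ℝ) / 2 - 1 - 1 = -(N : ℝ) / 2 - 2 := by ring
  rw [h.fderiv, e2]
  simp [inner_sub_right, real_inner_comm]
  ring

lemma repr_eq (hN : 1 ≤ N) (hR₀ : 0 < R₀) (hR : R₀ < R₁) {R τ : ℝ} (hRp : 0 < R)
    (hτ : 0 < τ) {h : EuclideanSpace ℝ (Fin N) → ℝ}
    (hh : ContDiffOn ℝ 2 h (closure (annulus N R₀ R₁)))
    (hbd : ∀ x : EuclideanSpace ℝ (Fin N), (‖x‖ = R₀ ∨ ‖x‖ = R₁) →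
      h x = 0 ∧ (‖x‖ = R ∨ ∀ i, pdv N R₀ R₁ i h x = 0)) (x e : EuclideanSpace ℝ (Fin N)) :
    ∫ y in annulus N R₀ R₁, kEta τ x y * fderiv ℝ h y e =
      (∫ y in annulus N R₀ R₁, kP R τ x e y * lapl h y) +
      ∫ y in annulus N R₀ R₁, h y *
        lapl (kQ (‖x‖ ^ 2 / R ^ 2) (R ^ 2) (inner ℝ e x / R ^ 2) 0 τ x e) y := by
  have hh1 : ContDiffOn ℝ 1 h (closure (annulus N R₀ R₁)) := hh.of_le (by norm_num)
  have g2 := green_second hN hR₀ hR hh (kP_contDiff hRp hτ x e) (fun y hy => by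
    obtain ⟨h1, h2⟩ := hbd y hy
    refine ⟨h1, ?_⟩
    rcases h2 with h2 | h2
    · exact Or.inl (kP_bd hRp x e y h2)
    · exact Or.inr h2)
  have c1 := kQ_contDiff (α := 0) (β := inner ℝ e x) (e := e) (kD1_pos hτ x)
  have c2 := kQ_contDiff (α := inner ℝ e x / R ^ 2) (β := 0) (e := e) (kD2_pos hRp hτ x)
  have l1 : ∀ y, lapl (kP R τ x e) y = - fderiv ℝ (kEta τ x) y e -
      lapl (kQ (‖x‖ ^ 2 / R ^ 2) (R ^ 2) (inner ℝ e x / R ^ 2) 0 τ x e) y := by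
    intro y
    have := lapl_sub_of c1 c2 y
    rw [show kP R τ x e = fun y => kQ 1 (‖x‖ ^ 2) 0 (inner ℝ e x) τ x e y
      - kQ (‖x‖ ^ 2 / R ^ 2) (R ^ 2) (inner ℝ e x / R ^ 2) 0 τ x e y from rfl, this,
      kQ_lapl (kD1_pos hτ x) (by ring) (by ring), kEta_fderiv hτ, kq1_eq]
    ring
  have hE := kEta_contDiff hτ x
  have hmem : memC10 N R₀ R₁ (fun y => kEta τ x y * h y) :=
    ⟨hE.contDiffOn.mul hh1, fun y hy => by simp [(hbd y hy).1]⟩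
  have hz := integral_fderiv_eq_zero hN hR₀ hR hmem e
  have hpt : ∀ y ∈ annulus N R₀ R₁, fderiv ℝ (fun y => kEta τ x y * h y) y e
      = kEta τ x y * fderiv ℝ h y e + h y * fderiv ℝ (kEta τ x) y e := by
    intro y hy
    have d1 : DifferentiableAt ℝ (kEta τ x) y := hE.differentiable one_ne_zero y
    have d3 : DifferentiableAt ℝ h y := hh1.diffAt hy
    rw [fderiv_fun_mul d1 d3]
    simp
  rw [setIntegral_congr_fun isOpen_annulus.measurableSet hpt] at hz
  have i1 : IntegrableOn (fun y => kEta τ x y * fderiv ℝ h y e) (annulus N R₀ R₁) := by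
    have h : ContinuousOn (fun x => fderivWithin ℝ h (closure (annulus N R₀ R₁)) x e)
      (closure (annulus N R₀ R₁)) :=
      (hh1.continuousOn_fderivWithin (uniqueDiffOn_cA hR₀ hR) le_rfl).clm_apply continuousOn_const
    refine (integrableOn_of_cont (hE.continuous.continuousOn.mul h)).congr_fun (fun x hx => ?_)
      isOpen_annulus.measurableSet
    simp only [fderivWithin_eq_of_mem hx, Pi.mul_apply]
  have i2 : IntegrableOn (fun y => h y * fderiv ℝ (kEta τ x) y e) (annulus N R₀ R₁) :=
    integrableOn_of_cont (hh.continuousOn.mul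
      ((hE.continuous_fderiv one_ne_zero).clm_apply continuous_const).continuousOn)
  have i3 : IntegrableOn (fun y => h y *
      lapl (kQ (‖x‖ ^ 2 / R ^ 2) (R ^ 2) (inner ℝ e x / R ^ 2) 0 τ x e) y)
      (annulus N R₀ R₁) := by
    obtain ⟨L', hL', hLe'⟩ := lapl_cont hR₀ hR (c2.contDiffOn (s := closure (annulus N R₀ R₁)))
    refine (integrableOn_of_cont (hh.continuousOn.mul hL')).congr_fun
      (fun x hx => ?_) isOpen_annulus.measurableSet
    simp only [hLe' x hx, Pi.mul_apply]
  rw [integral_add i1 i2] at hz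
  have : ∫ y in annulus N R₀ R₁, h y * lapl (kP R τ x e) y =
      - (∫ y in annulus N R₀ R₁, h y * fderiv ℝ (kEta τ x) y e) -
      ∫ y in annulus N R₀ R₁, h y *
        lapl (kQ (‖x‖ ^ 2 / R ^ 2) (R ^ 2) (inner ℝ e x / R ^ 2) 0 τ x e) y := by
    rw [← integral_neg, ← integral_sub (by exact i2.neg) i3]
    refine integral_congr_ae (Filter.Eventually.of_forall fun y => ?_)
    simp only [l1]; ring
  rw [g2, this]; linarith

/-- normalising constant -/
noncomputable def cN (N : ℕ) : ℝ :=
  ∫ z : EuclideanSpace ℝ (Fin N), N * (1 + ‖z‖ ^ 2) ^ (-(N : ℝ) / 2 - 1)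

lemma cN_integrable :
    Integrable (fun z : EuclideanSpace ℝ (Fin N) => N * (1 + ‖z‖ ^ 2) ^ (-(N : ℝ) / 2 - 1)) := by
  have := integrable_rpow_neg_one_add_norm_sq (μ := (volume : Measure (EuclideanSpace ℝ (Fin N))))
    (r := N + 2) (by simp)
  refine (this.const_mul (N : ℝ)).congr (Filter.Eventually.of_forall fun z => ?_)
  simp only
  congr 2; ring

lemma cN_pos (hN : 1 ≤ N) : 0 < cN N := by
  have hN' : (0 : ℝ) < N := by exact_mod_cast hN
  unfold cN
  rw [integral_pos_iff_support_of_nonneg (fun z => by positivity) cN_integrable]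
  have : Function.support (fun z : EuclideanSpace ℝ (Fin N) =>
      N * (1 + ‖z‖ ^ 2) ^ (-(N : ℝ) / 2 - 1)) = univ := by
    ext z; simp only [Function.mem_support, mem_univ, iff_true]
    have : 0 < 1 + ‖z‖ ^ 2 := by positivity
    positivity
  rw [this]; exact isOpen_univ.measure_pos volume univ_nonempty

lemma kEta_tendsto (hN : 1 ≤ N) {g : EuclideanSpace ℝ (Fin N) → ℝ} (hg : Integrable g)
    {x : EuclideanSpace ℝ (Fin N)} (hc : ContinuousAt g x) :
    Filter.Tendsto (fun c : ℝ => ∫ y, kEta (1 / c ^ 2) x y * g y) Filter.atTop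
      (nhds (cN N * g x)) := by
  have hcN := cN_pos hN
  let φ : EuclideanSpace ℝ (Fin N) → ℝ :=
    fun z => (cN N)⁻¹ * (N * (1 + ‖z‖ ^ 2) ^ (-(N : ℝ) / 2 - 1))
  have h := tendsto_integral_comp_smul_smul_of_integrable' (μ := volume) (φ := φ) (g := g) (x₀ := x)
    (fun z => by positivity) (by
      simp only [φ]; rw [integral_const_mul]
      exact inv_mul_cancel₀ hcN.ne') (by
      have hlim : Filter.Tendsto (fun z : EuclideanSpace ℝ (Fin N) => (cN N)⁻¹ * N *
          ((‖z‖ ^ 2)⁻¹)) (Bornology.cobounded _) (nhds 0) := by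
        rw [← mul_zero ((cN N)⁻¹ * (N : ℝ))]
        refine Filter.Tendsto.const_mul _ ?_
        exact (tendsto_inv_atTop_zero.comp ((Filter.tendsto_pow_atTop two_ne_zero).comp
          tendsto_norm_cobounded_atTop))
      refine squeeze_zero' (Filter.Eventually.of_forall fun z => by positivity) ?_ hlim
      filter_upwards [tendsto_norm_cobounded_atTop.eventually (Filter.eventually_gt_atTop 0)]
        with z hz
      simp only [φ, finrank_euclideanSpace, Fintype.card_fin]
      have h1 : (1 + ‖z‖ ^ 2) ^ (-(N : ℝ) / 2 - 1) ≤ (‖z‖ ^ 2) ^ (-(N : ℝ) / 2 - 1) :=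
        Real.rpow_le_rpow_of_nonpos (by positivity) (by linarith) (by
          have : (0 : ℝ) ≤ N := by positivity
          linarith)
      have h2 : (‖z‖ ^ 2) ^ (-(N : ℝ) / 2 - 1) = (‖z‖ ^ N)⁻¹ * (‖z‖ ^ 2)⁻¹ := by
        rw [← mul_inv, ← pow_add, ← Real.rpow_natCast, ← Real.rpow_natCast,
          ← Real.rpow_mul hz.le, ← Real.rpow_neg hz.le]
        congr 1; push_cast; ring
      rw [h2] at h1
      calc ‖z‖ ^ N * ((cN N)⁻¹ * (N * (1 + ‖z‖ ^ 2) ^ (-(N : ℝ) / 2 - 1)))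
          ≤ ‖z‖ ^ N * ((cN N)⁻¹ * (N * ((‖z‖ ^ N)⁻¹ * (‖z‖ ^ 2)⁻¹))) := by gcongr
        _ = _ := by field_simp) hg hc
  have h' := h.const_mul (cN N)
  refine h'.congr' ?_
  filter_upwards [Filter.eventually_gt_atTop 0] with c hc
  rw [← integral_const_mul]
  refine integral_congr_ae (Filter.Eventually.of_forall fun y => ?_)
  simp only [φ, finrank_euclideanSpace, Fintype.card_fin, smul_eq_mul, kEta, kD1_eq]
  have : (1 + ‖c • (x - y)‖ ^ 2) ^ (-(N : ℝ) / 2 - 1)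
      = (c ^ N)⁻¹ * (c ^ 2)⁻¹ * (‖x - y‖ ^ 2 + 1 / c ^ 2) ^ (-(N : ℝ) / 2 - 1) := by
    have e1 : 1 + ‖c • (x - y)‖ ^ 2 = c ^ 2 * (‖x - y‖ ^ 2 + 1 / c ^ 2) := by
      rw [norm_smul, Real.norm_eq_abs, mul_pow, sq_abs]; field_simp; ring
    rw [e1, Real.mul_rpow (by positivity) (by positivity)]
    congr 1
    rw [← mul_inv, ← pow_add, ← Real.rpow_natCast, ← Real.rpow_natCast,
          ← Real.rpow_mul hc.le, ← Real.rpow_neg hc.le]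
    congr 1; push_cast; ring
  rw [this]
  field_simp

end repr

end Part4

section Part5
section riesz
variable {N : ℕ} {R₀ R₁ : ℝ}

lemma integrableOn_norm_rpow (hN : 1 ≤ N) {θ ρ : ℝ} (hθ : θ < N) :
    IntegrableOn (fun z : EuclideanSpace ℝ (Fin N) => ‖z‖ ^ (-θ)) (Metric.ball 0 ρ) := by
  have : Nonempty (Fin N) := ⟨⟨0, hN⟩⟩
  rw [← integrable_indicator_iff measurableSet_ball]
  have h : (Metric.ball 0 ρ).indicator (fun z : EuclideanSpace ℝ (Fin N) => ‖z‖ ^ (-θ))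
      = fun z => (Iio ρ).indicator (fun t : ℝ => t ^ (-θ)) ‖z‖ := by
    funext z
    simp only [indicator, mem_ball_zero_iff, mem_Iio]
  rw [h, integrable_fun_norm_addHaar volume (f := (Iio ρ).indicator (fun t : ℝ => t ^ (-θ)))]
  simp only [finrank_euclideanSpace, Fintype.card_fin, smul_eq_mul]
  have h2 : (fun y : ℝ => y ^ (N - 1) * (Iio ρ).indicator (fun t : ℝ => t ^ (-θ)) y)
      = (Iio ρ).indicator (fun t : ℝ => t ^ (N - 1) * t ^ (-θ)) := by
    funext y; simp only [indicator]; split_ifs <;> simp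
  rw [h2, integrableOn_indicator_iff measurableSet_Iio]
  have h3 : Iio ρ ∩ Ioi 0 = Ioo 0 ρ := by ext; simp [and_comm]
  rw [h3]
  rcases le_or_gt ρ 0 with h0 | h0
  · simp [Ioo_eq_empty (not_lt.2 h0)]
  have := (intervalIntegral.integrableOn_Ioo_rpow_iff (s := (N - 1 : ℝ) - θ) h0).2 (by linarith)
  refine this.congr_fun (fun t ht => ?_) measurableSet_Ioo
  simp only
  rw [sub_eq_add_neg, Real.rpow_add ht.1, ← Real.rpow_natCast, Nat.cast_sub hN, Nat.cast_one]

lemma riesz_bound (hN : 1 ≤ N) {θ : ℝ} (hθ : θ < N) (R₀ R₁ : ℝ) :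
    ∃ C₀ : ℝ, 0 ≤ C₀ ∧ ∀ x ∈ annulus N R₀ R₁,
      IntegrableOn (fun y => ‖x - y‖ ^ (-θ)) (annulus N R₀ R₁) ∧
      ∫ y in annulus N R₀ R₁, ‖x - y‖ ^ (-θ) ≤ C₀ := by
  set g := (Metric.ball 0 (2 * R₁)).indicator (fun z : EuclideanSpace ℝ (Fin N) => ‖z‖ ^ (-θ))
    with hg
  have hgi : Integrable g :=
    (integrable_indicator_iff measurableSet_ball).2 (integrableOn_norm_rpow hN hθ)
  have hg0 : ∀ z, 0 ≤ g z := fun z => indicator_nonneg (fun _ _ => by positivity) z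
  refine ⟨∫ z, g z, integral_nonneg hg0, fun x hx => ?_⟩
  have hgx : Integrable (fun y => g (x - y)) := hgi.comp_sub_left x
  have heq : EqOn (fun y => g (x - y)) (fun y => ‖x - y‖ ^ (-θ)) (annulus N R₀ R₁) := by
    intro y hy
    have : x - y ∈ Metric.ball (0 : EuclideanSpace ℝ (Fin N)) (2 * R₁) := by
      rw [mem_ball_zero_iff]
      have := norm_sub_le x y
      linarith [hx.2, hy.2]
    simp only [hg, indicator_of_mem this]
  refine ⟨hgx.integrableOn.congr_fun heq isOpen_annulus.measurableSet, ?_⟩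
  rw [← setIntegral_congr_fun isOpen_annulus.measurableSet heq]
  calc _ ≤ ∫ y, g (x - y) := setIntegral_le_integral hgx (Filter.Eventually.of_forall fun y => hg0 _)
    _ = _ := integral_sub_left_eq_self g volume x

lemma kQ2_lapl_bound (hR₀ : 0 < R₀) (hR : R₀ < R₁) {R : ℝ} (hRR : R = R₀ ∨ R = R₁)
    {x e : EuclideanSpace ℝ (Fin N)} (he : ‖e‖ = 1) (hx : x ∈ annulus N R₀ R₁) :
    ∃ C : ℝ, ∀ τ, 0 < τ → ∀ y ∈ annulus N R₀ R₁,
      |lapl (kQ (‖x‖ ^ 2 / R ^ 2) (R ^ 2) (inner ℝ e x / R ^ 2) 0 τ x e) y| ≤ τ * C := by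
  obtain ⟨hx0, hx1⟩ := hx
  have hR1p : 0 < R₁ := hR₀.trans hR
  have hRp : 0 < R := by rcases hRR with rfl | rfl <;> linarith
  set α := inner ℝ e x / R ^ 2 with hα
  set κ := ‖x‖ ^ 2 / R ^ 2 with hκ
  have hκ0 : 0 ≤ κ := by positivity
  set d := (‖x‖ - R) ^ 2 with hd
  have hd0 : 0 < d := by
    have : ‖x‖ - R ≠ 0 := by rcases hRR with rfl | rfl <;> [exact (by linarith : 0 < ‖x‖ - R).ne';
      exact (by linarith : ‖x‖ - R < 0).ne]
    positivity
  refine ⟨2 * N * |α| * d ^ (-(N : ℝ) / 2 - 1)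
      + N * (N + 2) * κ * (|α| * R₁ ^ 2 + R₁) * d ^ (-(N : ℝ) / 2 - 2), fun τ hτ y hy => ?_⟩
  obtain ⟨hy0, hy1⟩ := hy
  rw [kQ_lapl (κ := κ) (kD2_pos hRp hτ x) (by rw [hκ]; field_simp)
    (by rw [hα]; field_simp; ring), abs_mul,
    abs_of_pos hτ]
  have hT : d ≤ kD κ (R ^ 2) x y + τ := by
    have h1 := kD2_ge hRp x y
    have h2 : d ≤ (‖x‖ * ‖y‖ / R - R) ^ 2 := by
      rw [hd]
      rcases hRR with rfl | rfl
      · have : ‖x‖ ≤ ‖x‖ * ‖y‖ / R := by rw [le_div_iff₀ hRp]; gcongr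
        gcongr
      · have : ‖x‖ * ‖y‖ / R ≤ ‖x‖ := by rw [div_le_iff₀ hRp]; gcongr
        nlinarith
    linarith
  have hN0 : (0 : ℝ) ≤ N := by positivity
  have t1 : (kD κ (R ^ 2) x y + τ) ^ (-(N : ℝ) / 2 - 1) ≤ d ^ (-(N : ℝ) / 2 - 1) :=
    Real.rpow_le_rpow_of_nonpos hd0 hT (by linarith)
  have t2 : (kD κ (R ^ 2) x y + τ) ^ (-(N : ℝ) / 2 - 2) ≤ d ^ (-(N : ℝ) / 2 - 2) :=
    Real.rpow_le_rpow_of_nonpos hd0 hT (by linarith)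
  have hTp : 0 < kD κ (R ^ 2) x y + τ := hd0.trans_le hT
  have hq : |kq α 0 e y| ≤ |α| * R₁ ^ 2 + R₁ := by
    rw [kq, add_zero]
    have := abs_real_inner_le_norm e y
    rw [he, one_mul] at this
    calc _ ≤ |α * ‖y‖ ^ 2| + |inner ℝ e y| := abs_sub _ _
      _ ≤ |α| * ‖y‖ ^ 2 + ‖y‖ := by rw [abs_mul, abs_of_nonneg (by positivity : 0 ≤ ‖y‖ ^ 2)]; gcongr
      _ ≤ _ := by gcongr
  refine mul_le_mul_of_nonneg_left ((abs_sub _ _).trans ?_) hτ.le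
  simp only [abs_mul, abs_of_nonneg (Real.rpow_nonneg hTp.le _), abs_of_nonneg hκ0,
    abs_of_nonneg hN0, abs_of_nonneg (by positivity : (0 : ℝ) ≤ N + 2), abs_two]
  gcongr

lemma repr_bound (hN : 2 ≤ N) (hR₀ : 0 < R₀) (hR : R₀ < R₁) {R : ℝ} (hRR : R = R₀ ∨ R = R₁)
    {h : EuclideanSpace ℝ (Fin N) → ℝ}
    (hh : ContDiffOn ℝ 2 h (closure (annulus N R₀ R₁)))
    (hbd : ∀ x : EuclideanSpace ℝ (Fin N), (‖x‖ = R₀ ∨ ‖x‖ = R₁) →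
      h x = 0 ∧ (‖x‖ = R ∨ ∀ i, pdv N R₀ R₁ i h x = 0)) {x e : EuclideanSpace ℝ (Fin N)}
    (he : ‖e‖ = 1) (hx : x ∈ annulus N R₀ R₁) :
    cN N * |fderiv ℝ h x e| ≤
      (1 + R₁ / R₀) * ∫ y in annulus N R₀ R₁, ‖x - y‖ ^ (1 - (N : ℝ)) * |lapl h y| := by
  have hR1p : 0 < R₁ := hR₀.trans hR
  have hRp : 0 < R := by rcases hRR with rfl | rfl <;> linarith
  have hN1 : 1 ≤ N := by omega
  have : Nonempty (Fin N) := ⟨⟨0, hN1⟩⟩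
  have hh1 : ContDiffOn ℝ 1 h (closure (annulus N R₀ R₁)) := hh.of_le (by norm_num)
  obtain ⟨C, hC⟩ := kQ2_lapl_bound hR₀ hR hRR he hx
  obtain ⟨C₀, -, hC₀⟩ := riesz_bound (N := N) hN1 (θ := (N : ℝ) - 1) (by linarith) R₀ R₁
  obtain ⟨hKi, -⟩ := hC₀ x hx
  rw [neg_sub] at hKi
  obtain ⟨L, hL, hLe⟩ := lapl_cont hR₀ hR hh
  obtain ⟨B, hB⟩ := isCompact_closure_annulus.exists_bound_of_continuousOn hL
  have hms := (isOpen_annulus (N := N) (R₀ := R₀) (R₁ := R₁)).measurableSet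
  have hKL : IntegrableOn (fun y => ‖x - y‖ ^ (1 - (N : ℝ)) * |lapl h y|) (annulus N R₀ R₁) := by
    have : IntegrableOn (fun y => ‖x - y‖ ^ (1 - (N : ℝ)) * |L y|) (annulus N R₀ R₁) := by
      refine Integrable.mul_bdd (c := B) hKi ?_ ?_
      · exact ((hL.mono subset_closure).aestronglyMeasurable hms).norm
      · refine (ae_restrict_iff' hms).2 (Filter.Eventually.of_forall fun y hy => ?_)
        rw [Real.norm_eq_abs, abs_abs]; exact hB y (subset_closure hy)
    exact this.congr_fun (fun y hy => by simp only [hLe y hy]) hms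
  set g := (annulus N R₀ R₁).indicator (fun y => fderiv ℝ h y e) with hg
  have hgi : Integrable g := (integrable_indicator_iff hms).2 (integrableOn_fderiv hR₀ hR hh1 e)
  have hgc : ContinuousAt g x := by
    have h1 : g =ᶠ[nhds x] fun y => fderivWithin ℝ h (closure (annulus N R₀ R₁)) y e := by
      filter_upwards [isOpen_annulus.mem_nhds hx] with y hy
      rw [hg, indicator_of_mem hy, fderivWithin_eq_of_mem hy]
    have h2 : ContinuousOn (fun x => fderivWithin ℝ h (closure (annulus N R₀ R₁)) x e)
      (closure (annulus N R₀ R₁)) :=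
      (hh1.continuousOn_fderivWithin (uniqueDiffOn_cA hR₀ hR) le_rfl).clm_apply continuousOn_const
    exact (h2.continuousAt (mem_nhds_cA hx)).congr h1.symm
  have hlim := (kEta_tendsto hN1 hgi hgc).abs
  have hgx : g x = fderiv ℝ h x e := indicator_of_mem hx _
  rw [hgx, abs_mul, abs_of_pos (cN_pos hN1)] at hlim
  have hlim2 : Filter.Tendsto (fun c : ℝ => (1 + R₁ / R₀) *
      (∫ y in annulus N R₀ R₁, ‖x - y‖ ^ (1 - (N : ℝ)) * |lapl h y|)
      + (1 / c ^ 2) * (C * ∫ y in annulus N R₀ R₁, |h y|)) Filter.atTop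
      (nhds ((1 + R₁ / R₀) *
      (∫ y in annulus N R₀ R₁, ‖x - y‖ ^ (1 - (N : ℝ)) * |lapl h y|))) := by
    have : Filter.Tendsto (fun c : ℝ => 1 / c ^ 2) Filter.atTop (nhds 0) := by
      simp only [one_div]
      exact tendsto_inv_atTop_zero.comp (Filter.tendsto_pow_atTop two_ne_zero)
    simpa using (this.mul_const (C * ∫ y in annulus N R₀ R₁, |h y|)).const_add _
  refine le_of_tendsto_of_tendsto hlim hlim2 ?_
  filter_upwards [Filter.eventually_gt_atTop 0] with c hc
  have hτ : 0 < 1 / c ^ 2 := by positivity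
  have e1 : ∫ y, kEta (1 / c ^ 2) x y * g y
      = ∫ y in annulus N R₀ R₁, kEta (1 / c ^ 2) x y * fderiv ℝ h y e := by
    rw [← integral_indicator hms]
    refine integral_congr_ae (Filter.Eventually.of_forall fun y => ?_)
    simp only [hg, indicator]; split_ifs <;> simp
  rw [e1, repr_eq hN1 hR₀ hR hRp hτ hh hbd x e]
  have hne : ∀ᵐ y ∂(volume.restrict (annulus N R₀ R₁)), x ≠ y := by
    refine ae_restrict_of_ae ?_
    have := (measure_singleton (μ := (volume : Measure (EuclideanSpace ℝ (Fin N)))) x)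
    rw [ae_iff]
    convert this using 2
    ext y; simp [eq_comm]
  refine (abs_add_le _ _).trans (add_le_add ?_ ?_)
  · rw [← integral_const_mul]
    refine (abs_integral_le_integral_abs).trans ?_
    refine integral_mono_of_nonneg (Filter.Eventually.of_forall fun y => abs_nonneg _)
      (hKL.const_mul _) ?_
    filter_upwards [hne, ae_restrict_mem hms] with y hy hyA
    rw [abs_mul, ← mul_assoc]
    exact mul_le_mul_of_nonneg_right (kP_bound hN1 hR₀ hR hRR hτ he hx hyA hy) (abs_nonneg _)
  · rw [← mul_assoc, ← integral_const_mul]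
    refine (abs_integral_le_integral_abs).trans ?_
    refine integral_mono_of_nonneg (Filter.Eventually.of_forall fun y => abs_nonneg _)
      ((integrableOn_of_cont hh.continuousOn).abs.const_mul _) ?_
    filter_upwards [ae_restrict_mem hms] with y hyA
    rw [abs_mul, mul_comm]
    exact mul_le_mul_of_nonneg_right (hC _ hτ y hyA) (abs_nonneg _)

end riesz

end Part5

section Part6
section gradest
variable {N : ℕ} {R₀ R₁ : ℝ}

lemma cut_hasFDerivAt (c s : ℝ) (y : EuclideanSpace ℝ (Fin N)) :
    HasFDerivAt (fun y : EuclideanSpace ℝ (Fin N) => c * (‖y‖ ^ 2 - s))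
      (c • (2 • innerSL ℝ y)) y :=
  (((hasStrictFDerivAt_norm_sq y).hasFDerivAt).sub_const s).const_mul c

lemma cut_contDiff (c s : ℝ) :
    ContDiff ℝ 2 (fun y : EuclideanSpace ℝ (Fin N) => c * (‖y‖ ^ 2 - s)) :=
  contDiff_const.mul ((contDiff_norm_sq ℝ).sub contDiff_const)

lemma lapl_cut (hR₀ : 0 < R₀) (hR : R₀ < R₁) {w : EuclideanSpace ℝ (Fin N) → ℝ}
    (hw : ContDiffOn ℝ 2 w (closure (annulus N R₀ R₁))) (c s : ℝ)
    {x : EuclideanSpace ℝ (Fin N)} (hx : x ∈ annulus N R₀ R₁) :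
    lapl (fun y => c * (‖y‖ ^ 2 - s) * w y) x
      = c * (‖x‖ ^ 2 - s) * lapl w x + 4 * c * fderiv ℝ w x x + 2 * N * c * w x := by
  have hw1 : ContDiffOn ℝ 1 w (closure (annulus N R₀ R₁)) := hw.of_le (by norm_num)
  have hsum : fderiv ℝ w x x = ∑ i, x i * fderiv ℝ w x (EuclideanSpace.single i 1) := by
    conv_lhs => rw [show x = ∑ i, x i • (EuclideanSpace.single i (1 : ℝ)) by
      simpa using ((EuclideanSpace.basisFun (Fin N) ℝ).sum_repr x).symm]
    rw [map_sum]
    refine Finset.sum_congr rfl fun i _ => ?_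
    rw [map_smul, smul_eq_mul]
    congr 3
    simpa using ((EuclideanSpace.basisFun (Fin N) ℝ).sum_repr x)
  have hterm : ∀ i : Fin N,
      fderiv ℝ (fun y => fderiv ℝ (fun y => c * (‖y‖ ^ 2 - s) * w y) y (EuclideanSpace.single i 1)) x
        (EuclideanSpace.single i 1) =
      c * (‖x‖ ^ 2 - s) * fderiv ℝ (pdv N R₀ R₁ i w) x (EuclideanSpace.single i 1)
      + 4 * c * (x i * fderiv ℝ w x (EuclideanSpace.single i 1)) + 2 * c * w x := by
    intro i
    have hev : (fun y => fderiv ℝ (fun y => c * (‖y‖ ^ 2 - s) * w y) y (EuclideanSpace.single i 1))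
        =ᶠ[nhds x] fun y => c * (‖y‖ ^ 2 - s) * pdv N R₀ R₁ i w y + w y * (2 * c * y i) := by
      filter_upwards [isOpen_annulus.mem_nhds hx] with y hy
      have d2 : DifferentiableAt ℝ w y := hw1.diffAt hy
      have := (cut_hasFDerivAt c s y).mul d2.hasFDerivAt
      have h' : HasFDerivAt (fun y => c * (‖y‖ ^ 2 - s) * w y) _ y := this
      rw [h'.fderiv, pdv_eq hy]
      simp [EuclideanSpace.inner_single_right]
      left; ring
    rw [hev.fderiv_eq]
    have hl : HasFDerivAt (fun y : EuclideanSpace ℝ (Fin N) => y i)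
        (EuclideanSpace.proj i : EuclideanSpace ℝ (Fin N) →L[ℝ] ℝ) x :=
      (EuclideanSpace.proj i : EuclideanSpace ℝ (Fin N) →L[ℝ] ℝ).hasFDerivAt
    have d2 : DifferentiableAt ℝ w x := hw1.diffAt hx
    have d3 : DifferentiableAt ℝ (pdv N R₀ R₁ i w) x := (pdv_contDiffOn hR₀ hR i hw).diffAt hx
    have h := ((cut_hasFDerivAt c s x).mul d3.hasFDerivAt).add
      (d2.hasFDerivAt.mul (hl.const_mul (2 * c)))
    have h' : HasFDerivAt (fun y : EuclideanSpace ℝ (Fin N) =>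
      c * (‖y‖ ^ 2 - s) * pdv N R₀ R₁ i w y + w y * (2 * c * y i)) _ x := h
    rw [h'.fderiv]
    simp [EuclideanSpace.inner_single_right, pdv_eq hx]
    ring
  rw [lapl, Finset.sum_congr rfl fun i _ => hterm i, Finset.sum_add_distrib,
    Finset.sum_add_distrib, ← Finset.mul_sum, ← Finset.mul_sum, ← hsum, ← lapl_eq_pdv hx]
  simp only [Finset.sum_const, Finset.card_univ, Fintype.card_fin, nsmul_eq_mul]
  ring

lemma riesz_mul_integrable (hN : 1 ≤ N) {θ : ℝ} (hθ : θ < N) {F : EuclideanSpace ℝ (Fin N) → ℝ}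
    (hF : ContinuousOn F (closure (annulus N R₀ R₁))) {x : EuclideanSpace ℝ (Fin N)}
    (hx : x ∈ annulus N R₀ R₁) :
    IntegrableOn (fun y => ‖x - y‖ ^ (-θ) * F y) (annulus N R₀ R₁) := by
  have hms := (isOpen_annulus (N := N) (R₀ := R₀) (R₁ := R₁)).measurableSet
  obtain ⟨C₀, -, hC₀⟩ := riesz_bound (N := N) hN hθ R₀ R₁
  obtain ⟨B, hB⟩ := isCompact_closure_annulus.exists_bound_of_continuousOn hF
  refine Integrable.mul_bdd (c := B) (hC₀ x hx).1 ?_ ?_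
  · exact ((hF.mono subset_closure).aestronglyMeasurable hms)
  · exact (ae_restrict_iff' hms).2 (Filter.Eventually.of_forall fun y hy => hB y (subset_closure hy))

lemma cut_bound (hN : 2 ≤ N) (hR₀ : 0 < R₀) (hR : R₀ < R₁) {R R' : ℝ}
    (hRR : R = R₀ ∧ R' = R₁ ∨ R = R₁ ∧ R' = R₀)
    {w f : EuclideanSpace ℝ (Fin N) → ℝ}
    (hw : ContDiffOn ℝ 2 w (closure (annulus N R₀ R₁)))
    (hf : ContinuousOn f (closure (annulus N R₀ R₁)))
    (hbd : ∀ x : EuclideanSpace ℝ (Fin N), (‖x‖ = R₀ ∨ ‖x‖ = R₁) → w x = 0)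
    (heq : ∀ x ∈ annulus N R₀ R₁, lapl w x = w x - f x)
    {x e : EuclideanSpace ℝ (Fin N)}
    (he : ‖e‖ = 1) (hx : x ∈ annulus N R₀ R₁) :
    cN N * |fderiv ℝ (fun y => (1 / (R ^ 2 - R' ^ 2)) * (‖y‖ ^ 2 - R' ^ 2) * w y) x e| ≤
      (1 + R₁ / R₀) * ∫ y in annulus N R₀ R₁, ‖x - y‖ ^ (1 - (N : ℝ)) *
        (|f y| + (1 + (4 * R₁ + 2 * N) / (R₁ ^ 2 - R₀ ^ 2)) *
          (‖fderivWithin ℝ w (closure (annulus N R₀ R₁)) y‖ + |w y|)) := by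
  have hR1p : 0 < R₁ := hR₀.trans hR
  have hsq : R₀ ^ 2 < R₁ ^ 2 := by gcongr
  have hw1 : ContDiffOn ℝ 1 w (closure (annulus N R₀ R₁)) := hw.of_le (by norm_num)
  have hms := (isOpen_annulus (N := N) (R₀ := R₀) (R₁ := R₁)).measurableSet
  have hsub : 0 < R₁ ^ 2 - R₀ ^ 2 := by linarith
  have hne : R ^ 2 - R' ^ 2 ≠ 0 := by
    rcases hRR with ⟨rfl, rfl⟩ | ⟨rfl, rfl⟩
    · exact (by linarith : R ^ 2 - R' ^ 2 < 0).ne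
    · exact hsub.ne'
  have habs : |1 / (R ^ 2 - R' ^ 2)| = 1 / (R₁ ^ 2 - R₀ ^ 2) := by
    rcases hRR with ⟨rfl, rfl⟩ | ⟨rfl, rfl⟩
    · rw [abs_div, abs_one, abs_sub_comm, abs_of_pos hsub]
    · rw [abs_div, abs_one, abs_of_pos hsub]
  set c := 1 / (R ^ 2 - R' ^ 2) with hc
  have hhC : ContDiffOn ℝ 2 (fun y => c * (‖y‖ ^ 2 - R' ^ 2) * w y) (closure (annulus N R₀ R₁)) :=
    (cut_contDiff c (R' ^ 2)).contDiffOn.mul hw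
  have hb := repr_bound hN hR₀ hR (R := R) (by tauto) hhC (fun y hy => by
    refine ⟨by simp [hbd y hy], ?_⟩
    by_cases hyR : ‖y‖ = R
    · exact Or.inl hyR
    · right
      have hyR' : ‖y‖ = R' := by
        rcases hRR with ⟨rfl, rfl⟩ | ⟨rfl, rfl⟩ <;> tauto
      intro i
      have hyc : y ∈ closure (annulus N R₀ R₁) := by
        rw [mem_closure_annulus hR₀ hR]
        rcases hy with h | h <;> rw [h] <;> constructor <;> linarith
      have d1 := (cut_hasFDerivAt c (R' ^ 2) y).hasFDerivWithinAt (s := closure (annulus N R₀ R₁))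
      have d2 := ((hw1.differentiableOn one_ne_zero) y hyc).hasFDerivWithinAt
      have h' : HasFDerivWithinAt (fun y => c * (‖y‖ ^ 2 - R' ^ 2) * w y) _
        (closure (annulus N R₀ R₁)) y := d1.mul d2
      rw [pdv, h'.fderivWithin (uniqueDiffOn_cA hR₀ hR y hyc)]
      simp [hyR', hbd y hy]) he hx
  refine hb.trans (mul_le_mul_of_nonneg_left ?_ (by positivity))
  have hcont : ContinuousOn (fun y => |f y| + (1 + (4 * R₁ + 2 * N) / (R₁ ^ 2 - R₀ ^ 2)) *
          (‖fderivWithin ℝ w (closure (annulus N R₀ R₁)) y‖ + |w y|))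
          (closure (annulus N R₀ R₁)) :=
    hf.abs.add (continuousOn_const.mul
      ((hw1.continuousOn_fderivWithin (uniqueDiffOn_cA hR₀ hR) le_rfl).norm.add hw.continuousOn.abs))
  have hInteg := riesz_mul_integrable (by omega) (θ := (N : ℝ) - 1) (by linarith) hcont hx
  rw [neg_sub] at hInteg
  refine integral_mono_of_nonneg (Filter.Eventually.of_forall fun y => by positivity) hInteg ?_
  filter_upwards [ae_restrict_mem hms] with y hy
  refine mul_le_mul_of_nonneg_left ?_ (by positivity)
  rw [lapl_cut hR₀ hR hw _ _ hy, heq y hy, fderivWithin_eq_of_mem hy]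
  have hy2 : R₀ ^ 2 < ‖y‖ ^ 2 := by have := hy.1; gcongr
  have hy3 : ‖y‖ ^ 2 < R₁ ^ 2 := by have := hy.2; gcongr
  have h1 : |c * (‖y‖ ^ 2 - R' ^ 2)| ≤ 1 := by
    rw [abs_mul, habs, one_div, inv_mul_le_iff₀ hsub, abs_le]
    rcases hRR with ⟨rfl, rfl⟩ | ⟨rfl, rfl⟩ <;> constructor <;> linarith
  have h2 : |fderiv ℝ w y y| ≤ ‖fderiv ℝ w y‖ * R₁ :=
    ((fderiv ℝ w y).le_opNorm y).trans (by gcongr; exact hy.2.le)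
  have h3 : |w y - f y| ≤ |w y| + |f y| := abs_sub _ _
  calc _ ≤ |c * (‖y‖ ^ 2 - R' ^ 2) * (w y - f y)| + |4 * c * fderiv ℝ w y y| + |2 * N * c * w y| :=
        abs_add_three _ _ _
    _ = |c * (‖y‖ ^ 2 - R' ^ 2)| * |w y - f y| + 4 * (1 / (R₁ ^ 2 - R₀ ^ 2)) * |fderiv ℝ w y y|
        + 2 * N * (1 / (R₁ ^ 2 - R₀ ^ 2)) * |w y| := by
      rw [← habs]; simp only [abs_mul, Nat.abs_cast, abs_two, Nat.abs_ofNat]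
    _ ≤ 1 * (|w y| + |f y|) + 4 * (1 / (R₁ ^ 2 - R₀ ^ 2)) * (‖fderiv ℝ w y‖ * R₁)
        + 2 * N * (1 / (R₁ ^ 2 - R₀ ^ 2)) * |w y| := by gcongr
    _ ≤ _ := by
      have e : (|f y| + (1 + (4 * R₁ + 2 * N) / (R₁ ^ 2 - R₀ ^ 2)) * (‖fderiv ℝ w y‖ + |w y|))
        - (1 * (|w y| + |f y|) + 4 * (1 / (R₁ ^ 2 - R₀ ^ 2)) * (‖fderiv ℝ w y‖ * R₁)
        + 2 * N * (1 / (R₁ ^ 2 - R₀ ^ 2)) * |w y|) = ‖fderiv ℝ w y‖ + 2 * N / (R₁ ^ 2 - R₀ ^ 2)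
          * ‖fderiv ℝ w y‖ + 4 * R₁ / (R₁ ^ 2 - R₀ ^ 2) * |w y| := by
        field_simp; ring
      have : 0 ≤ ‖fderiv ℝ w y‖ + 2 * N / (R₁ ^ 2 - R₀ ^ 2)
          * ‖fderiv ℝ w y‖ + 4 * R₁ / (R₁ ^ 2 - R₀ ^ 2) * |w y| := by positivity
      linarith

lemma grad_bound1 (hN : 2 ≤ N) (hR₀ : 0 < R₀) (hR : R₀ < R₁)
    {w f : EuclideanSpace ℝ (Fin N) → ℝ}
    (hw : ContDiffOn ℝ 2 w (closure (annulus N R₀ R₁)))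
    (hf : ContinuousOn f (closure (annulus N R₀ R₁)))
    (hbd : ∀ x : EuclideanSpace ℝ (Fin N), (‖x‖ = R₀ ∨ ‖x‖ = R₁) → w x = 0)
    (heq : ∀ x ∈ annulus N R₀ R₁, lapl w x = w x - f x)
    {x : EuclideanSpace ℝ (Fin N)} (hx : x ∈ annulus N R₀ R₁) :
    ‖fderiv ℝ w x‖ ≤
      (2 * (1 + R₁ / R₀) / cN N) * ∫ y in annulus N R₀ R₁, ‖x - y‖ ^ (1 - (N : ℝ)) *
        (|f y| + (1 + (4 * R₁ + 2 * N) / (R₁ ^ 2 - R₀ ^ 2)) *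
          (‖fderivWithin ℝ w (closure (annulus N R₀ R₁)) y‖ + |w y|)) := by
  have hcN := cN_pos (N := N) (by omega)
  have hR1p : 0 < R₁ := hR₀.trans hR
  have hsq : R₀ ^ 2 < R₁ ^ 2 := by gcongr
  have hsub : R₁ ^ 2 - R₀ ^ 2 ≠ 0 := (by linarith : 0 < R₁ ^ 2 - R₀ ^ 2).ne'
  have hsub' : R₀ ^ 2 - R₁ ^ 2 ≠ 0 := (by linarith : R₀ ^ 2 - R₁ ^ 2 < 0).ne
  have hw1 : ContDiffOn ℝ 1 w (closure (annulus N R₀ R₁)) := hw.of_le (by norm_num)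
  have hwx : DifferentiableAt ℝ w x := hw1.diffAt hx
  refine ContinuousLinearMap.opNorm_le_of_unit_norm (𝕜 := ℝ) ?_ ?_
  · have : 0 < R₁ ^ 2 - R₀ ^ 2 := by linarith
    have : 0 ≤ ∫ y in annulus N R₀ R₁, ‖x - y‖ ^ (1 - (N : ℝ)) *
        (|f y| + (1 + (4 * R₁ + 2 * N) / (R₁ ^ 2 - R₀ ^ 2)) *
          (‖fderivWithin ℝ w (closure (annulus N R₀ R₁)) y‖ + |w y|)) :=
      integral_nonneg fun y => by positivity
    positivity
  intro e he
  have b1 := cut_bound hN hR₀ hR (Or.inl ⟨rfl, rfl⟩) hw hf hbd heq he hx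
  have b2 := cut_bound hN hR₀ hR (Or.inr ⟨rfl, rfl⟩) hw hf hbd heq he hx
  have d1 : DifferentiableAt ℝ (fun y => 1 / (R₀ ^ 2 - R₁ ^ 2) * (‖y‖ ^ 2 - R₁ ^ 2) * w y) x :=
    (cut_hasFDerivAt _ _ x).differentiableAt.mul hwx
  have d2 : DifferentiableAt ℝ (fun y => 1 / (R₁ ^ 2 - R₀ ^ 2) * (‖y‖ ^ 2 - R₀ ^ 2) * w y) x :=
    (cut_hasFDerivAt _ _ x).differentiableAt.mul hwx
  have hadd : fderiv ℝ w x e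
      = fderiv ℝ (fun y => 1 / (R₀ ^ 2 - R₁ ^ 2) * (‖y‖ ^ 2 - R₁ ^ 2) * w y) x e
      + fderiv ℝ (fun y => 1 / (R₁ ^ 2 - R₀ ^ 2) * (‖y‖ ^ 2 - R₀ ^ 2) * w y) x e := by
    rw [← _root_.add_apply, ← fderiv_fun_add d1 d2]
    congr 2
    funext y
    have : R₀ ^ 2 - R₁ ^ 2 = -(R₁ ^ 2 - R₀ ^ 2) := by ring
    rw [this]
    field_simp
    ring
  rw [Real.norm_eq_abs, hadd, div_mul_eq_mul_div, le_div_iff₀ hcN]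
  refine (mul_le_mul_of_nonneg_right (abs_add_le _ _) hcN.le).trans ?_
  linarith

end gradest

end Part6

section Part7
section gradest2
variable {N : ℕ} {R₀ R₁ : ℝ}

lemma young_aux {K F s : ℝ} (hK : 0 ≤ K) (hF : 0 ≤ F) (hs : 0 < s) {n : ℕ} (hn : 1 ≤ n) :
    K * F ≤ s * K ^ (1 + 1 / (n : ℝ)) + (s ^ n)⁻¹ * F ^ (n + 1) := by
  have hn' : (0 : ℝ) < n := by exact_mod_cast hn
  have hKp : K ^ (1 + 1 / (n : ℝ)) = K * K ^ (1 / (n : ℝ)) := by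
    rw [Real.rpow_add' hK (by positivity), Real.rpow_one]
  rcases le_or_gt F (s * K ^ (1 / (n : ℝ))) with h | h
  · have : K * F ≤ s * K ^ (1 + 1 / (n : ℝ)) := by
      rw [hKp]
      calc K * F ≤ K * (s * K ^ (1 / (n : ℝ))) := by gcongr
        _ = _ := by ring
    have h2 : 0 ≤ (s ^ n)⁻¹ * F ^ (n + 1) := by positivity
    linarith
  · have h1 : s ^ n * K ≤ F ^ n := by
      have := pow_le_pow_left₀ (by positivity) h.le n
      rwa [mul_pow, ← Real.rpow_mul_natCast hK, one_div, inv_mul_cancel₀ hn'.ne',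
        Real.rpow_one] at this
    have h2 : K ≤ (s ^ n)⁻¹ * F ^ n := by
      rw [le_inv_mul_iff₀ (by positivity)]; exact h1
    have h3 : K * F ≤ (s ^ n)⁻¹ * F ^ (n + 1) := by
      calc K * F ≤ ((s ^ n)⁻¹ * F ^ n) * F := by gcongr
        _ = _ := by ring
    have h4 : 0 ≤ s * K ^ (1 + 1 / (n : ℝ)) := by positivity
    linarith

set_option maxHeartbeats 2000000 in
lemma grad_est (hN : 2 ≤ N) (hR₀ : 0 < R₀) (hR : R₀ < R₁) {δ : ℝ} (hδ : 0 < δ) :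
    ∃ C : ℝ, 0 ≤ C ∧ ∀ w f : EuclideanSpace ℝ (Fin N) → ℝ,
      ContDiffOn ℝ 2 w (closure (annulus N R₀ R₁)) →
      ContinuousOn f (closure (annulus N R₀ R₁)) →
      (∀ x : EuclideanSpace ℝ (Fin N), (‖x‖ = R₀ ∨ ‖x‖ = R₁) → w x = 0) →
      (∀ x ∈ annulus N R₀ R₁, lapl w x = w x - f x) →
      ∀ x ∈ annulus N R₀ R₁, ‖fderiv ℝ w x‖ ≤
        δ + C * ((∫ y in annulus N R₀ R₁, |f y| ^ (2 * N)) + H1sq N R₀ R₁ w) := by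
  have hcN := cN_pos (N := N) (by omega)
  have hR1p : 0 < R₁ := hR₀.trans hR
  have hsq : R₀ ^ 2 < R₁ ^ 2 := by gcongr
  have hsub : 0 < R₁ ^ 2 - R₀ ^ 2 := by linarith
  have hms := (isOpen_annulus (N := N) (R₀ := R₀) (R₁ := R₁)).measurableSet
  set A1 := 2 * (1 + R₁ / R₀) / cN N with hA1
  have hA1p : 0 < A1 := by positivity
  set C1 := 1 + (4 * R₁ + 2 * N) / (R₁ ^ 2 - R₀ ^ 2) with hC1
  have hC1p : 0 < C1 := by positivity
  set n := 2 * N - 1 with hn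
  have hn1 : n + 1 = 2 * N := by omega
  have hN2 : (2 : ℝ) ≤ N := by exact_mod_cast hN
  have hnr : (n : ℝ) = 2 * N - 1 := by
    have : ((n + 1 : ℕ) : ℝ) = ((2 * N : ℕ) : ℝ) := by rw [hn1]
    push_cast at this; linarith
  set θ := ((N : ℝ) - 1) * (1 + 1 / (n : ℝ)) with hθ
  have hnp : (0 : ℝ) < n := by rw [hnr]; linarith
  have hθN : θ < N := by
    rw [hθ]
    have : ((N : ℝ) - 1) * (1 + 1 / (n : ℝ)) = N - (1 - ((N : ℝ) - 1) / n) := by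
      field_simp; ring
    rw [this]
    have : ((N : ℝ) - 1) / n < 1 := by rw [div_lt_one hnp, hnr]; linarith
    linarith
  obtain ⟨C₀, hC₀p, hC₀⟩ := riesz_bound (N := N) (by omega) hθN R₀ R₁
  set V := volume.real (annulus N R₀ R₁) with hV
  have hV0 : 0 ≤ V := measureReal_nonneg
  have hVfin : volume (annulus N R₀ R₁) ≠ ⊤ :=
    ((measure_mono subset_closure).trans_lt isCompact_closure_annulus.measure_lt_top).ne
  set s1 := δ / (4 * A1 * (C₀ + 1)) with hs1
  set s2 := 1 / (2 * A1 * C1 * (1 + R₁) * (C₀ + 1)) with hs2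
  set s3 := δ / (4 * A1 * (V + 1)) with hs3
  have hs1p : 0 < s1 := by positivity
  have hs2p : 0 < s2 := by positivity
  have hs3p : 0 < s3 := by positivity
  set B := C1 * (s2 ^ n)⁻¹ with hB
  have hBp : 0 < B := by positivity
  set C2 := (s1 ^ n)⁻¹ + B ^ 2 / (2 * s3) with hC2
  refine ⟨2 * (A1 * C2), by positivity, fun w f hw hf hbd heq => ?_⟩
  have hw1 : ContDiffOn ℝ 1 w (closure (annulus N R₀ R₁)) := hw.of_le (by norm_num)
  have hdw := hw1.continuousOn_fderivWithin (uniqueDiffOn_cA hR₀ hR) le_rfl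
  have hif : IntegrableOn (fun y => |f y| ^ (2 * N)) (annulus N R₀ R₁) :=
    integrableOn_of_cont (hf.abs.pow _)
  have hiw : IntegrableOn (fun y => ‖fderivWithin ℝ w (closure (annulus N R₀ R₁)) y‖ ^ 2
    + (w y) ^ 2) (annulus N R₀ R₁) :=
    integrableOn_of_cont ((hdw.norm.pow _).add (hw.continuousOn.pow _))
  set J := (∫ y in annulus N R₀ R₁, |f y| ^ (2 * N)) + H1sq N R₀ R₁ w with hJ
  have hf0 : 0 ≤ ∫ y in annulus N R₀ R₁, |f y| ^ (2 * N) := integral_nonneg fun y => by positivity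
  have hw0 : 0 ≤ H1sq N R₀ R₁ w := integral_nonneg fun y => by positivity
  have key : ∀ M, 0 ≤ M → (∀ x ∈ annulus N R₀ R₁, ‖fderiv ℝ w x‖ ≤ M) →
      ∀ x ∈ annulus N R₀ R₁, ‖fderiv ℝ w x‖ ≤ M / 2 + δ / 2 + A1 * C2 * J := by
    intro M hM0 hM x hx
    refine (grad_bound1 hN hR₀ hR hw hf hbd heq hx).trans ?_
    obtain ⟨hKi, hKb⟩ := hC₀ x hx
    set κ := s1 + C1 * s2 * (M * (1 + R₁)) with hκ
    have hmaj : IntegrableOn (fun y => κ * ‖x - y‖ ^ (-θ) + (s1 ^ n)⁻¹ * |f y| ^ (2 * N) + s3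
        + B ^ 2 / (2 * s3) * (‖fderivWithin ℝ w (closure (annulus N R₀ R₁)) y‖ ^ 2
        + (w y) ^ 2)) (annulus N R₀ R₁) :=
      (((hKi.const_mul κ).add (hif.const_mul _)).add (integrableOn_const hVfin)).add
        (hiw.const_mul _)
    have hle : ∫ y in annulus N R₀ R₁, ‖x - y‖ ^ (1 - (N : ℝ)) *
        (|f y| + C1 * (‖fderivWithin ℝ w (closure (annulus N R₀ R₁)) y‖ + |w y|))
        ≤ ∫ y in annulus N R₀ R₁, (κ * ‖x - y‖ ^ (-θ) + (s1 ^ n)⁻¹ * |f y| ^ (2 * N) + s3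
        + B ^ 2 / (2 * s3) * (‖fderivWithin ℝ w (closure (annulus N R₀ R₁)) y‖ ^ 2
        + (w y) ^ 2)) := by
      refine integral_mono_of_nonneg (Filter.Eventually.of_forall fun y => by positivity) hmaj ?_
      filter_upwards [ae_restrict_mem hms] with y hy
      set K := ‖x - y‖ ^ (1 - (N : ℝ)) with hK
      have hK0 : 0 ≤ K := by positivity
      have hKθ : K ^ (1 + 1 / (n : ℝ)) = ‖x - y‖ ^ (-θ) := by
        rw [hK, ← Real.rpow_mul (norm_nonneg _)]; congr 1; rw [hθ]; ring
      set D := ‖fderivWithin ℝ w (closure (annulus N R₀ R₁)) y‖ with hD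
      have hD0 : 0 ≤ D := norm_nonneg _
      have y1 := young_aux hK0 (abs_nonneg (f y)) hs1p (n := n) (by omega)
      have y2 := young_aux hK0 zero_le_one hs2p (n := n) (by omega)
      rw [hKθ, hn1] at y1
      rw [hKθ, one_pow, mul_one, mul_one] at y2
      have hG : D + |w y| ≤ M * (1 + R₁) := by
        have h1 : D ≤ M := by rw [hD, fderivWithin_eq_of_mem hy]; exact hM y hy
        have h2 := memC10_abs_le hR₀ ⟨hw1, hbd⟩ hM hM0 (subset_closure hy)
        linarith
      set G := D + |w y| with hGd
      have hG0 : 0 ≤ G := by positivity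
      have hG2 : G ^ 2 ≤ 2 * (D ^ 2 + (w y) ^ 2) := by
        rw [hGd, ← sq_abs (w y)]; nlinarith [sq_nonneg (D - |w y|)]
      have y3 : B * G ≤ s3 + B ^ 2 / (4 * s3) * G ^ 2 := by
        have : s3 + B ^ 2 / (4 * s3) * G ^ 2 - B * G = (B * G - 2 * s3) ^ 2 / (4 * s3) := by
          field_simp; ring
        have : 0 ≤ (B * G - 2 * s3) ^ 2 / (4 * s3) := by positivity
        linarith
      have y4 : B ^ 2 / (4 * s3) * G ^ 2 ≤ B ^ 2 / (2 * s3) * (D ^ 2 + (w y) ^ 2) := by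
        calc _ ≤ B ^ 2 / (4 * s3) * (2 * (D ^ 2 + (w y) ^ 2)) := by gcongr
          _ = _ := by field_simp; ring
      have y5 : K * (C1 * G) ≤ C1 * s2 * (M * (1 + R₁)) * ‖x - y‖ ^ (-θ) + B * G := by
        calc K * (C1 * G) ≤ (s2 * ‖x - y‖ ^ (-θ) + (s2 ^ n)⁻¹) * (C1 * G) := by gcongr
          _ = C1 * s2 * G * ‖x - y‖ ^ (-θ) + B * G := by rw [hB]; ring
          _ ≤ _ := by gcongr
      calc K * (|f y| + C1 * G) = K * |f y| + K * (C1 * G) := by ring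
        _ ≤ _ := by rw [hκ]; linarith
    have hval : ∫ y in annulus N R₀ R₁, (κ * ‖x - y‖ ^ (-θ) + (s1 ^ n)⁻¹ * |f y| ^ (2 * N) + s3
        + B ^ 2 / (2 * s3) * (‖fderivWithin ℝ w (closure (annulus N R₀ R₁)) y‖ ^ 2
        + (w y) ^ 2)) = κ * (∫ y in annulus N R₀ R₁, ‖x - y‖ ^ (-θ))
        + (s1 ^ n)⁻¹ * (∫ y in annulus N R₀ R₁, |f y| ^ (2 * N)) + V * s3
        + B ^ 2 / (2 * s3) * H1sq N R₀ R₁ w := by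
      have hconst : Integrable (fun _ : EuclideanSpace ℝ (Fin N) => s3)
          (volume.restrict (annulus N R₀ R₁)) := integrableOn_const hVfin
      rw [integral_add _ (hiw.const_mul _), integral_add _ hconst,
        integral_add (hKi.const_mul κ) (hif.const_mul _), integral_const_mul, integral_const_mul,
        integral_const_mul, setIntegral_const, smul_eq_mul, H1sq]
      · exact (hKi.const_mul κ).add (hif.const_mul _)
      · exact ((hKi.const_mul κ).add (hif.const_mul _)).add (integrableOn_const hVfin)
    rw [hval] at hle
    have hκp : 0 ≤ κ := by positivity
    have e1 : A1 * (κ * (∫ y in annulus N R₀ R₁, ‖x - y‖ ^ (-θ))) ≤ δ / 4 + M / 2 := by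
      calc _ ≤ A1 * (κ * (C₀ + 1)) := by gcongr; linarith
        _ = _ := by rw [hκ, hs1, hs2]; field_simp
    have e2 : A1 * (V * s3) ≤ δ / 4 := by
      calc _ ≤ A1 * ((V + 1) * s3) := by gcongr; linarith
        _ = _ := by rw [hs3]; field_simp
    have e3 : A1 * ((s1 ^ n)⁻¹ * (∫ y in annulus N R₀ R₁, |f y| ^ (2 * N))
        + B ^ 2 / (2 * s3) * H1sq N R₀ R₁ w) ≤ A1 * C2 * J := by
      rw [mul_assoc]
      gcongr
      rw [hC2, hJ]
      have : 0 ≤ (s1 ^ n)⁻¹ * H1sq N R₀ R₁ w := by positivity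
      have : 0 ≤ B ^ 2 / (2 * s3) * ∫ y in annulus N R₀ R₁, |f y| ^ (2 * N) := by positivity
      linarith
    have := mul_le_mul_of_nonneg_left hle hA1p.le
    linarith
  obtain ⟨M₀, hM₀0, hM₀⟩ := exists_fderiv_bound hR₀ hR hw1
  intro x hx
  set S := (fun x => ‖fderiv ℝ w x‖) '' annulus N R₀ R₁ with hS
  have hbdd : BddAbove S := ⟨M₀, by rintro _ ⟨y, hy, rfl⟩; exact hM₀ y hy⟩
  have hle : ∀ y ∈ annulus N R₀ R₁, ‖fderiv ℝ w y‖ ≤ sSup S := fun y hy =>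
    le_csSup hbdd ⟨y, hy, rfl⟩
  have hS0 : 0 ≤ sSup S := (norm_nonneg _).trans (hle x hx)
  have h2 : sSup S ≤ sSup S / 2 + δ / 2 + A1 * C2 * J :=
    csSup_le ⟨_, x, hx, rfl⟩ (by rintro _ ⟨y, hy, rfl⟩; exact key _ hS0 hle y hy)
  have := hle x hx
  linarith

end gradest2

end Part7

section Part8
section polar
open Measure Metric
open scoped ENNReal

lemma lintegral_polar {E : Type*} [NormedAddCommGroup E] [NormedSpace ℝ E] [MeasurableSpace E]
    [FiniteDimensional ℝ E] [BorelSpace E] [Nontrivial E] (μ : Measure E) [μ.IsAddHaarMeasure]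
    {f : E → ℝ≥0∞} (hf : Measurable f) :
    ∫⁻ x, f x ∂μ = ∫⁻ ω : sphere (0 : E) 1, (∫⁻ r in Ioi (0 : ℝ),
      ENNReal.ofReal (r ^ (Module.finrank ℝ E - 1)) * f (r • (ω : E))) ∂μ.toSphere := by
  have h1 : ∫⁻ x, f x ∂μ = ∫⁻ x : ({0}ᶜ : Set E), f x ∂(μ.comap (↑)) := by
    rw [lintegral_subtype_comap (measurableSet_singleton _).compl, restrict_compl_singleton]
  have h2 : ∫⁻ x : ({0}ᶜ : Set E), f x ∂(μ.comap (↑)) =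
      ∫⁻ q, f (((homeomorphUnitSphereProd E).symm q : ({0}ᶜ : Set E)) : E)
        ∂(μ.toSphere.prod (volumeIoiPow (Module.finrank ℝ E - 1))) := by
    rw [← (measurePreserving_homeomorphUnitSphereProd μ).lintegral_comp_emb
      (Homeomorph.measurableEmbedding _)]
    simp
  rw [h1, h2, lintegral_prod _ (by
    apply Measurable.aemeasurable
    exact hf.comp (measurable_subtype_coe.comp (Homeomorph.measurable _)))]
  refine lintegral_congr fun ω => ?_
  have hm : Measurable (fun r : Ioi (0 : ℝ) => ENNReal.ofReal ((r : ℝ) ^ (Module.finrank ℝ E - 1))) := by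
    fun_prop
  have hm2 : Measurable (fun r : Ioi (0 : ℝ) => f ((r : ℝ) • (ω : E))) :=
    hf.comp (by fun_prop)
  simp only [homeomorphUnitSphereProd_symm_apply_coe]
  rw [volumeIoiPow, lintegral_withDensity_eq_lintegral_mul _ hm hm2]
  rw [← lintegral_subtype_comap measurableSet_Ioi]
  rfl

end polar

section cone
open scoped ENNReal
variable {N : ℕ} {R₀ R₁ : ℝ}

/-- monotonicity property of the cone -/
def MonoK (N : ℕ) (R₀ R₁ : ℝ) (F : EuclideanSpace ℝ (Fin N) → ℝ) : Prop :=
  ∀ x ∈ closure (annulus N R₀ R₁), ∀ y ∈ closure (annulus N R₀ R₁), ‖x‖ = ‖y‖ →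
    |lastCoord x| ≤ |lastCoord y| → F y ≤ F x

/-- enn-valued gradient, zero off the annulus -/
noncomputable def gradI (N : ℕ) (R₀ R₁ : ℝ) (F : EuclideanSpace ℝ (Fin N) → ℝ) :
    EuclideanSpace ℝ (Fin N) → ℝ≥0∞ :=
  (annulus N R₀ R₁).indicator (fun x => ‖fderiv ℝ F x‖ₑ)

noncomputable def funI (N : ℕ) (R₀ R₁ : ℝ) (F : EuclideanSpace ℝ (Fin N) → ℝ) :
    EuclideanSpace ℝ (Fin N) → ℝ≥0∞ :=
  (annulus N R₀ R₁).indicator (fun x => ‖F x‖ₑ)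

lemma gradI_meas (F : EuclideanSpace ℝ (Fin N) → ℝ) : Measurable (gradI N R₀ R₁ F) :=
  ((measurable_fderiv ℝ F).enorm).indicator isOpen_annulus.measurableSet

lemma funI_meas (hR₀ : 0 < R₀) (hR : R₀ < R₁)
    {F : EuclideanSpace ℝ (Fin N) → ℝ} (hF : memC10 N R₀ R₁ F) :
    Measurable (funI N R₀ R₁ F) := by
  obtain ⟨M, hM0, hM⟩ := exists_fderiv_bound hR₀ hR hF.1
  have hlip : LipschitzWith ⟨M, hM0⟩ ((annulus N R₀ R₁).indicator F) := by
    apply LipschitzWith.of_dist_le_mul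
    intro x y
    rw [dist_eq_norm, dist_eq_norm]
    exact memC10_abs_sub_le hF hM hM0 x y
  have : funI N R₀ R₁ F = fun x => ‖(annulus N R₀ R₁).indicator F x‖ₑ := by
    ext x; rw [funI]; by_cases h : x ∈ annulus N R₀ R₁ <;> simp [h]
  rw [this]
  exact hlip.continuous.measurable.enorm

lemma line_bound (hR₀ : 0 < R₀) (hR : R₀ < R₁)
    {F : EuclideanSpace ℝ (Fin N) → ℝ} (hF : memC10 N R₀ R₁ F)
    (x e : EuclideanSpace ℝ (Fin N)) (he : ‖e‖ = 1) :
    funI N R₀ R₁ F x ≤ ∫⁻ t in Ioi (0 : ℝ), gradI N R₀ R₁ F (x + t • e) := by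
  by_cases hx : x ∈ annulus N R₀ R₁
  swap
  · simp [funI, hx]
  have hR1 : 0 < R₁ := by linarith
  have hy : x + (2 * R₁) • e ∉ annulus N R₀ R₁ := by
    rintro ⟨-, h⟩
    have h1 : ‖(2 * R₁) • e‖ ≤ ‖x + (2 * R₁) • e‖ + ‖x‖ := by
      simpa using norm_sub_le (x + (2 * R₁) • e) x
    rw [norm_smul, he, Real.norm_of_nonneg (by positivity)] at h1
    linarith [hx.2]
  obtain ⟨s, hs0, hsT, hbd, hall⟩ := first_exit (by positivity) hx hy
  have hcl : ∀ t ∈ Icc (0 : ℝ) s, x + t • e ∈ closure (annulus N R₀ R₁) := by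
    intro t ht
    rcases ht.2.lt_or_eq with h | h
    · exact subset_closure (hall t ht.1 h)
    · rw [h]
      rw [mem_closure_annulus hR₀ hR]
      rcases hbd with h | h <;> rw [h] <;> constructor <;> linarith
  have hcontF : ContinuousOn (fun t : ℝ => F (x + t • e)) (Icc 0 s) :=
    hF.1.continuousOn.comp (by fun_prop) hcl
  have hcontD : ContinuousOn (fun t : ℝ => fderivWithin ℝ F (closure (annulus N R₀ R₁))
      (x + t • e) e) (Icc 0 s) := by
    have := (hF.1.continuousOn_fderivWithin (uniqueDiffOn_cA hR₀ hR) le_rfl).comp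
      (f := fun t : ℝ => x + t • e) (s := Icc 0 s) (by fun_prop) hcl
    exact this.clm_apply continuousOn_const
  have hd : ∀ t ∈ Ioo 0 s, HasDerivAt (fun t : ℝ => F (x + t • e))
      (fderivWithin ℝ F (closure (annulus N R₀ R₁)) (x + t • e) e) t := by
    intro t ht
    have hm := hall t ht.1.le ht.2
    rw [fderivWithin_eq_of_mem hm]
    have h1 : HasDerivAt (fun t : ℝ => x + t • e) e t := by
      simpa using ((hasDerivAt_id t).smul_const e).const_add x
    exact (ContDiffOn.diffAt hF.1 hm).hasFDerivAt.comp_hasDerivAt t h1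
  have hFTC := intervalIntegral.integral_eq_sub_of_hasDerivAt_of_le hs0.le hcontF hd
    (hcontD.intervalIntegrable_of_Icc hs0.le)
  rw [hF.2 _ hbd, zero_smul, add_zero, zero_sub] at hFTC
  have h0 : funI N R₀ R₁ F x = ‖∫ t in (0 : ℝ)..s, fderivWithin ℝ F (closure (annulus N R₀ R₁))
      (x + t • e) e‖ₑ := by
    rw [hFTC, enorm_neg, funI, indicator_of_mem hx]
  rw [h0, intervalIntegral.integral_of_le hs0.le, integral_Ioc_eq_integral_Ioo]
  refine (enorm_integral_le_lintegral_enorm _).trans ?_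
  calc _ ≤ ∫⁻ t in Ioo (0 : ℝ) s, gradI N R₀ R₁ F (x + t • e) := by
        refine setLIntegral_mono' measurableSet_Ioo fun t ht => ?_
        have hm := hall t ht.1.le ht.2
        rw [fderivWithin_eq_of_mem hm, gradI, indicator_of_mem hm]
        have : ‖e‖ₑ = 1 := by rw [← ofReal_norm, he, ENNReal.ofReal_one]
        simpa [this] using (fderiv ℝ F (x + t • e)).le_opENorm e
    _ ≤ _ := lintegral_mono_set Ioo_subset_Ioi_self

end cone

end Part8

section Part9
section trace
open scoped ENNReal

/-- `(z,t) ↦ (z,t)` into `ℝ^{M+1}` -/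
noncomputable def jmap (M : ℕ) (t : ℝ) (z : EuclideanSpace ℝ (Fin M)) : EuclideanSpace ℝ (Fin (M + 1)) :=
  WithLp.toLp 2 ((Fin.last M).insertNth (α := fun _ => ℝ) t z.ofLp)

lemma jmap_last (M : ℕ) (t : ℝ) (z : EuclideanSpace ℝ (Fin M)) : jmap M t z (Fin.last M) = t := by
  simp [jmap]

lemma jmap_castSucc (M : ℕ) (t : ℝ) (z : EuclideanSpace ℝ (Fin M)) (i : Fin M) :
    jmap M t z i.castSucc = z i := by
  have := Fin.insertNth_apply_succAbove (α := fun _ => ℝ) (Fin.last M) t z.ofLp i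
  rw [Fin.succAbove_last] at this
  exact this

lemma lastCoord_succ {M : ℕ} (x : EuclideanSpace ℝ (Fin (M + 1))) :
    lastCoord x = x (Fin.last M) := by
  simp [lastCoord, Fin.last]

lemma jmap_norm (M : ℕ) (z : EuclideanSpace ℝ (Fin M)) : ‖jmap M 0 z‖ = ‖z‖ := by
  rw [EuclideanSpace.norm_eq, EuclideanSpace.norm_eq, Fin.sum_univ_castSucc]
  simp [jmap_last, jmap_castSucc]

lemma jmap_add (M : ℕ) (t : ℝ) (z : EuclideanSpace ℝ (Fin M)) :
    jmap M t z = jmap M 0 z + t • EuclideanSpace.single (Fin.last M) (1 : ℝ) := by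
  ext i
  refine Fin.lastCases ?_ (fun i => ?_) i
  · simp [jmap_last]
  · simp [jmap_castSucc, Fin.castSucc_ne_last]

lemma jmap_cont (M : ℕ) : Continuous (fun q : ℝ × EuclideanSpace ℝ (Fin M) => jmap M q.1 q.2) := by
  apply (PiLp.continuous_toLp 2 _).comp
  refine continuous_pi fun i => ?_
  refine Fin.lastCases ?_ (fun i => ?_) i
  · simpa using continuous_fst
  · have : (fun q : ℝ × EuclideanSpace ℝ (Fin M) => jmap M q.1 q.2 i.castSucc) = fun q => q.2 i := by
      ext q; exact jmap_castSucc _ _ _ _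
    have h2 : Continuous fun q : ℝ × EuclideanSpace ℝ (Fin M) => q.2 i := by fun_prop
    rw [← this] at h2
    exact h2

lemma lintegral_jmap (M : ℕ) {f : EuclideanSpace ℝ (Fin (M + 1)) → ℝ≥0∞} (hf : Measurable f) :
    ∫⁻ x, f x = ∫⁻ z : EuclideanSpace ℝ (Fin M), ∫⁻ t : ℝ, f (jmap M t z) := by
  have h1 : ∫⁻ x, f x = ∫⁻ y : Fin (M + 1) → ℝ, f (WithLp.toLp 2 y) :=
    ((PiLp.volume_preserving_toLp (Fin (M + 1))).lintegral_comp hf).symm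
  have hf' : Measurable fun y : Fin (M + 1) → ℝ => f (WithLp.toLp 2 y) :=
    hf.comp (PiLp.volume_preserving_toLp (Fin (M + 1))).measurable
  have h2 := (volume_preserving_piFinSuccAbove (fun _ : Fin (M + 1) => ℝ) (Fin.last M)).symm.lintegral_comp hf'
  have hf2 : Measurable fun q : ℝ × (Fin M → ℝ) => f (jmap M q.1 (WithLp.toLp 2 q.2)) :=
    hf.comp ((jmap_cont M).measurable.comp
      (measurable_fst.prodMk ((PiLp.volume_preserving_toLp (Fin M)).measurable.comp measurable_snd)))
  have hf3 : Measurable fun q : ℝ × EuclideanSpace ℝ (Fin M) => f (jmap M q.1 q.2) :=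
    hf.comp (jmap_cont M).measurable
  have h3 : ∫⁻ q : ℝ × (Fin M → ℝ), f (jmap M q.1 (WithLp.toLp 2 q.2)) =
      ∫⁻ z : Fin M → ℝ, ∫⁻ t : ℝ, f (jmap M t (WithLp.toLp 2 z)) := by
    rw [Measure.volume_eq_prod, lintegral_prod_symm _ hf2.aemeasurable]
  have hm : Measurable fun z : EuclideanSpace ℝ (Fin M) => ∫⁻ t : ℝ, f (jmap M t z) :=
    hf3.lintegral_prod_left'
  rw [h1, ← h2, ← (PiLp.volume_preserving_toLp (Fin M)).lintegral_comp hm, ← h3]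
  rfl

variable {M : ℕ} {R₀ R₁ : ℝ}

lemma le_inv_mul_of {a b c : ℝ≥0∞} (ha : a ≠ 0) (ha' : a ≠ ⊤) (h : a * b ≤ c) : b ≤ a⁻¹ * c := by
  calc b = a⁻¹ * (a * b) := by rw [← mul_assoc, ENNReal.inv_mul_cancel ha ha', one_mul]
    _ ≤ _ := by gcongr

lemma mono_eq {F : EuclideanSpace ℝ (Fin (M + 1)) → ℝ} (hmono : MonoK (M + 1) R₀ R₁ F)
    {x y : EuclideanSpace ℝ (Fin (M + 1))} (h : ‖x‖ = ‖y‖) (hx : lastCoord x = 0)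
    (hy : lastCoord y = 0) : funI (M + 1) R₀ R₁ F x = funI (M + 1) R₀ R₁ F y := by
  by_cases hxA : x ∈ annulus (M + 1) R₀ R₁
  · have hyA : y ∈ annulus (M + 1) R₀ R₁ := by
      simpa only [annulus, mem_ofPred_eq, h] using hxA
    have : F x = F y := le_antisymm
      (hmono y (subset_closure hyA) x (subset_closure hxA) h.symm (by simp [hx, hy]))
      (hmono x (subset_closure hxA) y (subset_closure hyA) h (by simp [hx, hy]))
    simp [funI, hxA, hyA, this]
  · have hyA : y ∉ annulus (M + 1) R₀ R₁ := by
      simpa only [annulus, mem_ofPred_eq, h] using hxA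
    simp [funI, hxA, hyA]

lemma trace_bound (hM : 1 ≤ M) (hR₀ : 0 < R₀) (hR : R₀ < R₁)
    {F : EuclideanSpace ℝ (Fin (M + 1)) → ℝ} (hF : memC10 (M + 1) R₀ R₁ F) :
    ∫⁻ z : EuclideanSpace ℝ (Fin M), funI (M + 1) R₀ R₁ F (jmap M 0 z) ≤
      ∫⁻ x, gradI (M + 1) R₀ R₁ F x := by
  rw [lintegral_jmap M (gradI_meas F)]
  refine lintegral_mono fun z => ?_
  refine (line_bound hR₀ hR hF (jmap M 0 z) (EuclideanSpace.single (Fin.last M) (1 : ℝ))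
    (by simp)).trans ?_
  simp_rw [← jmap_add]
  exact setLIntegral_le_lintegral _ _

/-- The key two-dimensional type inequality in the cone. -/
lemma cone_embed_aux (hM : 1 ≤ M) (hR₀ : 0 < R₀) (hR : R₀ < R₁) :
    ∃ C : ℝ≥0∞, C ≠ ⊤ ∧ ∀ F : EuclideanSpace ℝ (Fin (M + 1)) → ℝ, memC10 (M + 1) R₀ R₁ F →
      (∀ x ∈ annulus (M + 1) R₀ R₁, 0 ≤ F x) → MonoK (M + 1) R₀ R₁ F →
      ∫⁻ x, (funI (M + 1) R₀ R₁ F x) ^ 2 ≤ C * (∫⁻ x, gradI (M + 1) R₀ R₁ F x) ^ 2 := by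
  have : Nonempty (Fin M) := ⟨⟨0, hM⟩⟩
  have : Nontrivial (EuclideanSpace ℝ (Fin M)) := inferInstance
  have hR1 : 0 < R₁ := hR₀.trans hR
  set σ := (volume : Measure (EuclideanSpace ℝ (Fin M))).toSphere univ with hσ
  have hσ0 : σ ≠ 0 := by
    rw [hσ, Ne, Measure.measure_univ_eq_zero]; exact Measure.toSphere_ne_zero _
  have hσt : σ ≠ ⊤ := measure_ne_top _ _
  refine ⟨ENNReal.ofReal R₁ * σ⁻¹ * (ENNReal.ofReal (R₀ ^ M))⁻¹, ?_, ?_⟩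
  · refine ENNReal.mul_ne_top (ENNReal.mul_ne_top ENNReal.ofReal_ne_top ?_) ?_
    · simpa using hσ0
    · simp; positivity
  intro F hF hpos hmono
  let z₀ : EuclideanSpace ℝ (Fin M) := EuclideanSpace.single ⟨0, hM⟩ 1
  let e₀ : EuclideanSpace ℝ (Fin (M + 1)) := jmap M 0 z₀
  have he₀ : ‖e₀‖ = 1 := by simp [e₀, jmap_norm, z₀]
  have hl₀ : ∀ r : ℝ, lastCoord (r • e₀) = 0 := by
    intro r; rw [lastCoord_succ]; simp [e₀, jmap_last]
  set mm : ℝ → ℝ≥0∞ := fun r => funI (M + 1) R₀ R₁ F (r • e₀) with hmm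
  have hfm := funI_meas hR₀ hR hF
  have hgm := gradI_meas (R₀ := R₀) (R₁ := R₁) F
  have hmmm : Measurable mm := hfm.comp (by fun_prop)
  set G := ∫⁻ x, gradI (M + 1) R₀ R₁ F x with hG
  -- trace
  have t1 : ∫⁻ z : EuclideanSpace ℝ (Fin M), funI (M + 1) R₀ R₁ F (jmap M 0 z) =
      σ * ∫⁻ r in Ioi (0 : ℝ), ENNReal.ofReal (r ^ (M - 1)) * mm r := by
    have e1 : ∀ z : EuclideanSpace ℝ (Fin M), funI (M + 1) R₀ R₁ F (jmap M 0 z) = mm ‖z‖ := by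
      intro z
      refine mono_eq hmono ?_ ?_ (hl₀ _)
      · rw [jmap_norm, norm_smul, he₀]; simp
      · rw [lastCoord_succ, jmap_last]
    simp_rw [e1]
    have e0 := lintegral_polar (E := EuclideanSpace ℝ (Fin M)) volume (hmmm.comp measurable_norm)
    simp only [Function.comp_apply] at e0
    rw [e0]
    have e2 : ∀ ω : Metric.sphere (0 : EuclideanSpace ℝ (Fin M)) 1,
        ∫⁻ r in Ioi (0 : ℝ), ENNReal.ofReal (r ^ (Module.finrank ℝ (EuclideanSpace ℝ (Fin M)) - 1))
          * mm ‖r • (ω : EuclideanSpace ℝ (Fin M))‖ =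
        ∫⁻ r in Ioi (0 : ℝ), ENNReal.ofReal (r ^ (M - 1)) * mm r := by
      intro ω
      refine setLIntegral_congr_fun measurableSet_Ioi fun r hr => ?_
      have hr' : 0 < r := hr
      have : ‖(ω : EuclideanSpace ℝ (Fin M))‖ = 1 := by simpa using ω.2
      simp [norm_smul, this, abs_of_pos hr']
    simp_rw [e2]
    rw [lintegral_const, mul_comm]
  have t2 : ∫⁻ r in Ioi (0 : ℝ), ENNReal.ofReal (r ^ M) * mm r ≤ ENNReal.ofReal R₁ * (σ⁻¹ * G) := by
    have e1 : ∫⁻ r in Ioi (0 : ℝ), ENNReal.ofReal (r ^ M) * mm r ≤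
        ENNReal.ofReal R₁ * ∫⁻ r in Ioi (0 : ℝ), ENNReal.ofReal (r ^ (M - 1)) * mm r := by
      rw [← lintegral_const_mul _ (by fun_prop)]
      refine setLIntegral_mono' measurableSet_Ioi fun r hr => ?_
      have hr' : 0 < r := hr
      by_cases hrA : r • e₀ ∈ annulus (M + 1) R₀ R₁
      · have : r < R₁ := by
          have := hrA.2
          rwa [norm_smul, he₀, mul_one, Real.norm_of_nonneg hr'.le] at this
        rw [← mul_assoc, ← ENNReal.ofReal_mul hR1.le]
        gcongr
        calc r ^ M = r * r ^ (M - 1) := by rw [← pow_succ']; congr 1; omega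
          _ ≤ _ := by gcongr
      · simp [hmm, funI, hrA]
    refine e1.trans ?_
    gcongr
    refine le_inv_mul_of hσ0 hσt ?_ 
    rw [← t1]
    exact trace_bound hM hR₀ hR hF
  -- spherical integral
  let S := Metric.sphere (0 : EuclideanSpace ℝ (Fin (M + 1))) 1
  let g : S → ℝ≥0∞ := fun ω => ∫⁻ t in Ioi (0 : ℝ), gradI (M + 1) R₀ R₁ F (t • (ω : EuclideanSpace ℝ (Fin (M + 1))))
  have hfr : Module.finrank ℝ (EuclideanSpace ℝ (Fin (M + 1))) - 1 = M := by simp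
  have t3 : ∫⁻ ω : S, g ω ∂(volume : Measure (EuclideanSpace ℝ (Fin (M + 1)))).toSphere ≤
      (ENNReal.ofReal (R₀ ^ M))⁻¹ * G := by
    have h0 : ENNReal.ofReal (R₀ ^ M) ≠ 0 := by simp; positivity
    refine le_inv_mul_of h0 ENNReal.ofReal_ne_top ?_
    rw [hG, lintegral_polar volume hgm, hfr, ← lintegral_const_mul' _ _ ENNReal.ofReal_ne_top]
    refine lintegral_mono fun ω => ?_
    simp only [g]
    rw [← lintegral_const_mul' _ _ ENNReal.ofReal_ne_top]
    refine setLIntegral_mono' measurableSet_Ioi fun r hr => ?_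
    have hr' : 0 < r := hr
    by_cases hrA : r • (ω : EuclideanSpace ℝ (Fin (M + 1))) ∈ annulus (M + 1) R₀ R₁
    · have : R₀ < r := by
        have := hrA.1
        have h1 : ‖(ω : EuclideanSpace ℝ (Fin (M + 1)))‖ = 1 := by simpa using ω.2
        rwa [norm_smul, h1, mul_one, Real.norm_of_nonneg hr'.le] at this
      gcongr
    · simp [gradI, hrA]
  have t4 : ∀ (ω : S) (r : ℝ), 0 < r → funI (M + 1) R₀ R₁ F (r • (ω : EuclideanSpace ℝ (Fin (M + 1)))) ≤ g ω := by
    intro ω r hr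
    have h1 : ‖(ω : EuclideanSpace ℝ (Fin (M + 1)))‖ = 1 := by simpa using ω.2
    refine (line_bound hR₀ hR hF _ _ h1).trans ?_
    simp_rw [← add_smul]
    have := lintegral_add_left_eq_self (μ := (volume : Measure ℝ)) ((Ioi r).indicator
      (fun t => gradI (M + 1) R₀ R₁ F (t • (ω : EuclideanSpace ℝ (Fin (M + 1)))))) r
    rw [lintegral_indicator measurableSet_Ioi] at this
    calc _ = ∫⁻ t in Ioi r, gradI (M + 1) R₀ R₁ F (t • (ω : EuclideanSpace ℝ (Fin (M + 1)))) := by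
          rw [← this, ← lintegral_indicator measurableSet_Ioi]
          refine lintegral_congr fun t => ?_
          by_cases ht : 0 < t <;> simp [ht, indicator]
      _ ≤ _ := lintegral_mono_set (Ioi_subset_Ioi hr.le)
  have t5 : ∀ (ω : S) (r : ℝ), 0 < r → funI (M + 1) R₀ R₁ F (r • (ω : EuclideanSpace ℝ (Fin (M + 1)))) ≤ mm r := by
    intro ω r hr
    have h1 : ‖(ω : EuclideanSpace ℝ (Fin (M + 1)))‖ = 1 := by simpa using ω.2
    by_cases hrA : r • (ω : EuclideanSpace ℝ (Fin (M + 1))) ∈ annulus (M + 1) R₀ R₁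
    · have hn : ‖r • (ω : EuclideanSpace ℝ (Fin (M + 1)))‖ = ‖r • e₀‖ := by
        rw [norm_smul, norm_smul, h1, he₀]
      have hrB : r • e₀ ∈ annulus (M + 1) R₀ R₁ := by
        simpa only [annulus, mem_ofPred_eq, hn] using hrA
      have h2 := hmono _ (subset_closure hrB) _ (subset_closure hrA) hn.symm (by simp [hl₀])
      simp only [hmm, funI, indicator_of_mem hrA, indicator_of_mem hrB]
      rw [Real.enorm_of_nonneg (hpos _ hrA), Real.enorm_of_nonneg (hpos _ hrB)]
      exact ENNReal.ofReal_le_ofReal h2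
    · simp [funI, hrA]
  rw [lintegral_polar volume (hfm.pow_const 2), hfr]
  calc _ ≤ ∫⁻ ω : S, (∫⁻ r in Ioi (0 : ℝ), ENNReal.ofReal (r ^ M) * mm r) * g ω
          ∂(volume : Measure (EuclideanSpace ℝ (Fin (M + 1)))).toSphere := by
        refine lintegral_mono fun ω => ?_
        simp only
        rw [← lintegral_mul_const _ (by fun_prop)]
        refine setLIntegral_mono' measurableSet_Ioi fun r hr => ?_
        rw [sq, mul_assoc]
        gcongr
        · exact t5 ω r hr
        · exact t4 ω r hr
    _ = (∫⁻ r in Ioi (0 : ℝ), ENNReal.ofReal (r ^ M) * mm r) * ∫⁻ ω : S, g ω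
          ∂(volume : Measure (EuclideanSpace ℝ (Fin (M + 1)))).toSphere := by
        refine lintegral_const_mul _ ?_
        refine Measurable.lintegral_prod_right' (f := fun q : S × ℝ => gradI (M + 1) R₀ R₁ F
          (q.2 • (q.1 : EuclideanSpace ℝ (Fin (M + 1))))) ?_
        exact hgm.comp (by fun_prop)
    _ ≤ (ENNReal.ofReal R₁ * (σ⁻¹ * G)) * ((ENNReal.ofReal (R₀ ^ M))⁻¹ * G) := by gcongr
    _ = _ := by ring

end trace

end Part9

section Part10
section powb
open scoped ENNReal
variable {N : ℕ} {R₀ R₁ : ℝ}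

lemma dcont (hR₀ : 0 < R₀) (hR : R₀ < R₁) {F : EuclideanSpace ℝ (Fin N) → ℝ}
    (hF : ContDiffOn ℝ 1 F (closure (annulus N R₀ R₁))) :
    ContinuousOn (fderivWithin ℝ F (closure (annulus N R₀ R₁))) (closure (annulus N R₀ R₁)) :=
  hF.continuousOn_fderivWithin (uniqueDiffOn_cA hR₀ hR) le_rfl

lemma cone_embed (hN : 2 ≤ N) (hR₀ : 0 < R₀) (hR : R₀ < R₁) :
    ∃ C : ℝ, 0 ≤ C ∧ ∀ F : EuclideanSpace ℝ (Fin N) → ℝ, memC10 N R₀ R₁ F →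
      (∀ x ∈ annulus N R₀ R₁, 0 ≤ F x) → MonoK N R₀ R₁ F →
      ∫ x in annulus N R₀ R₁, (F x) ^ 2 ≤
        C * (∫ x in annulus N R₀ R₁, ‖fderivWithin ℝ F (closure (annulus N R₀ R₁)) x‖) ^ 2 := by
  obtain ⟨M, rfl⟩ : ∃ M, N = M + 1 := ⟨N - 1, by omega⟩
  obtain ⟨C, hC, h⟩ := cone_embed_aux (M := M) (by omega) hR₀ hR
  refine ⟨C.toReal, ENNReal.toReal_nonneg, fun F hF hpos hmono => ?_⟩
  have h1 := h F hF hpos hmono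
  have hms : MeasurableSet (annulus (M + 1) R₀ R₁) := isOpen_annulus.measurableSet
  have hi2 : IntegrableOn (fun x => (F x) ^ 2) (annulus (M + 1) R₀ R₁) :=
    integrableOn_of_cont (hF.1.continuousOn.pow 2)
  have hid : IntegrableOn (fun x => ‖fderivWithin ℝ F (closure (annulus (M + 1) R₀ R₁)) x‖)
      (annulus (M + 1) R₀ R₁) := integrableOn_of_cont (dcont hR₀ hR hF.1).norm
  have e1 : ∫⁻ x, (funI (M + 1) R₀ R₁ F x) ^ 2 =
      ENNReal.ofReal (∫ x in annulus (M + 1) R₀ R₁, (F x) ^ 2) := by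
    rw [ofReal_integral_eq_lintegral_ofReal hi2 (Filter.Eventually.of_forall fun x => sq_nonneg _),
      ← lintegral_indicator hms]
    refine lintegral_congr fun x => ?_
    by_cases hx : x ∈ annulus (M + 1) R₀ R₁
    · simp only [funI, indicator_of_mem hx]
      rw [Real.enorm_of_nonneg (hpos x hx), ENNReal.ofReal_pow (hpos x hx)]
    · simp [funI, hx]
  have e2 : ∫⁻ x, gradI (M + 1) R₀ R₁ F x = ENNReal.ofReal
      (∫ x in annulus (M + 1) R₀ R₁, ‖fderivWithin ℝ F (closure (annulus (M + 1) R₀ R₁)) x‖) := by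
    rw [ofReal_integral_eq_lintegral_ofReal hid (Filter.Eventually.of_forall fun x => norm_nonneg _),
      ← lintegral_indicator hms]
    refine lintegral_congr fun x => ?_
    by_cases hx : x ∈ annulus (M + 1) R₀ R₁
    · simp only [gradI, indicator_of_mem hx]
      rw [fderivWithin_eq_of_mem hx, ofReal_norm]
    · simp [gradI, hx]
  have hn : 0 ≤ ∫ x in annulus (M + 1) R₀ R₁,
      ‖fderivWithin ℝ F (closure (annulus (M + 1) R₀ R₁)) x‖ :=
    integral_nonneg fun _ => norm_nonneg _
  rw [e1, e2, ← ENNReal.ofReal_pow hn, ← ENNReal.ofReal_toReal hC,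
    ← ENNReal.ofReal_mul ENNReal.toReal_nonneg] at h1
  exact (ENNReal.ofReal_le_ofReal_iff (by positivity)).1 h1

lemma abs_lastCoord_le (x : EuclideanSpace ℝ (Fin N)) : |lastCoord x| ≤ ‖x‖ := by
  unfold lastCoord
  split_ifs with h
  · simpa using PiLp.norm_apply_le x ⟨N - 1, by omega⟩
  · simp

lemma memKhat_mono (hR₀ : 0 < R₀) {F : EuclideanSpace ℝ (Fin N) → ℝ} (hF : memKhat N R₀ R₁ F) :
    MonoK N R₀ R₁ F := by
  obtain ⟨-, -, f, hf, heven, hanti⟩ := hF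
  intro x hx y hy hxy hl
  have hb := closure_annulus_subset hx
  have hx0 : 0 < ‖x‖ := hR₀.trans_le hb.1
  have hr : ‖x‖ ∈ Icc R₀ R₁ := hb
  have key : ∀ z : EuclideanSpace ℝ (Fin N), z ∈ closure (annulus N R₀ R₁) →
      F z = f ‖z‖ (Real.arcsin (|lastCoord z| / ‖z‖)) := by
    intro z hz
    rw [hf z hz, angleOf]
    rcases le_total 0 (lastCoord z) with h | h
    · rw [abs_of_nonneg h]
    · rw [abs_of_nonpos h, neg_div, Real.arcsin_neg]
      exact (heven _ (closure_annulus_subset hz) _ (Real.arcsin_mem_Icc _)).symm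
  rw [key x hx, key y hy, ← hxy]
  refine hanti _ hr ⟨Real.arcsin_nonneg.2 (by positivity), Real.arcsin_le_pi_div_two _⟩
    ⟨Real.arcsin_nonneg.2 (by positivity), Real.arcsin_le_pi_div_two _⟩ ?_
  exact Real.monotone_arcsin (by gcongr)

lemma memK_memC10 {F : EuclideanSpace ℝ (Fin N) → ℝ} (hF : memK N R₀ R₁ F) :
    memC10 N R₀ R₁ F := ⟨hF.1.1, hF.2⟩

lemma H1_cont (hR₀ : 0 < R₀) (hR : R₀ < R₁) {F : EuclideanSpace ℝ (Fin N) → ℝ}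
    (hF : ContDiffOn ℝ 1 F (closure (annulus N R₀ R₁))) :
    IntegrableOn (fun x => ‖fderivWithin ℝ F (closure (annulus N R₀ R₁)) x‖ ^ 2 + (F x) ^ 2)
      (annulus N R₀ R₁) :=
  integrableOn_of_cont (((dcont hR₀ hR hF).norm.pow 2).add (hF.continuousOn.pow 2))

lemma pow_bound (hN : 2 ≤ N) (hR₀ : 0 < R₀) (hR : R₀ < R₁) (B : ℝ) (m : ℕ) :
    ∃ C : ℝ, ∀ u : EuclideanSpace ℝ (Fin N) → ℝ, memK N R₀ R₁ u → H1sq N R₀ R₁ u ≤ B →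
      ∫ x in annulus N R₀ R₁, (u x) ^ (2 * m) ≤ C := by
  obtain ⟨C₀, hC₀, hce⟩ := cone_embed hN hR₀ hR
  have hms : MeasurableSet (annulus N R₀ R₁) := isOpen_annulus.measurableSet
  induction m with
  | zero => exact ⟨volume.real (annulus N R₀ R₁), fun u _ _ => by simp [measureReal_def]⟩
  | succ m ih =>
    obtain ⟨C, hC⟩ := ih
    refine ⟨C₀ * ((m + 1) * ((C + B) / 2)) ^ 2, fun u hu hB => ?_⟩
    have hu1 := hu.1.1
    have hnn := hu.1.2.1
    have hF : memC10 N R₀ R₁ (fun x => u x ^ (m + 1)) :=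
      ⟨hu1.pow _, fun x hx => by simp [hu.2 x hx]⟩
    have hmono : MonoK N R₀ R₁ (fun x => u x ^ (m + 1)) := by
      intro x hx y hy h1 h2
      exact pow_le_pow_left₀ (hnn y hy) (memKhat_mono hR₀ hu.1 x hx y hy h1 h2) _
    have h1 := hce _ hF (fun x hx => pow_nonneg (hnn x (subset_closure hx)) _) hmono
    have e1 : ∀ x, (u x ^ (m + 1)) ^ 2 = u x ^ (2 * (m + 1)) := fun x => by
      rw [← pow_mul]; congr 1; ring
    simp_rw [e1] at h1
    refine h1.trans ?_
    have hInteg : IntegrableOn (fun x => (m + 1 : ℝ) * ((u x ^ (2 * m) +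
        (‖fderivWithin ℝ u (closure (annulus N R₀ R₁)) x‖ ^ 2 + (u x) ^ 2)) / 2))
        (annulus N R₀ R₁) := by
      apply Integrable.const_mul
      apply Integrable.div_const
      exact (integrableOn_of_cont (hu1.continuousOn.pow _)).add (H1_cont hR₀ hR hu1)
    have e2 : ∫ x in annulus N R₀ R₁,
        ‖fderivWithin ℝ (fun x => u x ^ (m + 1)) (closure (annulus N R₀ R₁)) x‖ ≤
        (m + 1) * ((C + B) / 2) := by
      calc _ ≤ ∫ x in annulus N R₀ R₁, (m + 1 : ℝ) * ((u x ^ (2 * m) +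
            (‖fderivWithin ℝ u (closure (annulus N R₀ R₁)) x‖ ^ 2 + (u x) ^ 2)) / 2) := by
            refine integral_mono_of_nonneg (Filter.Eventually.of_forall fun y => norm_nonneg _)
              hInteg ?_
            filter_upwards [ae_restrict_mem hms] with x hx
            have hd := (ContDiffOn.diffAt hu1 hx).hasFDerivAt.pow (m + 1)
            have : fderiv ℝ (fun x => u x ^ (m + 1)) x = ((m + 1 : ℝ) * u x ^ m) • fderiv ℝ u x := by
              rw [hd.fderiv]; simp
            rw [fderivWithin_eq_of_mem hx, fderivWithin_eq_of_mem hx, this, norm_smul, norm_mul]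
            have h0 := hnn x (subset_closure hx)
            rw [Real.norm_of_nonneg (by positivity), Real.norm_of_nonneg (by positivity), mul_assoc]
            gcongr
            have : u x ^ (2 * m) = (u x ^ m) ^ 2 := by rw [← pow_mul]; congr 1; ring
            rw [this]
            nlinarith [sq_nonneg (u x ^ m - ‖fderiv ℝ u x‖), sq_nonneg (u x)]
        _ = (m + 1) * (((∫ x in annulus N R₀ R₁, u x ^ (2 * m)) + H1sq N R₀ R₁ u) / 2) := by
            have hp : Integrable (fun x => u x ^ (2 * m)) (volume.restrict (annulus N R₀ R₁)) :=
              integrableOn_of_cont (hu1.continuousOn.pow _)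
            rw [integral_const_mul, integral_div, integral_add hp (H1_cont hR₀ hR hu1), H1sq]
        _ ≤ _ := by gcongr; exact hC u hu hB
    gcongr

lemma rpow_bound (hN : 2 ≤ N) (hR₀ : 0 < R₀) (hR : R₀ < R₁) (B : ℝ) {q : ℝ} (hq : 0 ≤ q) :
    ∃ C : ℝ, ∀ u : EuclideanSpace ℝ (Fin N) → ℝ, memK N R₀ R₁ u → H1sq N R₀ R₁ u ≤ B →
      ∫ x in annulus N R₀ R₁, (u x) ^ q ≤ C := by
  obtain ⟨m, hm⟩ := exists_nat_ge q
  obtain ⟨C, hC⟩ := pow_bound hN hR₀ hR B m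
  refine ⟨volume.real (annulus N R₀ R₁) + C, fun u hu hB => ?_⟩
  have hms : MeasurableSet (annulus N R₀ R₁) := isOpen_annulus.measurableSet
  have hc : IntegrableOn (fun _ : EuclideanSpace ℝ (Fin N) => (1 : ℝ)) (annulus N R₀ R₁) :=
    integrableOn_of_cont continuousOn_const
  have hi : IntegrableOn (fun x => u x ^ (2 * m)) (annulus N R₀ R₁) :=
    integrableOn_of_cont (hu.1.1.continuousOn.pow _)
  calc _ ≤ ∫ x in annulus N R₀ R₁, (1 + u x ^ (2 * m)) := by
        refine integral_mono_of_nonneg ?_ (hc.add hi) ?_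
        · filter_upwards [ae_restrict_mem hms] with x hx
          exact Real.rpow_nonneg (hu.1.2.1 x (subset_closure hx)) _
        · filter_upwards [ae_restrict_mem hms] with x hx
          have h0 := hu.1.2.1 x (subset_closure hx)
          rcases le_total (u x) 1 with h | h
          · have := Real.rpow_le_one h0 h hq
            have : 0 ≤ u x ^ (2 * m) := by positivity
            linarith
          · have h3 : u x ^ q ≤ u x ^ ((2 * m : ℕ) : ℝ) := by
              apply Real.rpow_le_rpow_of_exponent_le h
              push_cast
              have : (0 : ℝ) ≤ m := by positivity
              linarith
            rw [Real.rpow_natCast] at h3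
            linarith
    _ = volume.real (annulus N R₀ R₁) + ∫ x in annulus N R₀ R₁, u x ^ (2 * m) := by
        rw [integral_add hc hi]; simp [measureReal_def]
    _ ≤ _ := by gcongr; exact hC u hu hB

end powb

end Part10

section Part11
section bilf
variable {N : ℕ} {R₀ R₁ : ℝ}

lemma clm_norm_sq (L : EuclideanSpace ℝ (Fin N) →L[ℝ] ℝ) :
    ‖L‖ ^ 2 = ∑ i, (L (EuclideanSpace.single i 1)) ^ 2 := by
  obtain ⟨g, rfl⟩ := (InnerProductSpace.toDual ℝ (EuclideanSpace ℝ (Fin N))).surjective L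
  rw [LinearIsometryEquiv.norm_map, EuclideanSpace.norm_sq_eq]
  refine Finset.sum_congr rfl fun i _ => ?_
  rw [InnerProductSpace.toDual_apply_apply, EuclideanSpace.inner_single_right]
  simp

lemma clm_grad (L : EuclideanSpace ℝ (Fin N) →L[ℝ] ℝ) {φ : EuclideanSpace ℝ (Fin N) → ℝ}
    {x : EuclideanSpace ℝ (Fin N)} :
    L (gradient φ x) = ∑ i, L (EuclideanSpace.single i 1) * fderiv ℝ φ x (EuclideanSpace.single i 1) := by
  have h : gradient φ x = ∑ i, (fderiv ℝ φ x (EuclideanSpace.single i 1)) •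
      EuclideanSpace.single i (1 : ℝ) := by
    have h1 : ∀ i, gradient φ x i = fderiv ℝ φ x (EuclideanSpace.single i 1) := by
      intro i
      have h2 : (InnerProductSpace.toDual ℝ (EuclideanSpace ℝ (Fin N))) (gradient φ x) = fderiv ℝ φ x := by
        simp [gradient]
      rw [← h2, InnerProductSpace.toDual_apply_apply, EuclideanSpace.inner_single_right]
      simp
    ext j
    rw [h1]
    simp [Finset.sum_apply, Pi.single_apply]
  rw [h, map_sum]
  refine Finset.sum_congr rfl fun i _ => ?_
  rw [map_smul, smul_eq_mul, mul_comm]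

/-- pointwise bilinear integrand -/
noncomputable def blp (N : ℕ) (R₀ R₁ : ℝ) (F G : EuclideanSpace ℝ (Fin N) → ℝ)
    (x : EuclideanSpace ℝ (Fin N)) : ℝ :=
  (∑ i, pdv N R₀ R₁ i F x * pdv N R₀ R₁ i G x) + F x * G x

noncomputable def bil (N : ℕ) (R₀ R₁ : ℝ) (F G : EuclideanSpace ℝ (Fin N) → ℝ) : ℝ :=
  ∫ x in annulus N R₀ R₁, blp N R₀ R₁ F G x

lemma blp_self (F : EuclideanSpace ℝ (Fin N) → ℝ) (x : EuclideanSpace ℝ (Fin N)) :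
    blp N R₀ R₁ F F x = ‖fderivWithin ℝ F (closure (annulus N R₀ R₁)) x‖ ^ 2 + (F x) ^ 2 := by
  rw [clm_norm_sq, blp, sq (F x)]
  congr 1
  exact Finset.sum_congr rfl fun i _ => (sq _).symm

lemma bil_self (F : EuclideanSpace ℝ (Fin N) → ℝ) : bil N R₀ R₁ F F = H1sq N R₀ R₁ F := by
  simp only [bil, blp_self, H1sq]

lemma H1sq_nonneg (F : EuclideanSpace ℝ (Fin N) → ℝ) : 0 ≤ H1sq N R₀ R₁ F :=
  integral_nonneg fun x => by positivity

lemma blp_int (hR₀ : 0 < R₀) (hR : R₀ < R₁) {F G : EuclideanSpace ℝ (Fin N) → ℝ}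
    (hF : ContDiffOn ℝ 1 F (closure (annulus N R₀ R₁)))
    (hG : ContDiffOn ℝ 1 G (closure (annulus N R₀ R₁))) :
    Integrable (blp N R₀ R₁ F G) (volume.restrict (annulus N R₀ R₁)) := by
  refine integrableOn_of_cont (ContinuousOn.add (continuousOn_finset_sum _ fun i _ => ?_)
    (hF.continuousOn.mul hG.continuousOn))
  exact (pdv_continuousOn hR₀ hR i hF).mul (pdv_continuousOn hR₀ hR i hG)

lemma pdv_sub (hR₀ : 0 < R₀) (hR : R₀ < R₁) {F G : EuclideanSpace ℝ (Fin N) → ℝ}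
    (hF : ContDiffOn ℝ 1 F (closure (annulus N R₀ R₁)))
    (hG : ContDiffOn ℝ 1 G (closure (annulus N R₀ R₁))) (i : Fin N)
    {x : EuclideanSpace ℝ (Fin N)} (hx : x ∈ annulus N R₀ R₁) :
    pdv N R₀ R₁ i (fun x => F x - G x) x = pdv N R₀ R₁ i F x - pdv N R₀ R₁ i G x := by
  rw [pdv_eq hx, pdv_eq hx, pdv_eq hx, fderiv_fun_sub (ContDiffOn.diffAt hF hx) (ContDiffOn.diffAt hG hx)]
  rfl

lemma bil_sub_left (hR₀ : 0 < R₀) (hR : R₀ < R₁) {F F' G : EuclideanSpace ℝ (Fin N) → ℝ}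
    (hF : ContDiffOn ℝ 1 F (closure (annulus N R₀ R₁)))
    (hF' : ContDiffOn ℝ 1 F' (closure (annulus N R₀ R₁)))
    (hG : ContDiffOn ℝ 1 G (closure (annulus N R₀ R₁))) :
    bil N R₀ R₁ (fun x => F x - F' x) G = bil N R₀ R₁ F G - bil N R₀ R₁ F' G := by
  rw [bil, bil, bil, ← integral_sub (blp_int hR₀ hR hF hG) (blp_int hR₀ hR hF' hG)]
  refine setIntegral_congr_fun isOpen_annulus.measurableSet fun x hx => ?_
  simp only [blp, pdv_sub hR₀ hR hF hF' _ hx, sub_mul, Finset.sum_sub_distrib]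
  ring

lemma bil_comm (F G : EuclideanSpace ℝ (Fin N) → ℝ) : bil N R₀ R₁ F G = bil N R₀ R₁ G F := by
  simp only [bil, blp, mul_comm]

lemma bil_le (hR₀ : 0 < R₀) (hR : R₀ < R₁) {F G : EuclideanSpace ℝ (Fin N) → ℝ}
    (hF : ContDiffOn ℝ 1 F (closure (annulus N R₀ R₁)))
    (hG : ContDiffOn ℝ 1 G (closure (annulus N R₀ R₁))) {ε : ℝ} (hε : 0 < ε) :
    |bil N R₀ R₁ F G| ≤ ε * H1sq N R₀ R₁ F + 1 / (4 * ε) * H1sq N R₀ R₁ G := by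
  have hy : ∀ s t : ℝ, |s * t| ≤ ε * (s * s) + 1 / (4 * ε) * (t * t) := by
    intro s t
    have h1 : ε * (s * s) + 1 / (4 * ε) * (t * t) - s * t = (2 * ε * s - t) ^ 2 / (4 * ε) := by
      field_simp; ring
    have h2 : ε * (s * s) + 1 / (4 * ε) * (t * t) + s * t = (2 * ε * s + t) ^ 2 / (4 * ε) := by
      field_simp; ring
    have h3 : 0 ≤ (2 * ε * s - t) ^ 2 / (4 * ε) := by positivity
    have h4 : 0 ≤ (2 * ε * s + t) ^ 2 / (4 * ε) := by positivity
    rw [abs_le]; constructor <;> linarith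
  rw [← bil_self, ← bil_self, bil, bil, bil, ← integral_const_mul, ← integral_const_mul,
    ← integral_add ((blp_int hR₀ hR hF hF).const_mul _) ((blp_int hR₀ hR hG hG).const_mul _)]
  refine (abs_integral_le_integral_abs).trans ?_
  refine integral_mono_of_nonneg (Filter.Eventually.of_forall fun _ => abs_nonneg _)
    (((blp_int hR₀ hR hF hF).const_mul _).add ((blp_int hR₀ hR hG hG).const_mul _))
    (Filter.Eventually.of_forall fun x => ?_)
  simp only [blp]
  calc _ ≤ (∑ i, |pdv N R₀ R₁ i F x * pdv N R₀ R₁ i G x|) + |F x * G x| :=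
        (abs_add_le _ _).trans (add_le_add_left (Finset.abs_sum_le_sum_abs _ _) _)
    _ ≤ (∑ i, (ε * (pdv N R₀ R₁ i F x * pdv N R₀ R₁ i F x) + 1 / (4 * ε) *
          (pdv N R₀ R₁ i G x * pdv N R₀ R₁ i G x))) +
          (ε * (F x * F x) + 1 / (4 * ε) * (G x * G x)) := by
        gcongr
        · exact hy _ _
        · exact hy _ _
    _ = _ := by rw [Finset.sum_add_distrib, ← Finset.mul_sum, ← Finset.mul_sum]; ring

lemma H1sq_sub (hR₀ : 0 < R₀) (hR : R₀ < R₁) {F G : EuclideanSpace ℝ (Fin N) → ℝ}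
    (hF : ContDiffOn ℝ 1 F (closure (annulus N R₀ R₁)))
    (hG : ContDiffOn ℝ 1 G (closure (annulus N R₀ R₁))) :
    H1sq N R₀ R₁ (fun x => F x - G x) =
      H1sq N R₀ R₁ F - 2 * bil N R₀ R₁ F G + H1sq N R₀ R₁ G := by
  rw [← bil_self, bil_sub_left hR₀ hR hF hG (hF.sub hG), bil_comm F, bil_comm G,
    bil_sub_left hR₀ hR hF hG hF, bil_sub_left hR₀ hR hF hG hG, bil_self, bil_self, bil_comm G F]
  ring

lemma H1sq_sub_le (hR₀ : 0 < R₀) (hR : R₀ < R₁) {F G : EuclideanSpace ℝ (Fin N) → ℝ}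
    (hF : ContDiffOn ℝ 1 F (closure (annulus N R₀ R₁)))
    (hG : ContDiffOn ℝ 1 G (closure (annulus N R₀ R₁))) :
    H1sq N R₀ R₁ (fun x => F x - G x) ≤ 2 * H1sq N R₀ R₁ F + 2 * H1sq N R₀ R₁ G := by
  rw [H1sq_sub hR₀ hR hF hG]
  have := bil_le hR₀ hR hF hG (ε := 1 / 2) (by norm_num)
  have := abs_le.1 this
  norm_num at this
  linarith [this.1]

lemma H1sq_symm (hR₀ : 0 < R₀) (hR : R₀ < R₁) {F G : EuclideanSpace ℝ (Fin N) → ℝ}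
    (hF : ContDiffOn ℝ 1 F (closure (annulus N R₀ R₁)))
    (hG : ContDiffOn ℝ 1 G (closure (annulus N R₀ R₁))) :
    H1sq N R₀ R₁ (fun x => F x - G x) = H1sq N R₀ R₁ (fun x => G x - F x) := by
  rw [H1sq_sub hR₀ hR hF hG, H1sq_sub hR₀ hR hG hF, bil_comm F G]; ring

lemma H1sq_tri (hR₀ : 0 < R₀) (hR : R₀ < R₁) {F G E : EuclideanSpace ℝ (Fin N) → ℝ}
    (hF : ContDiffOn ℝ 1 F (closure (annulus N R₀ R₁)))
    (hG : ContDiffOn ℝ 1 G (closure (annulus N R₀ R₁)))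
    (hE : ContDiffOn ℝ 1 E (closure (annulus N R₀ R₁))) :
    H1sq N R₀ R₁ (fun x => F x - G x) ≤ 2 * H1sq N R₀ R₁ (fun x => F x - E x)
      + 2 * H1sq N R₀ R₁ (fun x => E x - G x) := by
  have h := H1sq_sub_le hR₀ hR (hF.sub hE) (hG.sub hE)
  simp only [sub_sub_sub_cancel_right] at h
  rw [H1sq_symm hR₀ hR hE hG]
  exact h

lemma bil_weak (hN : 0 < N) (hR₀ : 0 < R₀) (hR : R₀ < R₁)
    {v g f : EuclideanSpace ℝ (Fin N) → ℝ} (hv : ContDiffOn ℝ 2 v (closure (annulus N R₀ R₁)))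
    (hg : memC10 N R₀ R₁ g) (hf : ∀ x ∈ annulus N R₀ R₁, lapl v x = v x - f x)
    (hfc : ContinuousOn f (closure (annulus N R₀ R₁))) :
    bil N R₀ R₁ v g = ∫ x in annulus N R₀ R₁, f x * g x := by
  have hv1 : ContDiffOn ℝ 1 v (closure (annulus N R₀ R₁)) := hv.of_le (by norm_num)
  have i1 : Integrable (fun x => ∑ i, pdv N R₀ R₁ i v x * pdv N R₀ R₁ i g x)
      (volume.restrict (annulus N R₀ R₁)) :=
    integrableOn_of_cont (continuousOn_finset_sum _ fun i _ =>
      (pdv_continuousOn hR₀ hR i hv1).mul (pdv_continuousOn hR₀ hR i hg.1))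
  have i2 : Integrable (fun x => v x * g x) (volume.restrict (annulus N R₀ R₁)) :=
    integrableOn_of_cont (hv.continuousOn.mul hg.1.continuousOn)
  have i3 : Integrable (fun x => f x * g x) (volume.restrict (annulus N R₀ R₁)) :=
    integrableOn_of_cont (hfc.mul hg.1.continuousOn)
  have e : ∫ x in annulus N R₀ R₁, lapl v x * g x =
      (∫ x in annulus N R₀ R₁, v x * g x) - ∫ x in annulus N R₀ R₁, f x * g x := by
    rw [← integral_sub i2 i3]
    refine setIntegral_congr_fun isOpen_annulus.measurableSet fun x hx => ?_
    simp only [hf x hx]; ring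
  simp only [bil, blp]
  rw [integral_add i1 i2, green_first hN hR₀ hR hv hg, e]
  ring

lemma sq_le_H1sq (hR₀ : 0 < R₀) (hR : R₀ < R₁) {F : EuclideanSpace ℝ (Fin N) → ℝ}
    (hF : ContDiffOn ℝ 1 F (closure (annulus N R₀ R₁))) :
    ∫ x in annulus N R₀ R₁, (F x) ^ 2 ≤ H1sq N R₀ R₁ F := by
  refine integral_mono_of_nonneg (Filter.Eventually.of_forall fun _ => sq_nonneg _)
    (H1_cont hR₀ hR hF) (Filter.Eventually.of_forall fun x => ?_)
  simp only
  have : 0 ≤ ‖fderivWithin ℝ F (closure (annulus N R₀ R₁)) x‖ ^ 2 := by positivity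
  linarith

lemma lapl_sub' (hR₀ : 0 < R₀) (hR : R₀ < R₁) {F G : EuclideanSpace ℝ (Fin N) → ℝ}
    (hF : ContDiffOn ℝ 2 F (closure (annulus N R₀ R₁)))
    (hG : ContDiffOn ℝ 2 G (closure (annulus N R₀ R₁)))
    {x : EuclideanSpace ℝ (Fin N)} (hx : x ∈ annulus N R₀ R₁) :
    lapl (fun x => F x - G x) x = lapl F x - lapl G x := by
  have hF1 : ContDiffOn ℝ 1 F (closure (annulus N R₀ R₁)) := hF.of_le (by norm_num)
  have hG1 : ContDiffOn ℝ 1 G (closure (annulus N R₀ R₁)) := hG.of_le (by norm_num)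
  rw [lapl_eq_pdv hx, lapl_eq_pdv hx, lapl_eq_pdv hx, ← Finset.sum_sub_distrib]
  refine Finset.sum_congr rfl fun i _ => ?_
  have : pdv N R₀ R₁ i (fun x => F x - G x) =ᶠ[nhds x]
      fun y => pdv N R₀ R₁ i F y - pdv N R₀ R₁ i G y := by
    filter_upwards [isOpen_annulus.mem_nhds hx] with y hy
    exact pdv_sub hR₀ hR hF1 hG1 i hy
  rw [this.fderiv_eq, fderiv_fun_sub (ContDiffOn.diffAt (pdv_contDiffOn hR₀ hR i hF) hx)
    (ContDiffOn.diffAt (pdv_contDiffOn hR₀ hR i hG) hx)]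
  rfl

end bilf

end Part11

section Part12
section bdd
variable {N : ℕ} {R₀ R₁ : ℝ}

lemma rpow_sub_le_aux {U W b : ℝ} (hW : 0 ≤ W) (hWU : W ≤ U) (hb : 1 ≤ b) :
    U ^ b - W ^ b ≤ b * U ^ (b - 1) * (U - W) := by
  rcases (hW.trans hWU).eq_or_lt with h | hU
  · have : W = 0 := le_antisymm (by rw [h]; exact hWU) hW
    rw [← h, this]; simp
  have hs := one_add_mul_self_le_rpow_one_add (s := (W - U) / U) (p := b)
    (by rw [le_div_iff₀ hU]; linarith) hb
  have e1 : 1 + (W - U) / U = W / U := by field_simp; ring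
  rw [e1, Real.div_rpow hW hU.le, le_div_iff₀ (by positivity)] at hs
  have e2 : U ^ b = U ^ (b - 1) * U := by
    rw [← Real.rpow_add_one hU.ne']; congr 1; ring
  have e3 : (1 + b * ((W - U) / U)) * U ^ b = U ^ b + b * U ^ (b - 1) * (W - U) := by
    rw [add_mul, one_mul, mul_assoc, mul_assoc, e2]; field_simp
  rw [e3] at hs
  linarith

lemma rpow_sub_le {U W b : ℝ} (hU : 0 ≤ U) (hW : 0 ≤ W) (hb : 1 ≤ b) :
    |U ^ b - W ^ b| ≤ b * (U + W) ^ (b - 1) * |U - W| := by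
  have key : ∀ U W : ℝ, 0 ≤ U → 0 ≤ W → W ≤ U →
      |U ^ b - W ^ b| ≤ b * (U + W) ^ (b - 1) * |U - W| := by
    intro U W hU hW h
    have h1 := rpow_sub_le_aux hW h hb
    have h2 : W ^ b ≤ U ^ b := Real.rpow_le_rpow hW h (by linarith)
    rw [abs_of_nonneg (by linarith), abs_of_nonneg (by linarith)]
    refine h1.trans ?_
    have h3 : U ^ (b - 1) ≤ (U + W) ^ (b - 1) := Real.rpow_le_rpow hU (by linarith) (by linarith)
    have : 0 ≤ U - W := by linarith
    gcongr
  rcases le_total W U with h | h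
  · exact key U W hU hW h
  · rw [abs_sub_comm, abs_sub_comm U W, add_comm]; exact key W U hW hU h

lemma add_rpow_le {U W q : ℝ} (hU : 0 ≤ U) (hW : 0 ≤ W) (hq : 0 ≤ q) :
    (U + W) ^ q ≤ 2 ^ q * (U ^ q + W ^ q) := by
  have h1 : (U + W) ^ q ≤ (2 * max U W) ^ q :=
    Real.rpow_le_rpow (by positivity) (by linarith [le_max_left U W, le_max_right U W]) hq
  rw [Real.mul_rpow (by norm_num) (by positivity)] at h1
  refine h1.trans ?_
  gcongr
  have hU' : 0 ≤ U ^ q := by positivity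
  have hW' : 0 ≤ W ^ q := by positivity
  rcases max_cases U W with h | h <;> rw [h.1] <;> linarith

lemma rpow_diff_pow {U W b l : ℝ} (hU : 0 ≤ U) (hW : 0 ≤ W) (hb : 1 ≤ b) {j : ℕ} (hj : 1 ≤ j)
    (hl : 0 < l) :
    |U ^ b - W ^ b| ^ j ≤ l * (2 ^ (2 * (b * j - 1)) * (U ^ (2 * (b * j - 1)) +
      W ^ (2 * (b * j - 1)))) + b ^ (2 * j) / (4 * l) * (U - W) ^ 2 := by
  have hS : 0 ≤ U + W := by positivity
  have hj' : (1 : ℝ) ≤ j := by exact_mod_cast hj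
  have hbj : 1 ≤ b * j := by nlinarith
  have hd : |U - W| ≤ U + W := by rw [abs_le]; constructor <;> linarith
  set X := (U + W) ^ (b * j - 1) with hX
  have hX0 : 0 ≤ X := by positivity
  have h1 : |U ^ b - W ^ b| ^ j ≤ b ^ j * X * |U - W| := by
    calc _ ≤ (b * (U + W) ^ (b - 1) * |U - W|) ^ j := by
          gcongr; exact rpow_sub_le hU hW hb
      _ = b ^ j * ((U + W) ^ (b - 1)) ^ j * (|U - W| ^ (j - 1) * |U - W|) := by
          rw [mul_pow, mul_pow, ← pow_succ]; congr 3; omega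
      _ ≤ b ^ j * ((U + W) ^ (b - 1)) ^ j * ((U + W) ^ (j - 1) * |U - W|) := by gcongr
      _ = b ^ j * (((U + W) ^ (b - 1)) ^ j * (U + W) ^ (j - 1)) * |U - W| := by ring
      _ = _ := by
          congr 2
          rw [← Real.rpow_natCast, ← Real.rpow_mul hS, ← Real.rpow_natCast (U + W),
            ← Real.rpow_add_of_nonneg hS (by nlinarith) (by positivity), hX]
          congr 1
          rw [Nat.cast_sub hj]; push_cast; ring
  have h2 : b ^ j * X * |U - W| ≤ l * X ^ 2 + b ^ (2 * j) / (4 * l) * (U - W) ^ 2 := by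
    have : l * X ^ 2 + b ^ (2 * j) / (4 * l) * (U - W) ^ 2 - b ^ j * X * |U - W| =
        (2 * l * X - b ^ j * |U - W|) ^ 2 / (4 * l) := by
      rw [← sq_abs (U - W), mul_comm 2 j, pow_mul]; field_simp; ring
    have : 0 ≤ (2 * l * X - b ^ j * |U - W|) ^ 2 / (4 * l) := by positivity
    linarith
  have h3 : X ^ 2 ≤ 2 ^ (2 * (b * j - 1)) * (U ^ (2 * (b * j - 1)) + W ^ (2 * (b * j - 1))) := by
    have : X ^ 2 = (U + W) ^ (2 * (b * j - 1)) := by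
      rw [hX, ← Real.rpow_natCast, ← Real.rpow_mul hS]; congr 1; push_cast; ring
    rw [this]
    exact add_rpow_le hU hW (by linarith)
  refine h1.trans (h2.trans ?_)
  gcongr

lemma fcont {a u : EuclideanSpace ℝ (Fin N) → ℝ} {b : ℝ} (hb : 0 ≤ b)
    (ha : ContinuousOn a (closure (annulus N R₀ R₁)))
    (hu : ContinuousOn u (closure (annulus N R₀ R₁))) :
    ContinuousOn (fun x => a x * u x ^ b) (closure (annulus N R₀ R₁)) :=
  ha.mul (hu.rpow_const fun _ _ => Or.inr hb)

lemma H1_bound_one (hN : 0 < N) (hR₀ : 0 < R₀) (hR : R₀ < R₁) {p : ℝ} (hp : 2 < p)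
    {a u v : EuclideanSpace ℝ (Fin N) → ℝ} (ha : memKhat N R₀ R₁ a) (hu : memK N R₀ R₁ u)
    (hv : ContDiffOn ℝ 2 v (closure (annulus N R₀ R₁)))
    (hveq : ∀ x ∈ annulus N R₀ R₁, lapl v x = v x - a x * u x ^ (p - 1))
    {C D : ℝ} (hI : |funcI N R₀ R₁ a p u| ≤ C)
    (hD : H1sq N R₀ R₁ (fun x => u x - v x) ≤ D) :
    H1sq N R₀ R₁ u ≤ (p * C + D / (4 * ((p - 2) / 4))) / ((p - 2) / 4) := by
  have hfc := fcont (b := p - 1) (by linarith) ha.1.continuousOn hu.1.1.continuousOn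
  have hv1 : ContDiffOn ℝ 1 v (closure (annulus N R₀ R₁)) := hv.of_le (by norm_num)
  have h1 := bil_weak hN hR₀ hR hv (memK_memC10 hu) hveq hfc
  have e1 : ∫ x in annulus N R₀ R₁, a x * u x ^ (p - 1) * u x =
      ∫ x in annulus N R₀ R₁, a x * |u x| ^ p := by
    refine setIntegral_congr_fun isOpen_annulus.measurableSet fun x hx => ?_
    have h0 := hu.1.2.1 x (subset_closure hx)
    rw [abs_of_nonneg h0, mul_assoc, ← Real.rpow_add_one' h0 (by linarith), sub_add_cancel]
  rw [e1] at h1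
  have h2 := bil_sub_left hR₀ hR hu.1.1 hv1 hu.1.1
  rw [bil_self, h1] at h2
  set ε := (p - 2) / 4 with hε
  have hεp : 0 < ε := by rw [hε]; linarith
  have h3 := bil_le hR₀ hR hu.1.1 (hu.1.1.sub hv1) hεp
  rw [bil_comm, h2] at h3
  have h4 := (abs_le.1 h3).1
  have h5 := (abs_le.1 hI).2
  rw [funcI] at h5
  set H := H1sq N R₀ R₁ u
  set P := ∫ x in annulus N R₀ R₁, a x * |u x| ^ p
  have h6 : p * (1 / 2 * H - 1 / p * P) ≤ p * C := by gcongr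
  have h7 : p * (1 / 2 * H - 1 / p * P) = p / 2 * H - P := by field_simp
  have h8 : 1 / (4 * ε) * H1sq N R₀ R₁ (fun x => u x - v x) ≤ D / (4 * ε) := by
    rw [one_div_mul_eq_div]; gcongr
  rw [le_div_iff₀ hεp]
  have h9 : p / 2 * H = H + 2 * ε * H := by rw [hε]; ring
  linarith

lemma fdiff (hN : 2 ≤ N) (hR₀ : 0 < R₀) (hR : R₀ < R₁) {p : ℝ} (hp : 2 < p)
    {a : EuclideanSpace ℝ (Fin N) → ℝ} (ha : memKhat N R₀ R₁ a) (B : ℝ) {j : ℕ} (hj : 1 ≤ j)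
    {ε : ℝ} (hε : 0 < ε) :
    ∃ η, 0 < η ∧ ∀ u w : EuclideanSpace ℝ (Fin N) → ℝ, memK N R₀ R₁ u → memK N R₀ R₁ w →
      H1sq N R₀ R₁ u ≤ B → H1sq N R₀ R₁ w ≤ B →
      ∫ x in annulus N R₀ R₁, (u x - w x) ^ 2 ≤ η →
      ∫ x in annulus N R₀ R₁, |a x * u x ^ (p - 1) - a x * w x ^ (p - 1)| ^ j ≤ ε := by
  obtain ⟨Am, hAm⟩ := isCompact_closure_annulus.exists_bound_of_continuousOn ha.1.continuousOn
  set b := p - 1 with hb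
  have hb1 : 1 ≤ b := by linarith
  have hj' : (1 : ℝ) ≤ j := by exact_mod_cast hj
  have hbj : 1 ≤ b * j := by nlinarith
  set q := 2 * (b * j - 1) with hq
  have hq0 : 0 ≤ q := by linarith
  obtain ⟨C, hC⟩ := rpow_bound hN hR₀ hR B hq0
  set A0 := max Am 1 with hA0
  have hA0p : 0 < A0 := lt_of_lt_of_le one_pos (le_max_right _ _)
  set C' := max C 1 with hC'
  have hC'p : 0 < C' := lt_of_lt_of_le one_pos (le_max_right _ _)
  set l := ε / (2 * (A0 ^ j * (2 ^ q * (2 * C')))) with hl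
  have hlp : 0 < l := by positivity
  set η := ε / (2 * (A0 ^ j * (b ^ (2 * j) / (4 * l)))) with hη
  have hbp : 0 < b := by linarith
  have hηp : 0 < η := by positivity
  refine ⟨η, hηp, fun u w hu hw hBu hBw hd => ?_⟩
  have hms : MeasurableSet (annulus N R₀ R₁) := isOpen_annulus.measurableSet
  have iq : ∀ u, memK N R₀ R₁ u → Integrable (fun x => u x ^ q)
      (volume.restrict (annulus N R₀ R₁)) := fun u hu =>
    integrableOn_of_cont (hu.1.1.continuousOn.rpow_const fun _ _ => Or.inr hq0)
  have id : Integrable (fun x => (u x - w x) ^ 2) (volume.restrict (annulus N R₀ R₁)) :=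
    integrableOn_of_cont ((hu.1.1.continuousOn.sub hw.1.1.continuousOn).pow 2)
  have i1 : Integrable (fun x => l * (2 ^ q * (u x ^ q + w x ^ q)))
      (volume.restrict (annulus N R₀ R₁)) := (((iq u hu).add (iq w hw)).const_mul _).const_mul _
  have i2 : Integrable (fun x => b ^ (2 * j) / (4 * l) * (u x - w x) ^ 2)
      (volume.restrict (annulus N R₀ R₁)) := id.const_mul _
  calc _ ≤ ∫ x in annulus N R₀ R₁, A0 ^ j * (l * (2 ^ q * (u x ^ q + w x ^ q)) +
        b ^ (2 * j) / (4 * l) * (u x - w x) ^ 2) := by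
        refine integral_mono_of_nonneg (Filter.Eventually.of_forall fun _ => by positivity)
          ((i1.add i2).const_mul _) ?_
        filter_upwards [ae_restrict_mem hms] with x hx
        have hx' := subset_closure hx
        have hax : |a x| ≤ A0 := (hAm x hx').trans (le_max_left _ _)
        rw [← mul_sub, abs_mul, mul_pow]
        have := rpow_diff_pow (hu.1.2.1 x hx') (hw.1.2.1 x hx') hb1 hj hlp
        gcongr
    _ = A0 ^ j * (l * (2 ^ q * ((∫ x in annulus N R₀ R₁, u x ^ q) +
          ∫ x in annulus N R₀ R₁, w x ^ q)) + b ^ (2 * j) / (4 * l) *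
          ∫ x in annulus N R₀ R₁, (u x - w x) ^ 2) := by
        rw [integral_const_mul, integral_add i1 i2, integral_const_mul, integral_const_mul,
          integral_const_mul, integral_add (iq u hu) (iq w hw)]
    _ ≤ A0 ^ j * (l * (2 ^ q * (C' + C')) + b ^ (2 * j) / (4 * l) * η) := by
        gcongr
        · exact (hC u hu hBu).trans (le_max_left _ _)
        · exact (hC w hw hBw).trans (le_max_left _ _)
    _ = ε := by
        have e1 : A0 ^ j * (l * (2 ^ q * (C' + C'))) = ε / 2 := by
          rw [hl]; field_simp; ring
        have e2 : A0 ^ j * (b ^ (2 * j) / (4 * l) * η) = ε / 2 := by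
          rw [hη]; field_simp
        rw [mul_add, e1, e2]; ring

lemma fbound (hN : 2 ≤ N) (hR₀ : 0 < R₀) (hR : R₀ < R₁) {p : ℝ} (hp : 2 < p)
    {a : EuclideanSpace ℝ (Fin N) → ℝ} (ha : memKhat N R₀ R₁ a) (B : ℝ) (j : ℕ) :
    ∃ C, 0 ≤ C ∧ ∀ u : EuclideanSpace ℝ (Fin N) → ℝ, memK N R₀ R₁ u →
      H1sq N R₀ R₁ u ≤ B →
      ∫ x in annulus N R₀ R₁, |a x * u x ^ (p - 1)| ^ j ≤ C := by
  obtain ⟨Am, hAm⟩ := isCompact_closure_annulus.exists_bound_of_continuousOn ha.1.continuousOn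
  have hq0 : 0 ≤ (p - 1) * j := by
    have : (0 : ℝ) ≤ j := by positivity
    nlinarith
  obtain ⟨C, hC⟩ := rpow_bound hN hR₀ hR B hq0
  refine ⟨(max Am 0) ^ j * max C 0, by positivity, fun u hu hB => ?_⟩
  have hms : MeasurableSet (annulus N R₀ R₁) := isOpen_annulus.measurableSet
  have iq : Integrable (fun x => u x ^ ((p - 1) * j)) (volume.restrict (annulus N R₀ R₁)) :=
    integrableOn_of_cont (hu.1.1.continuousOn.rpow_const fun _ _ => Or.inr hq0)
  calc _ ≤ ∫ x in annulus N R₀ R₁, (max Am 0) ^ j * u x ^ ((p - 1) * j) := by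
        refine integral_mono_of_nonneg (Filter.Eventually.of_forall fun _ => by positivity)
          (iq.const_mul _) ?_
        filter_upwards [ae_restrict_mem hms] with x hx
        have hx' := subset_closure hx
        have hax : |a x| ≤ max Am 0 := (hAm x hx').trans (le_max_left _ _)
        have h0 := hu.1.2.1 x hx'
        rw [abs_mul, mul_pow, abs_of_nonneg (a := u x ^ (p - 1)) (by positivity),
          Real.rpow_mul_natCast h0]
        gcongr
    _ = (max Am 0) ^ j * ∫ x in annulus N R₀ R₁, u x ^ ((p - 1) * j) := integral_const_mul _ _
    _ ≤ _ := by gcongr; exact (hC u hu hB).trans (le_max_left _ _)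

end bdd

end Part12

section Part13
variable {N : ℕ} {R₀ R₁ : ℝ}

lemma memC10_sub {F G : EuclideanSpace ℝ (Fin N) → ℝ} (hF : memC10 N R₀ R₁ F)
    (hG : memC10 N R₀ R₁ G) : memC10 N R₀ R₁ (fun x => F x - G x) :=
  ⟨hF.1.sub hG.1, fun x hx => by
    show F x - G x = 0
    rw [hF.2 x hx, hG.2 x hx, sub_zero]⟩

lemma c1_limit (hR₀ : 0 < R₀) (hR : R₀ < R₁) {v : ℕ → EuclideanSpace ℝ (Fin N) → ℝ}
    (hv : ∀ k, memC10 N R₀ R₁ (v k))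
    (hc : ∀ ε : ℝ, 0 < ε → ∃ K : ℕ, ∀ k ≥ K, ∀ l ≥ K, ∀ x ∈ annulus N R₀ R₁,
      ‖fderiv ℝ (fun y => v k y - v l y) x‖ ≤ ε) :
    ∃ w, memC10 N R₀ R₁ w ∧ ∀ ε : ℝ, 0 < ε → ∃ K : ℕ, ∀ k ≥ K,
      ∀ x ∈ annulus N R₀ R₁, |v k x - w x| ≤ ε ∧
        ‖fderivWithin ℝ (fun y => v k y - w y) (closure (annulus N R₀ R₁)) x‖ ≤ ε := by
  have hR1 : 0 < R₁ := hR₀.trans hR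
  set cA := closure (annulus N R₀ R₁) with hcA
  have hud := uniqueDiffOn_cA (N := N) hR₀ hR
  let G : ℕ → EuclideanSpace ℝ (Fin N) → (EuclideanSpace ℝ (Fin N) →L[ℝ] ℝ) :=
    fun k x => fderivWithin ℝ (v k) cA x
  have hGc : ∀ k, ContinuousOn (G k) cA := fun k => dcont hR₀ hR (hv k).1
  have hdw : ∀ k, ∀ x ∈ cA, DifferentiableWithinAt ℝ (v k) cA x := fun k x hx =>
    ((hv k).1.differentiableOn (by norm_num)) x hx
  have hGsub : ∀ ε : ℝ, 0 < ε → ∃ K : ℕ, ∀ k ≥ K, ∀ l ≥ K, ∀ x ∈ cA, ‖G k x - G l x‖ ≤ ε := by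
    intro ε hε
    obtain ⟨K, hK⟩ := hc ε hε
    refine ⟨K, fun k hk l hl x hx => ?_⟩
    refine le_on_closure (f := fun x => ‖G k x - G l x‖) (g := fun _ => ε) (fun y hy => ?_)
      ((hGc k).sub (hGc l)).norm continuousOn_const hx
    have := hK k hk l hl y hy
    rw [← fderivWithin_eq_of_mem hy] at this
    rw [fderivWithin_fun_sub (hud y (subset_closure hy)) (hdw k y (subset_closure hy))
      (hdw l y (subset_closure hy))] at this
    exact this
  have hlip : ∀ ε : ℝ, 0 < ε → ∃ K : ℕ, ∀ k ≥ K, ∀ l ≥ K, (∀ x ∈ cA, ∀ y ∈ cA,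
      |(v k x - v l x) - (v k y - v l y)| ≤ ε * ‖x - y‖) ∧ ∀ x ∈ cA, |v k x - v l x| ≤ ε * R₁ := by
    intro ε hε
    obtain ⟨K, hK⟩ := hc ε hε
    refine ⟨K, fun k hk l hl => ⟨fun x hx y hy => ?_, fun x hx => ?_⟩⟩
    · have := memC10_abs_sub_le (memC10_sub (hv k) (hv l)) (hK k hk l hl) hε.le x y
      rwa [indicator_eq_of_memC10 (memC10_sub (hv k) (hv l)) hx,
        indicator_eq_of_memC10 (memC10_sub (hv k) (hv l)) hy] at this
    · exact memC10_abs_le hR₀ (memC10_sub (hv k) (hv l)) (hK k hk l hl) hε.le hx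
  have hwex : ∀ x ∈ cA, ∃ L : ℝ, Filter.Tendsto (fun k => v k x) Filter.atTop (nhds L) := by
    intro x hx
    refine cauchySeq_tendsto_of_complete (Metric.cauchySeq_iff.2 fun ε hε => ?_)
    obtain ⟨K, hK⟩ := hlip (ε / (2 * R₁)) (by positivity)
    refine ⟨K, fun k hk l hl => ?_⟩
    rw [Real.dist_eq]
    have h := (hK k hk l hl).2 x hx
    have : ε / (2 * R₁) * R₁ = ε / 2 := by field_simp
    linarith
  have hgex : ∀ x ∈ cA, ∃ L, Filter.Tendsto (fun k => G k x) Filter.atTop (nhds L) := by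
    intro x hx
    refine cauchySeq_tendsto_of_complete (Metric.cauchySeq_iff.2 fun ε hε => ?_)
    obtain ⟨K, hK⟩ := hGsub (ε / 2) (by positivity)
    refine ⟨K, fun k hk l hl => ?_⟩
    rw [dist_eq_norm]
    have h := hK k hk l hl x hx
    linarith
  choose! w hw using hwex
  choose! g hg using hgex
  have hGg : ∀ ε : ℝ, 0 < ε → ∃ K : ℕ, ∀ k ≥ K, ∀ x ∈ cA, ‖G k x - g x‖ ≤ ε := by
    intro ε hε
    obtain ⟨K, hK⟩ := hGsub ε hε
    refine ⟨K, fun k hk x hx => ?_⟩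
    refine le_of_tendsto ((tendsto_const_nhds.sub (hg x hx)).norm) ?_
    filter_upwards [Filter.eventually_ge_atTop K] with l hl using hK k hk l hl x hx
  have hlw : ∀ ε : ℝ, 0 < ε → ∃ K : ℕ, ∀ k ≥ K, (∀ x ∈ cA, ∀ y ∈ cA,
      |(v k x - w x) - (v k y - w y)| ≤ ε * ‖x - y‖) ∧ ∀ x ∈ cA, |v k x - w x| ≤ ε * R₁ := by
    intro ε hε
    obtain ⟨K, hK⟩ := hlip ε hε
    refine ⟨K, fun k hk => ⟨fun x hx y hy => ?_, fun x hx => ?_⟩⟩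
    · refine le_of_tendsto (((tendsto_const_nhds.sub (hw x hx)).sub
        (tendsto_const_nhds.sub (hw y hy))).abs) ?_
      filter_upwards [Filter.eventually_ge_atTop K] with l hl using (hK k hk l hl).1 x hx y hy
    · refine le_of_tendsto ((tendsto_const_nhds.sub (hw x hx)).abs) ?_
      filter_upwards [Filter.eventually_ge_atTop K] with l hl using (hK k hk l hl).2 x hx
  have hgc : ContinuousOn g cA := by
    have hu : TendstoUniformlyOn G g Filter.atTop cA := by
      rw [Metric.tendstoUniformlyOn_iff]
      intro ε hε
      obtain ⟨K, hK⟩ := hGg (ε / 2) (by positivity)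
      filter_upwards [Filter.eventually_ge_atTop K] with k hk x hx
      rw [dist_comm, dist_eq_norm]
      linarith [hK k hk x hx]
    exact hu.continuousOn (Filter.Eventually.of_forall hGc).frequently
  have hder : ∀ x ∈ cA, HasFDerivWithinAt w (g x) cA x := by
    intro x hx
    refine HasFDerivWithinAt.of_isLittleO (Asymptotics.isLittleO_iff.2 fun c hc0 => ?_)
    obtain ⟨K1, hK1⟩ := hlw (c / 3) (by positivity)
    obtain ⟨K2, hK2⟩ := hGg (c / 3) (by positivity)
    set k := max K1 K2
    have h1 := (hK1 k (le_max_left _ _)).1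
    have h2 := hK2 k (le_max_right _ _) x hx
    have h3 := Asymptotics.isLittleO_iff.1 (hdw k x hx).hasFDerivWithinAt.isLittleO
      (show 0 < c / 3 by positivity)
    filter_upwards [h3, self_mem_nhdsWithin] with z hz hzA
    have h4 := h1 z hzA x hx
    have h5 : ‖(G k x - g x) (z - x)‖ ≤ c / 3 * ‖z - x‖ :=
      (ContinuousLinearMap.le_opNorm _ _).trans (by gcongr)
    rw [_root_.sub_apply] at h5
    rw [Real.norm_eq_abs] at h5 hz ⊢
    rw [abs_le] at h4 h5 hz ⊢
    constructor <;> linarith [h4.1, h4.2, h5.1, h5.2, hz.1, hz.2]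
  have hfw : ∀ x ∈ cA, fderivWithin ℝ w cA x = g x := fun x hx =>
    (hder x hx).fderivWithin (hud x hx)
  have hw1 : ContDiffOn ℝ 1 w cA := by
    have h := (contDiffOn_succ_iff_fderivWithin (n := 0) (f := w) hud).2
      ⟨fun x hx => (hder x hx).differentiableWithinAt, fun h => by simp at h,
        contDiffOn_zero.2 (hgc.congr hfw)⟩
    rwa [zero_add] at h
  refine ⟨w, ⟨hw1, fun x hx => ?_⟩, fun ε hε => ?_⟩
  · have hxA : x ∈ cA := by
      rw [hcA, mem_closure_annulus hR₀ hR]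
      rcases hx with h | h <;> rw [h] <;> exact ⟨by linarith, by linarith⟩
    refine tendsto_nhds_unique (hw x hxA) ?_
    simp only [fun k => (hv k).2 x hx]
    exact tendsto_const_nhds
  · obtain ⟨K1, hK1⟩ := hlw (ε / R₁) (by positivity)
    obtain ⟨K2, hK2⟩ := hGg ε hε
    refine ⟨max K1 K2, fun k hk x hx => ⟨?_, ?_⟩⟩
    · have := (hK1 k (le_of_max_le_left hk)).2 x (subset_closure hx)
      rwa [div_mul_cancel₀ _ hR1.ne'] at this
    · have hx' := subset_closure hx
      rw [fderivWithin_fun_sub (hud x hx') (hdw k x hx') (hder x hx').differentiableWithinAt,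
        hfw x hx']
      exact hK2 k (le_of_max_le_right hk) x hx'

end Part13

section Part14
variable {N : ℕ} {R₀ R₁ : ℝ}

lemma ascoli_seq (hR₀ : 0 < R₀) {v : ℕ → EuclideanSpace ℝ (Fin N) → ℝ}
    (hv : ∀ k, memC10 N R₀ R₁ (v k)) {L : ℝ} (hL : 0 ≤ L)
    (hb : ∀ k, ∀ x ∈ annulus N R₀ R₁, ‖fderiv ℝ (v k) x‖ ≤ L) :
    ∃ φ : ℕ → ℕ, StrictMono φ ∧ ∀ ε : ℝ, 0 < ε → ∃ K : ℕ, ∀ k ≥ K, ∀ l ≥ K,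
      ∀ x ∈ annulus N R₀ R₁, |v (φ k) x - v (φ l) x| ≤ ε := by
  haveI : CompactSpace (closure (annulus N R₀ R₁)) :=
    isCompact_iff_compactSpace.1 isCompact_closure_annulus
  let V : ℕ → BoundedContinuousFunction (closure (annulus N R₀ R₁)) ℝ := fun k =>
    BoundedContinuousFunction.mkOfCompact
      ⟨fun x => v k x, continuousOn_iff_continuous_restrict.1 (hv k).1.continuousOn⟩
  have hVa : ∀ k x, V k x = v k x := fun k x => rfl
  have hcomp := BoundedContinuousFunction.arzela_ascoli (Icc (-(L * R₁)) (L * R₁)) isCompact_Icc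
    (Set.range V) (by
      rintro f x ⟨k, rfl⟩
      exact abs_le.1 (memC10_abs_le hR₀ (hv k) (hb k) hL x.2)) (by
      refine Metric.equicontinuous_of_continuity_modulus (fun t => L * t) ?_ _ ?_
      · have : Filter.Tendsto (fun t : ℝ => L * t) (nhds 0) (nhds (L * 0)) :=
          (continuous_const.mul continuous_id).tendsto 0
        rwa [mul_zero] at this
      · rintro x y ⟨f, k, rfl⟩
        have := memC10_abs_sub_le (hv k) (hb k) hL (x : EuclideanSpace ℝ (Fin N)) y
        rw [indicator_eq_of_memC10 (hv k) x.2, indicator_eq_of_memC10 (hv k) y.2] at this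
        rw [Subtype.dist_eq, dist_eq_norm (x : EuclideanSpace ℝ (Fin N)), Real.dist_eq]
        exact this)
  obtain ⟨g, -, φ, hφ, hlim⟩ := hcomp.tendsto_subseq
    (x := V) (fun k => subset_closure (mem_range_self k))
  refine ⟨φ, hφ, fun ε hε => ?_⟩
  obtain ⟨K, hK⟩ := Metric.cauchySeq_iff.1 hlim.cauchySeq ε hε
  refine ⟨K, fun k hk l hl x hx => ?_⟩
  have h1 := hK k hk l hl
  have h2 := BoundedContinuousFunction.dist_coe_le_dist (f := V (φ k)) (g := V (φ l))
    ⟨x, subset_closure hx⟩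
  rw [Real.dist_eq, hVa, hVa] at h2
  exact h2.trans h1.le

lemma grad_cauchy (hN : 2 ≤ N) (hR₀ : 0 < R₀) (hR : R₀ < R₁) {p : ℝ} (hp : 2 < p)
    {a : EuclideanSpace ℝ (Fin N) → ℝ} (ha : memKhat N R₀ R₁ a) {B : ℝ}
    {u v : ℕ → EuclideanSpace ℝ (Fin N) → ℝ}
    (hu : ∀ n, memK N R₀ R₁ (u n))
    (hv : ∀ n, ContDiffOn ℝ 2 (v n) (closure (annulus N R₀ R₁)))
    (hveq : ∀ n, ∀ x ∈ annulus N R₀ R₁, lapl (v n) x = v n x - a x * u n x ^ (p - 1))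
    (hvbd : ∀ n, ∀ x : EuclideanSpace ℝ (Fin N), (‖x‖ = R₀ ∨ ‖x‖ = R₁) → v n x = 0)
    (hB : ∀ n, H1sq N R₀ R₁ (u n) ≤ B)
    (hD : Filter.Tendsto (fun n => H1sq N R₀ R₁ (fun x => u n x - v n x)) Filter.atTop (nhds 0))
    (hc : ∀ ε : ℝ, 0 < ε → ∃ K : ℕ, ∀ k ≥ K, ∀ l ≥ K,
      ∀ x ∈ annulus N R₀ R₁, |v k x - v l x| ≤ ε) :
    ∀ ε : ℝ, 0 < ε → ∃ K : ℕ, ∀ k ≥ K, ∀ l ≥ K, ∀ x ∈ annulus N R₀ R₁,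
      ‖fderiv ℝ (fun y => v k y - v l y) x‖ ≤ ε := by
  intro ε hε
  obtain ⟨C, hC0, hC⟩ := grad_est hN hR₀ hR (half_pos hε)
  obtain ⟨Cf, hCf0, hCf⟩ := fbound hN hR₀ hR hp ha B 1
  set ε1 := ε / (4 * (C + 1)) with hε1
  have hεpa : 0 < ε1 := by positivity
  obtain ⟨η, hη0, hη⟩ := fdiff hN hR₀ hR hp ha B (j := 2 * N) (by omega) hεpa
  set ε2 := min ε1 (η / 12) with hε2
  have hεpb : 0 < ε2 := lt_min hεpa (by positivity)
  obtain ⟨K1, hK1⟩ := hc (ε2 / (2 * Cf + 1)) (by positivity)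
  obtain ⟨K2, hK2⟩ := Filter.eventually_atTop.1 (hD.eventually (gt_mem_nhds hεpb))
  have hv1 : ∀ n, ContDiffOn ℝ 1 (v n) (closure (annulus N R₀ R₁)) :=
    fun n => (hv n).of_le (by norm_num)
  have hfc : ∀ n, ContinuousOn (fun x => a x * u n x ^ (p - 1)) (closure (annulus N R₀ R₁)) :=
    fun n => fcont (b := p - 1) (by linarith) ha.1.continuousOn (hu n).1.1.continuousOn
  refine ⟨max K1 K2, fun k hk l hl => ?_⟩
  have hs := hK1 k (le_of_max_le_left hk) l (le_of_max_le_left hl)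
  have hDk := hK2 k (le_of_max_le_right hk)
  have hDl := hK2 l (le_of_max_le_right hl)
  have hlap : ∀ x ∈ annulus N R₀ R₁, lapl (fun y => v k y - v l y) x = (v k x - v l x) -
      (a x * u k x ^ (p - 1) - a x * u l x ^ (p - 1)) := by
    intro x hx
    rw [lapl_sub' hR₀ hR (hv k) (hv l) hx, hveq k x hx, hveq l x hx]
    ring
  have hm : memC10 N R₀ R₁ (fun y => v k y - v l y) :=
    memC10_sub ⟨hv1 k, hvbd k⟩ ⟨hv1 l, hvbd l⟩
  have hH : H1sq N R₀ R₁ (fun y => v k y - v l y) ≤ ε2 := by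
    rw [← bil_self, bil_weak (by omega) hR₀ hR ((hv k).sub (hv l)) hm hlap ((hfc k).sub (hfc l))]
    set s := ε2 / (2 * Cf + 1) with hs'
    have hs0 : 0 ≤ s := by positivity
    have ik : IntegrableOn (fun x => |a x * u k x ^ (p - 1)| ^ 1) (annulus N R₀ R₁) :=
      integrableOn_of_cont ((hfc k).abs.pow 1)
    have il : IntegrableOn (fun x => |a x * u l x ^ (p - 1)| ^ 1) (annulus N R₀ R₁) :=
      integrableOn_of_cont ((hfc l).abs.pow 1)
    have h1 : ∫ x in annulus N R₀ R₁,
        (a x * u k x ^ (p - 1) - a x * u l x ^ (p - 1)) * (v k x - v l x) ≤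
        ∫ x in annulus N R₀ R₁,
          (|a x * u k x ^ (p - 1)| ^ 1 + |a x * u l x ^ (p - 1)| ^ 1) * s := by
      refine setIntegral_mono_on (integrableOn_of_cont (((hfc k).sub (hfc l)).mul
        ((hv1 k).continuousOn.sub (hv1 l).continuousOn))) ((ik.add il).mul_const s)
        isOpen_annulus.measurableSet fun x hx => ?_
      refine (le_abs_self _).trans ?_
      rw [abs_mul, pow_one, pow_one]
      exact mul_le_mul (abs_sub _ _) (hs x hx) (abs_nonneg _) (by positivity)
    rw [integral_mul_const, integral_add ik il] at h1
    refine h1.trans ?_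
    have h2 := hCf _ (hu k) (hB k)
    have h3 := hCf _ (hu l) (hB l)
    calc _ ≤ (2 * Cf + 1) * s := by
            refine mul_le_mul_of_nonneg_right ?_ hs0
            linarith
      _ = ε2 := by rw [hs']; field_simp
  have hU : ∫ x in annulus N R₀ R₁, (u k x - u l x) ^ 2 ≤ η := by
    refine (sq_le_H1sq hR₀ hR ((hu k).1.1.sub (hu l).1.1)).trans ?_
    have h1 := H1sq_tri hR₀ hR (hu k).1.1 (hu l).1.1 (hv1 k)
    have h2 := H1sq_tri hR₀ hR (hv1 k) (hu l).1.1 (hv1 l)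
    rw [H1sq_symm hR₀ hR (hv1 l) (hu l).1.1] at h2
    have h3 : ε2 ≤ η / 12 := min_le_right _ _
    linarith
  have hF := hη _ _ (hu k) (hu l) (hB k) (hB l) hU
  intro x hx
  refine (hC _ _ ((hv k).sub (hv l)) ((hfc k).sub (hfc l)) hm.2 hlap x hx).trans ?_
  have h3 : ε2 ≤ ε1 := min_le_left _ _
  have h4 : C * ((∫ y in annulus N R₀ R₁, |a y * u k y ^ (p - 1) - a y * u l y ^ (p - 1)| ^ (2 * N))
      + H1sq N R₀ R₁ (fun y => v k y - v l y)) ≤ (C + 1) * (ε1 + ε1) := by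
    refine mul_le_mul (by linarith) (add_le_add hF (hH.trans h3)) ?_ (by positivity)
    exact add_nonneg (integral_nonneg fun _ => by positivity) (H1sq_nonneg _)
  have h5 : (C + 1) * (ε1 + ε1) = ε / 2 := by rw [hε1]; field_simp; ring
  change ε / 2 + C * ((∫ y in annulus N R₀ R₁, |a y * u k y ^ (p - 1) - a y * u l y ^ (p - 1)| ^ (2 * N))
      + H1sq N R₀ R₁ (fun y => v k y - v l y)) ≤ ε
  linarith

end Part14

section Part15
variable {N : ℕ} {R₀ R₁ : ℝ}

lemma ae_subseq {u : ℕ → EuclideanSpace ℝ (Fin N) → ℝ} {w : EuclideanSpace ℝ (Fin N) → ℝ}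
    (hu : ∀ k, ContinuousOn (u k) (closure (annulus N R₀ R₁)))
    (hw : ContinuousOn w (closure (annulus N R₀ R₁)))
    (hlim : Filter.Tendsto (fun k => ∫ x in annulus N R₀ R₁, (u k x - w x) ^ 2)
      Filter.atTop (nhds 0)) :
    ∃ ns : ℕ → ℕ, ∀ᵐ x, x ∈ annulus N R₀ R₁ →
      Filter.Tendsto (fun i => u (ns i) x) Filter.atTop (nhds (w x)) := by
  have hm := (isOpen_annulus (N := N) (R₀ := R₀) (R₁ := R₁)).measurableSet
  have hme : ∀ {g : EuclideanSpace ℝ (Fin N) → ℝ}, ContinuousOn g (closure (annulus N R₀ R₁)) →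
      AEStronglyMeasurable g (volume.restrict (annulus N R₀ R₁)) := fun hg =>
    (hg.mono subset_closure).aestronglyMeasurable hm
  have hE : ∀ k, eLpNorm (u k - w) 2 (volume.restrict (annulus N R₀ R₁)) =
      ENNReal.ofReal ((∫ x in annulus N R₀ R₁, (u k x - w x) ^ 2) ^ ((2 : ℝ)⁻¹)) := by
    intro k
    have hL : MemLp (u k - w) 2 (volume.restrict (annulus N R₀ R₁)) := by
      rw [memLp_two_iff_integrable_sq (hme ((hu k).sub hw))]
      exact integrableOn_of_cont (((hu k).sub hw).pow 2)
    rw [hL.eLpNorm_eq_integral_rpow_norm (by norm_num) (by norm_num)]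
    simp
  have hT : TendstoInMeasure (volume.restrict (annulus N R₀ R₁)) u Filter.atTop w := by
    refine tendstoInMeasure_of_tendsto_eLpNorm (p := 2) (by norm_num) (fun k => hme (hu k))
      (hme hw) ?_
    simp only [hE]
    have h := (hlim.rpow_const (p := (2 : ℝ)⁻¹) (Or.inr (by norm_num)))
    have h2 := ENNReal.tendsto_ofReal h
    simpa using h2
  obtain ⟨ns, -, h⟩ := hT.exists_seq_tendsto_ae
  exact ⟨ns, (ae_restrict_iff' hm).1 h⟩

lemma ae_frequently {P : EuclideanSpace ℝ (Fin N) → Prop} (h : ∀ᵐ x, P x)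
    (x : EuclideanSpace ℝ (Fin N)) : ∃ᶠ z in nhds x, P z :=
  mem_closure_iff_frequently.1 (Measure.dense_of_ae h x)

lemma reflect_coord (i : Fin N) {d : EuclideanSpace ℝ (Fin N)} (hd : d i = 0)
    (z : EuclideanSpace ℝ (Fin N)) : ((ℝ ∙ d)ᗮ.reflection z) i = z i := by
  rw [Submodule.reflection_orthogonal_apply, Submodule.reflection_singleton_apply]
  simp [hd]

lemma limit_mono (hN : 2 ≤ N) (hR₀ : 0 < R₀)
    {u : ℕ → EuclideanSpace ℝ (Fin N) → ℝ} {w : EuclideanSpace ℝ (Fin N) → ℝ}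
    (hu : ∀ k, memK N R₀ R₁ (u k)) (hw : memC10 N R₀ R₁ w) {ns : ℕ → ℕ}
    (hns : ∀ᵐ x, x ∈ annulus N R₀ R₁ →
      Filter.Tendsto (fun i => u (ns i) x) Filter.atTop (nhds (w x))) :
    MonoK N R₀ R₁ w := by
  have hcw : ∀ x ∈ annulus N R₀ R₁, ContinuousAt w x := fun x hx =>
    (hw.1.diffAt hx).continuousAt
  have hRA : ∀ (R : EuclideanSpace ℝ (Fin N) ≃ₗᵢ[ℝ] EuclideanSpace ℝ (Fin N)) x,
      x ∈ annulus N R₀ R₁ → R x ∈ annulus N R₀ R₁ := by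
    intro R x hx
    unfold annulus at hx ⊢
    simpa using hx
  have key : ∀ (R : EuclideanSpace ℝ (Fin N) ≃ₗᵢ[ℝ] EuclideanSpace ℝ (Fin N)) x,
      x ∈ annulus N R₀ R₁ → (∀ᶠ z in nhds x, |lastCoord z| ≤ |lastCoord (R z)|) →
      w (R x) ≤ w x := by
    intro R x hx hev
    have h1 : ∀ᵐ z, R z ∈ annulus N R₀ R₁ →
      Filter.Tendsto (fun i => u (ns i) (R z)) Filter.atTop (nhds (w (R z))) :=
      R.measurePreserving.quasiMeasurePreserving.ae hns
    have h2 := (ae_frequently (hns.and h1) x).and_eventually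
      (hev.and (isOpen_annulus.mem_nhds hx))
    have h3 : ∃ᶠ z in nhds x, w (R z) - w z ≤ 0 := by
      refine h2.mono fun z hz => ?_
      obtain ⟨⟨ha, hb⟩, hc, hd⟩ := hz
      have := le_of_tendsto_of_tendsto' (hb (hRA R z hd)) (ha hd) fun i =>
        memKhat_mono hR₀ (hu (ns i)).1 z (subset_closure hd) (R z) (subset_closure (hRA R z hd))
          (R.norm_map z).symm hc
      linarith
    have h4 : ContinuousAt (fun z => w (R z) - w z) x :=
      ((hcw (R x) (hRA R x hx)).comp R.continuous.continuousAt).sub (hcw x hx)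
    linarith [le_of_tendsto_of_frequently h4 h3]
  have hl : ∀ z : EuclideanSpace ℝ (Fin N), lastCoord z = z ⟨N - 1, by omega⟩ := by
    intro z
    unfold lastCoord
    rw [dif_pos (by omega)]
  have hlc : Continuous (lastCoord (N := N)) := by
    have : (lastCoord (N := N)) = fun z => z ⟨N - 1, by omega⟩ := funext hl
    rw [this]
    fun_prop
  intro x hx y hy hxy hxyl
  by_cases hxA : x ∈ annulus N R₀ R₁
  swap
  · have hb := bd_of_mem_closure hx hxA
    rw [hw.2 x hb, hw.2 y (by rwa [← hxy])]
  rcases hxyl.lt_or_eq with hlt | heq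
  · have hRx : (ℝ ∙ (x - y))ᗮ.reflection x = y := Submodule.reflection_sub hxy
    have := key (ℝ ∙ (x - y))ᗮ.reflection x hxA ?_
    · rwa [hRx] at this
    · have h1 : ContinuousAt (fun z => |lastCoord z|) x := (hlc.abs).continuousAt
      have h2 : ContinuousAt (fun z => |lastCoord ((ℝ ∙ (x - y))ᗮ.reflection z)|) x :=
        ((hlc.comp (LinearIsometryEquiv.continuous _)).abs).continuousAt
      have := h1.eventually_lt h2 (by rw [hRx]; exact hlt)
      exact this.mono fun z hz => hz.le
  · rcases abs_eq_abs.1 heq with h | h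
    · have hRx : (ℝ ∙ (x - y))ᗮ.reflection x = y := Submodule.reflection_sub hxy
      have := key (ℝ ∙ (x - y))ᗮ.reflection x hxA ?_
      · rwa [hRx] at this
      · refine Filter.Eventually.of_forall fun z => ?_
        rw [hl, hl, reflect_coord]
        rw [hl, hl] at h
        simp [h]
    · have hRx : (ℝ ∙ (x - -y))ᗮ.reflection x = -y := Submodule.reflection_sub (by rwa [norm_neg])
      have := key ((ℝ ∙ (x - -y))ᗮ.reflection.trans (LinearIsometryEquiv.neg ℝ)) x hxA ?_
      · rw [LinearIsometryEquiv.trans_apply, hRx] at this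
        simpa using this
      · refine Filter.Eventually.of_forall fun z => ?_
        rw [hl, hl, LinearIsometryEquiv.trans_apply, LinearIsometryEquiv.coe_neg, PiLp.neg_apply,
          reflect_coord, abs_neg]
        rw [hl, hl] at h
        simp [h]

lemma limit_nonneg (hR₀ : 0 < R₀) {u : ℕ → EuclideanSpace ℝ (Fin N) → ℝ}
    {w : EuclideanSpace ℝ (Fin N) → ℝ}
    (hu : ∀ k, memK N R₀ R₁ (u k)) (hw : memC10 N R₀ R₁ w) {ns : ℕ → ℕ}
    (hns : ∀ᵐ x, x ∈ annulus N R₀ R₁ →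
      Filter.Tendsto (fun i => u (ns i) x) Filter.atTop (nhds (w x))) :
    ∀ x ∈ closure (annulus N R₀ R₁), 0 ≤ w x := by
  intro x hx
  by_cases hxA : x ∈ annulus N R₀ R₁
  swap
  · rw [hw.2 x (bd_of_mem_closure hx hxA)]
  have h1 := (ae_frequently hns x).and_eventually (isOpen_annulus.mem_nhds hxA)
  refine ge_of_tendsto_of_frequently (hw.1.diffAt hxA).continuousAt (h1.mono fun z hz => ?_)
  exact ge_of_tendsto' (hz.1 hz.2) fun i => (hu (ns i)).1.2.1 z (subset_closure hz.2)

lemma memK_of_mono (hN : 2 ≤ N) (hR₀ : 0 < R₀) (hR : R₀ < R₁) {w : EuclideanSpace ℝ (Fin N) → ℝ}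
    (hw : memC10 N R₀ R₁ w) (hw0 : ∀ x ∈ closure (annulus N R₀ R₁), 0 ≤ w x)
    (hm : MonoK N R₀ R₁ w) : memK N R₀ R₁ w := by
  let P : ℝ → ℝ → EuclideanSpace ℝ (Fin N) := fun r θ =>
    EuclideanSpace.single ⟨0, by omega⟩ (r * cos θ) + EuclideanSpace.single ⟨N - 1, by omega⟩ (r * sin θ)
  have hne : (⟨0, by omega⟩ : Fin N) ≠ ⟨N - 1, by omega⟩ := by
    intro h
    have := congrArg Fin.val h
    simp at this
    omega
  have hPl : ∀ r θ, lastCoord (P r θ) = r * sin θ := by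
    intro r θ
    unfold lastCoord
    rw [dif_pos (by omega)]
    simp [P, hne.symm]
  have hPn : ∀ r θ, 0 ≤ r → ‖P r θ‖ = r := by
    intro r θ hr
    have h0 : inner ℝ (EuclideanSpace.single (⟨0, by omega⟩ : Fin N) (r * cos θ))
        (EuclideanSpace.single (⟨N - 1, by omega⟩ : Fin N) (r * sin θ)) = 0 := by
      rw [EuclideanSpace.inner_single_left]
      simp [hne]
    have h1 := norm_add_sq_real (EuclideanSpace.single (⟨0, by omega⟩ : Fin N) (r * cos θ))
        (EuclideanSpace.single (⟨N - 1, by omega⟩ : Fin N) (r * sin θ))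
    rw [h0] at h1
    have h2 : ‖P r θ‖ ^ 2 = r ^ 2 := by
      rw [show P r θ = _ from rfl, h1]
      simp only [EuclideanSpace.norm_single, Real.norm_eq_abs, sq_abs]
      nlinarith [sin_sq_add_cos_sq θ]
    exact (pow_left_inj₀ (norm_nonneg _) hr (by norm_num)).1 h2
  have hPA : ∀ r ∈ Icc R₀ R₁, ∀ θ, P r θ ∈ closure (annulus N R₀ R₁) := by
    intro r hr θ
    rw [mem_closure_annulus hR₀ hR, hPn r θ (hR₀.le.trans hr.1)]
    exact hr
  refine ⟨⟨hw.1, hw0, fun r θ => w (P r θ), ?_, ?_, ?_⟩, hw.2⟩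
  · intro x hx
    have hb := (mem_closure_annulus hR₀ hR).1 hx
    have hx0 : 0 < ‖x‖ := hR₀.trans_le hb.1
    have hlx : lastCoord (P ‖x‖ (angleOf x)) = lastCoord x := by
      have h := abs_le.1 (abs_lastCoord_le x)
      rw [hPl, angleOf, Real.sin_arcsin, mul_div_cancel₀ _ hx0.ne']
      · rw [le_div_iff₀ hx0]; linarith
      · rw [div_le_iff₀ hx0]; linarith
    have hn : ‖P ‖x‖ (angleOf x)‖ = ‖x‖ := hPn _ _ hx0.le
    exact le_antisymm (hm _ (hPA _ hb _) _ hx hn (by rw [hlx])) (hm _ hx _ (hPA _ hb _) hn.symm (by rw [hlx]))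
  · intro r hr θ _
    have h0 := hR₀.le.trans hr.1
    have e : |lastCoord (P r (-θ))| = |lastCoord (P r θ)| := by
      rw [hPl, hPl, sin_neg, mul_neg, abs_neg]
    exact le_antisymm (hm _ (hPA r hr _) _ (hPA r hr _) (by rw [hPn _ _ h0, hPn _ _ h0]) e.ge)
      (hm _ (hPA r hr _) _ (hPA r hr _) (by rw [hPn _ _ h0, hPn _ _ h0]) e.le)
  · intro r hr θ hθ θ' hθ' hle
    have h0 := hR₀.le.trans hr.1
    refine hm _ (hPA r hr _) _ (hPA r hr _) (by rw [hPn _ _ h0, hPn _ _ h0]) ?_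
    have hs : 0 ≤ sin θ := sin_nonneg_of_nonneg_of_le_pi hθ.1 (by linarith [hθ.2, pi_pos])
    have hs' : sin θ ≤ sin θ' := sin_le_sin_of_le_of_le_pi_div_two (by linarith [hθ.1, pi_pos]) hθ'.2 hle
    rw [hPl, hPl, abs_of_nonneg (mul_nonneg h0 hs), abs_of_nonneg (mul_nonneg h0 (hs.trans hs'))]
    exact mul_le_mul_of_nonneg_left hs' h0

end Part15

section Part16
variable {N : ℕ} {R₀ R₁ : ℝ}

lemma test_memC10 {φ : EuclideanSpace ℝ (Fin N) → ℝ} (h : IsTestFun N R₀ R₁ φ) :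
    memC10 N R₀ R₁ φ := by
  refine ⟨(h.1.of_le (by norm_cast)).contDiffOn, fun x hx => ?_⟩
  exact image_eq_zero_of_notMem_tsupport fun hx' => not_mem_of_bd hx (h.2.2 hx')

lemma H1sq_tendsto (hR₀ : 0 < R₀) (hR : R₀ < R₁) {v : ℕ → EuclideanSpace ℝ (Fin N) → ℝ}
    {w : EuclideanSpace ℝ (Fin N) → ℝ}
    (hv : ∀ k, ContDiffOn ℝ 1 (v k) (closure (annulus N R₀ R₁)))
    (hw : ContDiffOn ℝ 1 w (closure (annulus N R₀ R₁)))
    (h : ∀ ε : ℝ, 0 < ε → ∃ K : ℕ, ∀ k ≥ K,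
      ∀ x ∈ annulus N R₀ R₁, |v k x - w x| ≤ ε ∧
        ‖fderivWithin ℝ (fun y => v k y - w y) (closure (annulus N R₀ R₁)) x‖ ≤ ε) :
    Filter.Tendsto (fun k => H1sq N R₀ R₁ (fun x => v k x - w x)) Filter.atTop (nhds 0) := by
  set m := (volume : Measure (EuclideanSpace ℝ (Fin N))).real (annulus N R₀ R₁) with hm
  have hm0 : 0 ≤ m := measureReal_nonneg
  rw [Metric.tendsto_atTop]
  intro ε hε
  set δ := min 1 (ε / (4 * (m + 1))) with hδ
  have hδ0 : 0 < δ := lt_min one_pos (by positivity)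
  have hδ1 : δ ≤ 1 := min_le_left _ _
  have hδ2 : δ * (4 * (m + 1)) ≤ ε := by
    rw [← le_div_iff₀ (by positivity)]
    exact min_le_right _ _
  obtain ⟨K, hK⟩ := h δ hδ0
  refine ⟨K, fun k hk => ?_⟩
  rw [Real.dist_eq, sub_zero, abs_of_nonneg (H1sq_nonneg _)]
  have h1 : H1sq N R₀ R₁ (fun x => v k x - w x) ≤ ∫ _ in annulus N R₀ R₁, 2 * δ := by
    refine setIntegral_mono_on (H1_cont hR₀ hR ((hv k).sub hw)) (integrableOn_of_cont
      continuousOn_const) isOpen_annulus.measurableSet fun x hx => ?_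
    obtain ⟨ha, hb⟩ := hK k hk x hx
    have h3 : |v k x - w x| ^ 2 ≤ δ ^ 2 := by gcongr
    have h4 : ‖fderivWithin ℝ (fun y => v k y - w y) (closure (annulus N R₀ R₁)) x‖ ^ 2 ≤ δ ^ 2 := by
      gcongr
    rw [sq_abs] at h3
    nlinarith
  rw [setIntegral_const, smul_eq_mul, ← hm] at h1
  nlinarith

lemma weak_limit (hN : 2 ≤ N) (hR₀ : 0 < R₀) (hR : R₀ < R₁) {p : ℝ} (hp : 2 < p)
    {a : EuclideanSpace ℝ (Fin N) → ℝ} (ha : memKhat N R₀ R₁ a) {B : ℝ}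
    {u v : ℕ → EuclideanSpace ℝ (Fin N) → ℝ} {w : EuclideanSpace ℝ (Fin N) → ℝ}
    (hu : ∀ n, memK N R₀ R₁ (u n)) (hw : memK N R₀ R₁ w)
    (hv : ∀ n, ContDiffOn ℝ 2 (v n) (closure (annulus N R₀ R₁)))
    (hveq : ∀ n, ∀ x ∈ annulus N R₀ R₁, lapl (v n) x = v n x - a x * u n x ^ (p - 1))
    (hB : ∀ n, H1sq N R₀ R₁ (u n) ≤ B)
    (hU : Filter.Tendsto (fun n => H1sq N R₀ R₁ (fun x => u n x - w x)) Filter.atTop (nhds 0))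
    (hV : Filter.Tendsto (fun n => H1sq N R₀ R₁ (fun x => v n x - w x)) Filter.atTop (nhds 0))
    {g : EuclideanSpace ℝ (Fin N) → ℝ} (hg : memC10 N R₀ R₁ g) :
    bil N R₀ R₁ w g = ∫ x in annulus N R₀ R₁, a x * w x ^ (p - 1) * g x := by
  have hfc : ∀ {u}, memK N R₀ R₁ u →
      ContinuousOn (fun x => a x * u x ^ (p - 1)) (closure (annulus N R₀ R₁)) :=
    fun hu => fcont (b := p - 1) (by linarith) ha.1.continuousOn hu.1.1.continuousOn
  obtain ⟨M, hM⟩ := isCompact_closure_annulus.exists_bound_of_continuousOn hg.1.continuousOn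
  have hv1 : ∀ n, ContDiffOn ℝ 1 (v n) (closure (annulus N R₀ R₁)) :=
    fun n => (hv n).of_le (by norm_num)
  refine eq_of_abs_sub_le_all fun ε hε => ?_
  have hH0 := H1sq_nonneg (N := N) (R₀ := R₀) (R₁ := R₁) g
  set H := H1sq N R₀ R₁ g with hH
  set ε0 := ε / (3 * (H + 1)) with hε0
  have hεpc : 0 < ε0 := by positivity
  set ε1 := ε / (3 * (|M| + 1)) with hε1
  have hεpa : 0 < ε1 := by positivity
  obtain ⟨η, hη0, hη⟩ := fdiff hN hR₀ hR hp ha (max B (H1sq N R₀ R₁ w)) (j := 1) le_rfl hεpa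
  obtain ⟨k, hk1, hk2⟩ := ((hU.eventually (gt_mem_nhds hη0)).and
    (hV.eventually (gt_mem_nhds (show 0 < 4 * ε0 * (ε / 3) by positivity)))).exists
  have h1 := bil_le hR₀ hR hg.1 ((hv1 k).sub hw.1.1) hεpc
  rw [bil_comm, bil_sub_left hR₀ hR (hv1 k) hw.1.1 hg.1,
    bil_weak (by omega) hR₀ hR (hv k) hg (hveq k) (hfc (hu k))] at h1
  have h2 : ε0 * H ≤ ε / 3 := by
    rw [hε0, div_mul_eq_mul_div, div_le_div_iff₀ (by positivity) (by norm_num)]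
    nlinarith
  have h3 : 1 / (4 * ε0) * H1sq N R₀ R₁ (fun x => v k x - w x) ≤ ε / 3 := by
    rw [one_div_mul_eq_div, div_le_iff₀ (by positivity)]
    linarith
  have h4 := hη _ _ (hu k) hw ((hB k).trans (le_max_left _ _)) (le_max_right _ _)
    ((sq_le_H1sq hR₀ hR ((hu k).1.1.sub hw.1.1)).trans hk1.le)
  have ik : IntegrableOn (fun x => a x * u k x ^ (p - 1) * g x) (annulus N R₀ R₁) :=
    integrableOn_of_cont ((hfc (hu k)).mul hg.1.continuousOn)
  have iw : IntegrableOn (fun x => a x * w x ^ (p - 1) * g x) (annulus N R₀ R₁) :=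
    integrableOn_of_cont ((hfc hw).mul hg.1.continuousOn)
  have h5 : |(∫ x in annulus N R₀ R₁, a x * u k x ^ (p - 1) * g x) -
      ∫ x in annulus N R₀ R₁, a x * w x ^ (p - 1) * g x| ≤ ε / 3 := by
    rw [← integral_sub ik iw]
    refine (abs_integral_le_integral_abs).trans ?_
    have h6 : ∫ x in annulus N R₀ R₁, |a x * u k x ^ (p - 1) * g x - a x * w x ^ (p - 1) * g x| ≤
        ∫ x in annulus N R₀ R₁, |a x * u k x ^ (p - 1) - a x * w x ^ (p - 1)| ^ 1 * (|M| + 1) := by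
      refine setIntegral_mono_on (ik.sub iw).abs
        (integrableOn_of_cont ((((hfc (hu k)).sub (hfc hw)).abs.pow 1).mul continuousOn_const))
        isOpen_annulus.measurableSet fun x hx => ?_
      rw [← sub_mul, abs_mul, pow_one]
      refine mul_le_mul_of_nonneg_left ?_ (abs_nonneg _)
      have := hM x (subset_closure hx)
      rw [Real.norm_eq_abs] at this
      linarith [le_abs_self M]
    rw [integral_mul_const] at h6
    refine h6.trans ((mul_le_mul_of_nonneg_right h4 (by positivity)).trans ?_)
    rw [hε1]
    apply le_of_eq
    field_simp
  rw [abs_le] at h1 h5 ⊢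
  constructor <;> linarith [h1.1, h1.2, h5.1, h5.2]

lemma weak_of_bil (hN : 2 ≤ N) {p : ℝ} (hp : 2 < p)
    {a w : EuclideanSpace ℝ (Fin N) → ℝ} (hw : memK N R₀ R₁ w)
    (h : ∀ g, memC10 N R₀ R₁ g →
      bil N R₀ R₁ w g = ∫ x in annulus N R₀ R₁, a x * w x ^ (p - 1) * g x) :
    IsWeakSolution N R₀ R₁ a p w := by
  refine ⟨memK_memC10 hw, fun φ hφ => ?_⟩
  have h1 := h φ (test_memC10 hφ)
  have e1 : bil N R₀ R₁ w φ = ∫ x in annulus N R₀ R₁,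
      (fderivWithin ℝ w (closure (annulus N R₀ R₁)) x (gradient φ x) + w x * φ x) := by
    refine setIntegral_congr_fun isOpen_annulus.measurableSet fun x hx => ?_
    rw [clm_grad]
    unfold blp
    congr 1
    refine Finset.sum_congr rfl fun i _ => ?_
    rw [pdv_eq (F := φ) hx]
    rfl
  rw [← e1, h1]
  refine setIntegral_congr_fun isOpen_annulus.measurableSet fun x hx => ?_
  have h0 := hw.1.2.1 x (subset_closure hx)
  show a x * w x ^ (p - 1) * φ x = a x * |w x| ^ (p - 2) * w x * φ x
  rw [abs_of_nonneg h0, mul_assoc (a x) (w x ^ (p - 2)), ← Real.rpow_add_one' h0 (by linarith)]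
  congr 3
  ring

theorem main11 (N : ℕ) (hN : 3 ≤ N) (R₀ R₁ : ℝ) (hR₀ : 0 < R₀) (hR : R₀ < R₁)
    (p : ℝ) (hp : 2 < p) (a : EuclideanSpace ℝ (Fin N) → ℝ)
    (ha : memKhat N R₀ R₁ a)
    (u v : ℕ → EuclideanSpace ℝ (Fin N) → ℝ)
    (hu : ∀ n, memK N R₀ R₁ (u n))
    (hv : ∀ n, ContDiffOn ℝ 2 (v n) (closure (annulus N R₀ R₁)))
    (hveq : ∀ n, ∀ x ∈ annulus N R₀ R₁, -lapl (v n) x + v n x = a x * u n x ^ (p - 1))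
    (hvbd : ∀ n, ∀ x : EuclideanSpace ℝ (Fin N), (‖x‖ = R₀ ∨ ‖x‖ = R₁) → v n x = 0)
    (hIbdd : ∃ C : ℝ, ∀ n, |funcI N R₀ R₁ a p (u n)| ≤ C)
    (hPS : Filter.Tendsto (fun n => Real.sqrt (H1sq N R₀ R₁ (fun x => u n x - v n x)))
      Filter.atTop (nhds 0)) :
    ∃ φ : ℕ → ℕ, StrictMono φ ∧
      ∃ w : EuclideanSpace ℝ (Fin N) → ℝ, memK N R₀ R₁ w ∧
        Filter.Tendsto (fun k => Real.sqrt (H1sq N R₀ R₁ (fun x => u (φ k) x - w x)))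
          Filter.atTop (nhds 0) ∧
        IsWeakSolution N R₀ R₁ a p w := by
  have hN2 : 2 ≤ N := by omega
  have hveq' : ∀ n, ∀ x ∈ annulus N R₀ R₁, lapl (v n) x = v n x - a x * u n x ^ (p - 1) := by
    intro n x hx
    linarith [hveq n x hx]
  have hv1 : ∀ n, ContDiffOn ℝ 1 (v n) (closure (annulus N R₀ R₁)) :=
    fun n => (hv n).of_le (by norm_num)
  have hvm : ∀ n, memC10 N R₀ R₁ (v n) := fun n => ⟨hv1 n, hvbd n⟩
  have hD : Filter.Tendsto (fun n => H1sq N R₀ R₁ (fun x => u n x - v n x))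
      Filter.atTop (nhds 0) := by
    have h := hPS.pow 2
    simpa only [Real.sq_sqrt (H1sq_nonneg _), ne_eq, OfNat.ofNat_ne_zero, not_false_eq_true,
      zero_pow] using h
  obtain ⟨D, hDb⟩ := hD.bddAbove_range
  have hDb' : ∀ n, H1sq N R₀ R₁ (fun x => u n x - v n x) ≤ D := fun n => hDb (mem_range_self n)
  obtain ⟨C, hC⟩ := hIbdd
  obtain ⟨B, hB⟩ : ∃ B, ∀ n, H1sq N R₀ R₁ (u n) ≤ B :=
    ⟨_, fun n => H1_bound_one (by omega) hR₀ hR hp ha (hu n) (hv n) (hveq' n) (hC n) (hDb' n)⟩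
  obtain ⟨L, hL0, hL⟩ : ∃ L, 0 ≤ L ∧ ∀ n, ∀ x ∈ annulus N R₀ R₁, ‖fderiv ℝ (v n) x‖ ≤ L := by
    obtain ⟨C1, hC10, hC1⟩ := grad_est hN2 hR₀ hR one_pos
    obtain ⟨Cf, hCf0, hCf⟩ := fbound hN2 hR₀ hR hp ha B (2 * N)
    have hB0 : 0 ≤ B := (H1sq_nonneg _).trans (hB 0)
    have hD0 : 0 ≤ D := (H1sq_nonneg _).trans (hDb' 0)
    refine ⟨1 + C1 * (Cf + (2 * B + 2 * D)), by positivity, fun n x hx => ?_⟩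
    refine (hC1 _ _ (hv n) (fcont (b := p - 1) (by linarith) ha.1.continuousOn
      (hu n).1.1.continuousOn) (hvbd n) (hveq' n) x hx).trans ?_
    have h1 := H1sq_sub_le hR₀ hR (hu n).1.1 ((hu n).1.1.sub (hv1 n))
    simp only [sub_sub_cancel] at h1
    have h2 := hCf _ (hu n) (hB n)
    have h3 := hB n
    have h4 := hDb' n
    gcongr
    linarith
  obtain ⟨φ, hφ, hcau⟩ := ascoli_seq hR₀ hvm hL0 hL
  have hDφ : Filter.Tendsto (fun k => H1sq N R₀ R₁ (fun x => u (φ k) x - v (φ k) x))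
      Filter.atTop (nhds 0) := hD.comp hφ.tendsto_atTop
  have hgc := grad_cauchy hN2 hR₀ hR hp ha (u := fun k => u (φ k)) (v := fun k => v (φ k))
    (fun k => hu _) (fun k => hv _) (fun k => hveq' _) (fun k => hvbd _) (fun k => hB _) hDφ hcau
  obtain ⟨w, hw, hwl⟩ := c1_limit hR₀ hR (v := fun k => v (φ k)) (fun k => hvm _) hgc
  have hV := H1sq_tendsto hR₀ hR (v := fun k => v (φ k)) (fun k => hv1 _) hw.1 hwl
  have hU : Filter.Tendsto (fun k => H1sq N R₀ R₁ (fun x => u (φ k) x - w x))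
      Filter.atTop (nhds 0) := by
    have h := (hDφ.const_mul 2).add (hV.const_mul 2)
    rw [mul_zero, add_zero] at h
    exact squeeze_zero (fun k => H1sq_nonneg _)
      (fun k => H1sq_tri hR₀ hR (hu _).1.1 hw.1 (hv1 _)) h
  have hU2 : Filter.Tendsto (fun k => ∫ x in annulus N R₀ R₁, (u (φ k) x - w x) ^ 2)
      Filter.atTop (nhds 0) :=
    squeeze_zero (fun k => integral_nonneg fun x => sq_nonneg _)
      (fun k => sq_le_H1sq hR₀ hR ((hu _).1.1.sub hw.1)) hU
  obtain ⟨ns, hns⟩ := ae_subseq (u := fun k => u (φ k)) (fun k => (hu _).1.1.continuousOn)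
    hw.1.continuousOn hU2
  have hwK : memK N R₀ R₁ w := memK_of_mono hN2 hR₀ hR hw
    (limit_nonneg hR₀ (u := fun k => u (φ k)) (fun k => hu _) hw hns)
    (limit_mono hN2 hR₀ (u := fun k => u (φ k)) (fun k => hu _) hw hns)
  refine ⟨φ, hφ, w, hwK, ?_, weak_of_bil hN2 hp hwK fun g hg => ?_⟩
  · have h := hU.sqrt
    rwa [Real.sqrt_zero] at h
  · exact weak_limit hN2 hR₀ hR hp ha (u := fun k => u (φ k)) (v := fun k => v (φ k))
      (fun k => hu _) hwK (fun k => hv _) (fun k => hveq' _) (fun k => hB _) hU hV hg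

end Part16

/-- Palais–Smale type condition in the cone `K`.
Here `v n = T (u n)` is the solution of the linear problem with right-hand side
`a(x) (u n)^{p−1}`. -/
theorem statement11 (N : ℕ) (hN : 3 ≤ N) (R₀ R₁ : ℝ) (hR₀ : 0 < R₀) (hR : R₀ < R₁)
    (p : ℝ) (hp : 2 < p) (a : EuclideanSpace ℝ (Fin N) → ℝ)
    (ha : memKhat N R₀ R₁ a) (hapos : ∀ x ∈ closure (annulus N R₀ R₁), 0 < a x)
    (u v : ℕ → EuclideanSpace ℝ (Fin N) → ℝ)
    (hu : ∀ n, memK N R₀ R₁ (u n))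
    (hv : ∀ n, ContDiffOn ℝ 2 (v n) (closure (annulus N R₀ R₁)))
    (hveq : ∀ n, ∀ x ∈ annulus N R₀ R₁, -lapl (v n) x + v n x = a x * u n x ^ (p - 1))
    (hvbd : ∀ n, ∀ x : EuclideanSpace ℝ (Fin N), (‖x‖ = R₀ ∨ ‖x‖ = R₁) → v n x = 0)
    (hIbdd : ∃ C : ℝ, ∀ n, |funcI N R₀ R₁ a p (u n)| ≤ C)
    (hPS : Filter.Tendsto (fun n => Real.sqrt (H1sq N R₀ R₁ (fun x => u n x - v n x)))
      Filter.atTop (nhds 0)) :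
    ∃ φ : ℕ → ℕ, StrictMono φ ∧
      ∃ w : EuclideanSpace ℝ (Fin N) → ℝ, memK N R₀ R₁ w ∧
        Filter.Tendsto (fun k => Real.sqrt (H1sq N R₀ R₁ (fun x => u (φ k) x - w x)))
          Filter.atTop (nhds 0) ∧
        IsWeakSolution N R₀ R₁ a p w := by
  exact main11 N hN R₀ R₁ hR₀ hR p hp a ha u v hu hv hveq hvbd hIbdd hPS
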